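/- arXiv:2107.00153 — 9 statements merged into one kernel-verified Lean document; each statement's English description precedes it below -/
import Mathlib

section
/- Let ε ∈ (0,1) and let α, β, θ be parameters of a valid PAPER model. Let G_n ~ PAPER(α, β, θ) be a random graph on vertex set [n] whose nodes are labeled by arrival time, and let G*_n = ρ G_n be the observed relabeled graph for any bijection ρ ∈ Bi([n], U_n). Then the level 1−ε Bayesian credible set for the root node satisfies P(ρ_1 ∈ B_ε(G*_n)) ≥ 1 − ε; that is, the credible set is a frequentist confidence set for the root node at the same level 1−ε. -/
open scoped Classical
open Finset

noncomputable section

/-- A parent map encoding a recursive tree on `Fin n` (nodes indexed by arrival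
time, `0`-indexed): node `0` is the root, and every node `t ≠ 0` attaches to the
earlier node `pa t`. -/
def IsParentMap {n : ℕ} (pa : Fin n → Fin n) : Prop :=
  (∀ t : Fin n, t.val = 0 → pa t = t) ∧ ∀ t : Fin n, t.val ≠ 0 → (pa t).val < t.val

/-- Degree of node `w` in the tree grown on the nodes `0, …, t`. -/
def degAt {n : ℕ} (pa : Fin n → Fin n) (t : ℕ) (w : Fin n) : ℕ :=
  (Finset.univ.filter (fun s : Fin n => 1 ≤ s.val ∧ s.val ≤ t ∧ pa s = w)).card +
    (if w.val ≠ 0 ∧ w.val ≤ t then 1 else 0)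

/-- Probability that the affine preferential attachment process `APA(α,β)`
produces the recursive tree encoded by `pa`: the product over arrival times of
the attachment probabilities `(β·deg + α) / (2·#edges·β + #nodes·α)`. -/
def apaProb {n : ℕ} (α β : ℝ) (pa : Fin n → Fin n) : ℝ :=
  ∏ t : Fin n,
    if 2 ≤ t.val then
      (β * degAt pa (t.val - 1) (pa t) + α) /
        (2 * ((t.val : ℝ) - 1) * β + (t.val : ℝ) * α)
    else 1

/-- The graph of the recursive tree encoded by `pa`. -/
def treeGraph {n : ℕ} (pa : Fin n → Fin n) : SimpleGraph (Fin n) :=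
  SimpleGraph.fromRel (fun i j => j.val ≠ 0 ∧ pa j = i)

/-- The mass function of `G_n ~ PAPER(α,β,θ)`: `G_n = T_n + R_n` is the union of
an `APA(α,β)` tree and an independent Erdős–Rényi(θ) graph (multi-edges collapsed). -/
def paperProb (n : ℕ) (α β θ : ℝ) (g : SimpleGraph (Fin n)) : ℝ :=
  θ ^ (g.edgeSet.ncard - (n - 1)) * (1 - θ) ^ (n * (n - 1) / 2 - g.edgeSet.ncard) *
    ∑ pa : Fin n → Fin n,
      if IsParentMap pa ∧ treeGraph pa ≤ g then apaProb α β pa else 0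

variable {U : Type} [Fintype U] [DecidableEq U]

/-- Posterior root probability `P(Π₁ = u | Π G_n = g̃)` where `Π` is a uniformly
random bijection (relabeling) `Fin n ≃ U` independent of `G_n ~ PAPER(α,β,θ)`. -/
def postRoot (n : ℕ) [NeZero n] (α β θ : ℝ) (g : SimpleGraph U) (u : U) : ℝ :=
  (∑ π : Fin n ≃ U, if π 0 = u then paperProb n α β θ (g.comap ⇑π) else 0) /
    ∑ π : Fin n ≃ U, paperProb n α β θ (g.comap ⇑π)

/-- The level `1-ε` credible set for the root: sort the nodes by decreasing
posterior root probability (ties broken by the order `σ`) and take the smallest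
initial segment whose posterior probabilities sum to at least `1-ε`.  A node `u`
belongs to the set iff the total posterior mass of the nodes strictly preceding
`u` is `< 1 - ε`. -/
def Bset (n : ℕ) [NeZero n] (α β θ ε : ℝ) (g : SimpleGraph U) (σ : U ≃ Fin n) : Set U :=
  {u | (∑ v : U,
      if postRoot n α β θ g u < postRoot n α β θ g v ∨
          (postRoot n α β θ g v = postRoot n α β θ g u ∧ σ v < σ u) then
        postRoot n α β θ g v
      else 0) < 1 - ε}


theorem Bmass_ge {U : Type} [Fintype U] {n : ℕ} (p : U → ℝ) (hp : ∀ u, 0 ≤ p u)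
    (hs : ∑ u, p u = 1) (ε : ℝ) (hε : 0 < ε) (σ : U ≃ Fin n) :
    1 - ε ≤ ∑ u, if (∑ v, if p u < p v ∨ (p v = p u ∧ σ v < σ u) then p v else 0) < 1 - ε
      then p u else 0 := by
  set B : Finset U := Finset.univ.filter
    (fun u => (∑ v, if p u < p v ∨ (p v = p u ∧ σ v < σ u) then p v else 0) < 1 - ε) with hB
  rw [← Finset.sum_filter, ← hB]
  by_cases hne : (Bᶜ).Nonempty
  · obtain ⟨u, hu, hmin⟩ := Finset.exists_min_image Bᶜ
      (fun u => toLex (OrderDual.toDual (p u), σ u)) hne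
    have hu' : 1 - ε ≤ (∑ v, if p u < p v ∨ (p v = p u ∧ σ v < σ u) then p v else 0) := by
      simpa [hB] using hu
    refine hu'.trans ?_
    rw [← Finset.sum_filter]
    refine Finset.sum_le_sum_of_subset_of_nonneg ?_ (fun i _ _ => hp i)
    intro v hv
    by_contra hvB
    have h := hmin v (Finset.mem_compl.2 hvB)
    have hv' : p u < p v ∨ (p v = p u ∧ σ v < σ u) := by simpa using hv
    refine absurd h (not_le.2 ?_)
    rw [Prod.Lex.toLex_lt_toLex]
    rcases hv' with h1 | ⟨h1, h2⟩
    · left; exact OrderDual.toDual_lt_toDual.2 h1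
    · right; exact ⟨by simp [h1], h2⟩
  · have : B = Finset.univ := by
      rw [Finset.not_nonempty_iff_eq_empty] at hne
      simpa using hne
    rw [this, hs]; linarith

theorem sum_graph_ge {n : ℕ} (T : SimpleGraph (Fin n)) (θ : ℝ) (hT : T.edgeSet.ncard = n - 1) :
    ∑ g : SimpleGraph (Fin n), (if T ≤ g then
      θ ^ (g.edgeSet.ncard - (n - 1)) * (1 - θ) ^ (n * (n - 1) / 2 - g.edgeSet.ncard) else 0) = 1 := by
  have hcard : ∀ g : SimpleGraph (Fin n), g.edgeSet.ncard = g.edgeFinset.card := by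
    intro g
    rw [← SimpleGraph.coe_edgeFinset, Set.ncard_coe_finset]
  have htop : n * (n - 1) / 2 = (⊤ : SimpleGraph (Fin n)).edgeFinset.card := by
    rw [SimpleGraph.card_edgeFinset_top_eq_card_choose_two, Fintype.card_fin, Nat.choose_two_right]
  rw [← Finset.sum_filter]
  have key := Finset.sum_pow_mul_eq_add_pow θ (1 - θ)
    ((⊤ : SimpleGraph (Fin n)).edgeFinset \ T.edgeFinset)
  rw [show θ + (1 - θ) = 1 by ring, one_pow] at key
  refine Eq.trans ?_ key
  have hTt : T.edgeFinset ⊆ (⊤ : SimpleGraph (Fin n)).edgeFinset :=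
    SimpleGraph.edgeFinset_subset_edgeFinset.2 le_top
  refine Finset.sum_bij' (fun g _ => g.edgeFinset \ T.edgeFinset)
    (fun S _ => SimpleGraph.fromEdgeSet (S : Set (Sym2 (Fin n))) ⊔ T) ?_ ?_ ?_ ?_ ?_
  · intro g hg
    rw [Finset.mem_powerset]
    exact Finset.sdiff_subset_sdiff (SimpleGraph.edgeFinset_subset_edgeFinset.2 le_top) le_rfl
  · intro S hS
    simp
  · intro g hg
    have hg' : T ≤ g := by simpa using hg
    apply SimpleGraph.edgeSet_injective
    ext e
    have h1 : e ∈ T.edgeSet → e ∈ g.edgeSet := fun h => SimpleGraph.edgeSet_subset_edgeSet.2 hg' h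
    have h2 : e ∈ g.edgeSet → ¬ e.IsDiag := fun h => SimpleGraph.not_isDiag_of_mem_edgeSet _ h
    simp
    tauto
  · intro S hS
    rw [Finset.mem_powerset] at hS
    ext e
    have h1 : e ∈ S → ¬ e.IsDiag ∧ e ∉ T.edgeSet := fun h => by simpa using hS h
    simp
    tauto
  · intro g hg
    have hg' : T ≤ g := by simpa using hg
    have hs : T.edgeFinset ⊆ g.edgeFinset := SimpleGraph.edgeFinset_subset_edgeFinset.2 hg'
    have hs2 : g.edgeFinset ⊆ (⊤ : SimpleGraph (Fin n)).edgeFinset :=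
      SimpleGraph.edgeFinset_subset_edgeFinset.2 le_top
    have c1 := Finset.card_le_card hs
    have c2 := Finset.card_le_card hs2
    rw [htop, ← hT, hcard, hcard, Finset.card_sdiff_of_subset hs, Finset.card_sdiff_of_subset hTt]
    congr 2
    omega

theorem tree_card {n : ℕ} [NeZero n] (pa : Fin n → Fin n) (h : IsParentMap pa) :
    (treeGraph pa).edgeSet.ncard = n - 1 := by
  have hset : (treeGraph pa).edgeSet = (fun t => s(pa t, t)) '' {t : Fin n | t ≠ 0} := by
    ext e
    induction e using Sym2.ind with
    | _ x y =>
      simp only [treeGraph, SimpleGraph.mem_edgeSet, SimpleGraph.fromRel_adj, Set.mem_image,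
        Set.mem_ofPred_eq, Sym2.eq_iff]
      constructor
      · rintro ⟨hne, ⟨h1, h2⟩ | ⟨h1, h2⟩⟩
        · exact ⟨y, fun h0 => h1 (by simp [h0]), Or.inl ⟨h2, rfl⟩⟩
        · exact ⟨x, fun h0 => h1 (by simp [h0]), Or.inr ⟨h2, rfl⟩⟩
      · rintro ⟨t, ht, ⟨h1, h2⟩ | ⟨h1, h2⟩⟩
        · have ht' : t.val ≠ 0 := fun h0 => ht (Fin.ext (by simpa using h0))
          have := h.2 t ht'
          subst h1 h2
          exact ⟨fun hh => by rw [hh] at this; omega, Or.inl ⟨ht', rfl⟩⟩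
        · have ht' : t.val ≠ 0 := fun h0 => ht (Fin.ext (by simpa using h0))
          have := h.2 t ht'
          subst h1 h2
          exact ⟨fun hh => by rw [← hh] at this; omega, Or.inr ⟨ht', rfl⟩⟩
  rw [hset, Set.ncard_image_of_injOn]
  · rw [show {t : Fin n | t ≠ 0} = ((Finset.univ.erase (0 : Fin n) : Finset (Fin n)) : Set (Fin n)) by
      ext; simp, Set.ncard_coe_finset, Finset.card_erase_of_mem (Finset.mem_univ _)]
    simp
  · intro s hs t ht hst
    have hs' : s.val ≠ 0 := fun h0 => hs (Fin.ext (by simpa using h0))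
    have ht' : t.val ≠ 0 := fun h0 => ht (Fin.ext (by simpa using h0))
    have a := h.2 s hs'
    have b := h.2 t ht'
    simp only [Sym2.eq_iff] at hst
    rcases hst with h1 | ⟨h1, h2⟩
    · exact h1.2
    · rw [h1] at a; rw [← h2] at b; omega

theorem den_pos (α β : ℝ) (hβ : 0 ≤ β) (hαβ : 0 < α + β) (t : ℕ) (ht : 2 ≤ t) :
    0 < 2 * ((t : ℝ) - 1) * β + (t : ℝ) * α := by
  have h2 : (2 : ℝ) ≤ t := by exact_mod_cast ht
  nlinarith [mul_pos (show (0:ℝ) < t by linarith) hαβ, mul_nonneg (sub_nonneg.2 h2) hβ]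

theorem degAt_pos {n : ℕ} (pa : Fin n → Fin n) (h : IsParentMap pa) (t : ℕ) (ht : 1 ≤ t)
    (htn : t < n) (w : Fin n) (hw : w.val ≤ t) : 1 ≤ degAt pa t w := by
  unfold degAt
  by_cases h0 : w.val = 0
  · have : 0 < (Finset.univ.filter (fun s : Fin n => 1 ≤ s.val ∧ s.val ≤ t ∧ pa s = w)).card := by
      rw [Finset.card_pos]
      refine ⟨⟨1, by omega⟩, ?_⟩
      have := h.2 ⟨1, by omega⟩ (by simp)
      simp only [Finset.mem_filter, Finset.mem_univ, true_and]
      refine ⟨le_rfl, ht, Fin.ext ?_⟩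
      simp at this
      omega
    omega
  · simp [h0, hw]

theorem apaProb_nonneg {n : ℕ} (α β : ℝ) (hβ : 0 ≤ β) (hαβ : 0 < α + β) (pa : Fin n → Fin n)
    (h : IsParentMap pa) : 0 ≤ apaProb α β pa := by
  unfold apaProb
  refine Finset.prod_nonneg fun t _ => ?_
  split_ifs with ht
  · refine div_nonneg ?_ (den_pos α β hβ hαβ _ ht).le
    have h1 := h.2 t (by omega)
    have := degAt_pos pa h (t.val - 1) (by omega) (by omega) (pa t) (by omega)
    have : (1 : ℝ) ≤ (degAt pa (t.val - 1) (pa t) : ℝ) := by exact_mod_cast this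
    nlinarith
  · exact zero_le_one

/-- attachment kernel including validity indicator -/
def qk {n : ℕ} (α β : ℝ) (t : Fin n) (pa : Fin n → Fin n) : ℝ :=
  if (t.val = 0 → pa t = t) ∧ (t.val ≠ 0 → (pa t).val < t.val) then
    (if 2 ≤ t.val then
      (β * degAt pa (t.val - 1) (pa t) + α) /
        (2 * ((t.val : ℝ) - 1) * β + (t.val : ℝ) * α)
    else 1) else 0

theorem degAt_update {n : ℕ} (pa : Fin n → Fin n) (k w x : Fin n) (t : ℕ) (ht : t < k.val) :
    degAt (Function.update pa k w) t x = degAt pa t x := by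
  unfold degAt
  congr 2
  ext s
  simp only [Finset.mem_filter, Finset.mem_univ, true_and]
  by_cases hs : s = k
  · subst hs; constructor <;> (intro h; omega)
  · rw [Function.update_of_ne hs]

theorem qk_update {n : ℕ} (α β : ℝ) (t k w : Fin n) (h : t.val < k.val) (pa : Fin n → Fin n) :
    qk α β t (Function.update pa k w) = qk α β t pa := by
  unfold qk
  have hne : t ≠ k := fun hh => by rw [hh] at h; omega
  rw [Function.update_of_ne hne, degAt_update _ _ _ _ _ (by omega)]

theorem card_lt {n : ℕ} (k : Fin n) : (Finset.univ.filter (fun w : Fin n => w.val < k.val)).card = k.val := by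
  have : (Finset.univ.filter (fun w : Fin n => w.val < k.val)) = Finset.Iio k := by
    ext x; rw [Finset.mem_filter, Finset.mem_Iio, Fin.lt_def]; simp
  rw [this, Fin.card_Iio]

theorem sum_deg {n : ℕ} (pa : Fin n → Fin n) (k : Fin n) (hk : 1 ≤ k.val)
    (hv : ∀ s : Fin n, s.val ≠ 0 → s.val < k.val → (pa s).val < s.val) :
    ∑ w ∈ Finset.univ.filter (fun w : Fin n => w.val < k.val), degAt pa (k.val - 1) w
      = 2 * (k.val - 1) := by
  have hE : (Finset.univ.filter (fun w : Fin n => 1 ≤ w.val ∧ w.val ≤ k.val - 1)).card = k.val - 1 := by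
    have hn : 0 < n := by have := k.isLt; omega
    have e : (Finset.univ.filter (fun w : Fin n => 1 ≤ w.val ∧ w.val ≤ k.val - 1))
        = (Finset.univ.filter (fun w : Fin n => w.val < k.val)).erase ⟨0, hn⟩ := by
      ext x
      simp [Fin.ext_iff]
      omega
    have hm : (⟨0, hn⟩ : Fin n) ∈ Finset.univ.filter (fun w : Fin n => w.val < k.val) :=
      Finset.mem_filter.2 ⟨Finset.mem_univ _, by show 0 < k.val; omega⟩
    rw [e, Finset.card_erase_of_mem hm, card_lt]
  unfold degAt
  rw [Finset.sum_add_distrib]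
  have h1 : ∑ w ∈ Finset.univ.filter (fun w : Fin n => w.val < k.val),
      (Finset.univ.filter (fun s : Fin n => 1 ≤ s.val ∧ s.val ≤ k.val - 1 ∧ pa s = w)).card = k.val - 1 := by
    refine Eq.trans ?_ hE
    rw [Finset.card_eq_sum_card_fiberwise (f := pa)
      (t := Finset.univ.filter (fun w : Fin n => w.val < k.val))]
    · refine Finset.sum_congr rfl fun w _ => ?_
      congr 1
      ext s
      simp [and_assoc]
    · intro s hs
      have hs' : 1 ≤ s.val ∧ s.val ≤ k.val - 1 := by simpa using hs
      have := hv s (by omega) (by omega)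
      simp
      omega
  have h2 : ∑ w ∈ Finset.univ.filter (fun w : Fin n => w.val < k.val),
      (if w.val ≠ 0 ∧ w.val ≤ k.val - 1 then 1 else 0) = k.val - 1 := by
    refine Eq.trans ?_ hE
    rw [← Finset.sum_filter, Finset.filter_filter, Finset.sum_const, smul_eq_mul, mul_one]
    congr 1
    ext x
    simp only [Finset.mem_filter, Finset.mem_univ, true_and]
    omega
  rw [h1, h2]
  omega

theorem sum_qk {n : ℕ} (α β : ℝ) (hβ : 0 ≤ β) (hαβ : 0 < α + β) (pa : Fin n → Fin n) (k : Fin n)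
    (hv : ∀ s : Fin n, s.val ≠ 0 → s.val < k.val → (pa s).val < s.val) :
    ∑ w, qk α β k (Function.update pa k w) = 1 := by
  unfold qk
  simp only [Function.update_self]
  rcases Nat.lt_or_ge k.val 2 with hk | hk
  · have hk' : ¬ 2 ≤ k.val := by omega
    simp only [hk', if_false]
    rw [← Finset.sum_filter, Finset.sum_const, nsmul_eq_mul, mul_one]
    rw [Nat.cast_eq_one, Finset.card_eq_one]
    refine ⟨⟨0, by have := k.isLt; omega⟩, ?_⟩
    ext x
    simp [Fin.ext_iff]
    omega
  · have hd := den_pos α β hβ hαβ _ hk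
    simp only [hk, if_true]
    rw [← Finset.sum_filter]
    have e : (Finset.univ.filter (fun w : Fin n => (k.val = 0 → w = k) ∧ (k.val ≠ 0 → w.val < k.val)))
        = Finset.univ.filter (fun w : Fin n => w.val < k.val) := by
      ext x
      simp only [Finset.mem_filter, Finset.mem_univ, true_and]
      have : k.val ≠ 0 := by omega
      tauto
    rw [e, ← Finset.sum_div, div_eq_one_iff_eq hd.ne', Finset.sum_add_distrib, ← Finset.mul_sum]
    have hs := sum_deg pa k (by omega) hv
    have hs2 : ∑ w ∈ Finset.univ.filter (fun w : Fin n => w.val < k.val),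
        ((degAt (Function.update pa k w) (k.val - 1) w : ℕ) : ℝ) = 2 * ((k.val : ℝ) - 1) := by
      rw [Finset.sum_congr rfl (fun w _ => by rw [degAt_update _ _ _ _ _ (by omega)]),
        ← Nat.cast_sum, hs]
      push_cast [Nat.cast_sub (show 1 ≤ k.val by omega)]
      ring
    rw [hs2, Finset.sum_const, card_lt, nsmul_eq_mul]
    ring

theorem sum_update {n : ℕ} (f : (Fin n → Fin n) → ℝ) (k : Fin n) :
    ∑ pa, ∑ w, f (Function.update pa k w) = n * ∑ pa, f pa := by
  rw [← Finset.sum_product']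
  have : (n : ℝ) * ∑ pa, f pa = ∑ x ∈ (Finset.univ : Finset (Fin n → Fin n)) ×ˢ (Finset.univ : Finset (Fin n)), f x.1 := by
    rw [Finset.sum_product]
    simp [Finset.mul_sum]
  rw [this]
  refine Finset.sum_bij' (fun x _ => (Function.update x.1 k x.2, x.1 k))
    (fun x _ => (Function.update x.1 k x.2, x.1 k)) ?_ ?_ ?_ ?_ ?_ <;> simp

theorem sum_prod_qk {n : ℕ} (α β : ℝ) (hβ : 0 ≤ β) (hαβ : 0 < α + β) (k : ℕ) (hk : k ≤ n) :
    (n : ℝ) ^ k * ∑ pa : Fin n → Fin n,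
      ∏ t ∈ Finset.univ.filter (fun t : Fin n => t.val < k), qk α β t pa = (n : ℝ) ^ n := by
  induction k with
  | zero => simp
  | succ k ih =>
    rw [← ih (by omega), pow_succ, mul_assoc]
    congr 1
    set K : Fin n := ⟨k, by omega⟩ with hK
    rw [← sum_update _ K]
    refine Finset.sum_congr rfl fun pa _ => ?_
    have e : Finset.univ.filter (fun t : Fin n => t.val < k + 1)
        = insert K (Finset.univ.filter (fun t : Fin n => t.val < k)) := by
      ext x; simp [hK, Fin.ext_iff]; omega
    have hn : K ∉ Finset.univ.filter (fun t : Fin n => t.val < k) := by simp [hK]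
    have step : ∀ w, ∏ t ∈ Finset.univ.filter (fun t : Fin n => t.val < k + 1),
        qk α β t (Function.update pa K w) = qk α β K (Function.update pa K w) *
        ∏ t ∈ Finset.univ.filter (fun t : Fin n => t.val < k), qk α β t pa := by
      intro w
      rw [e, Finset.prod_insert hn]
      congr 1
      refine Finset.prod_congr rfl fun t ht => ?_
      exact qk_update _ _ _ _ _ (by simpa [hK] using ht) _
    rw [Finset.sum_congr rfl (fun w _ => step w), ← Finset.sum_mul]
    by_cases hv : ∀ s : Fin n, s.val ≠ 0 → s.val < K.val → (pa s).val < s.val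
    · rw [sum_qk α β hβ hαβ pa K hv, one_mul]
    · push Not at hv
      obtain ⟨s, h0, h1, h2⟩ := hv
      rw [Finset.prod_eq_zero (i := s) (by simpa [hK] using h1), mul_zero]
      unfold qk
      rw [if_neg]
      rintro ⟨_, h3⟩
      have := h3 h0
      omega

theorem sum_apa (n : ℕ) [NeZero n] (α β : ℝ) (hβ : 0 ≤ β) (hαβ : 0 < α + β) :
    ∑ pa : Fin n → Fin n, (if IsParentMap pa then apaProb α β pa else 0) = 1 := by
  have h := sum_prod_qk (n := n) α β hβ hαβ n le_rfl
  have hn : (n : ℝ) ^ n ≠ 0 := pow_ne_zero _ (Nat.cast_ne_zero.2 (NeZero.ne n))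
  have h' := mul_left_cancel₀ hn (h.trans (mul_one _).symm)
  rw [← h']
  refine Finset.sum_congr rfl fun pa _ => ?_
  rw [show (Finset.univ.filter (fun t : Fin n => t.val < n)) = Finset.univ by ext; simp]
  split_ifs with hp
  · unfold apaProb
    refine Finset.prod_congr rfl fun t _ => ?_
    unfold qk
    rw [if_pos (c := (t.val = 0 → pa t = t) ∧ (t.val ≠ 0 → (pa t).val < t.val)) ⟨hp.1 t, hp.2 t⟩]
  · have : ∃ t, ¬ ((t.val = 0 → pa t = t) ∧ (t.val ≠ 0 → (pa t).val < t.val)) := by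
      by_contra hc
      push Not at hc
      exact hp ⟨fun t => (hc t).1, fun t => (hc t).2⟩
    obtain ⟨t, ht⟩ := this
    rw [Finset.prod_eq_zero (Finset.mem_univ t)]
    unfold qk
    rw [if_neg ht]

theorem sum_paper (n : ℕ) [NeZero n] (α β θ : ℝ) (hβ : 0 ≤ β) (hαβ : 0 < α + β) :
    ∑ g : SimpleGraph (Fin n), paperProb n α β θ g = 1 := by
  unfold paperProb
  simp only [Finset.mul_sum]
  rw [Finset.sum_comm]
  refine Eq.trans ?_ (sum_apa n α β hβ hαβ)
  refine Finset.sum_congr rfl fun pa _ => ?_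
  split_ifs with hp
  · refine Eq.trans ?_ ((congrArg (apaProb α β pa * ·)
      (sum_graph_ge (treeGraph pa) θ (tree_card pa hp))).trans (mul_one _))
    simp only [Finset.mul_sum]
    refine Finset.sum_congr rfl fun g _ => ?_
    by_cases hg : treeGraph pa ≤ g
    · simp only [hp, hg, and_self, if_true]
      ring
    · simp [hg]
  · simp [hp]

theorem paper_nonneg (n : ℕ) (α β θ : ℝ) (hβ : 0 ≤ β) (hαβ : 0 < α + β) (hθ0 : 0 ≤ θ) (hθ1 : θ ≤ 1)
    (g : SimpleGraph (Fin n)) : 0 ≤ paperProb n α β θ g := by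
  unfold paperProb
  refine mul_nonneg (mul_nonneg (pow_nonneg hθ0 _) (pow_nonneg (by linarith) _))
    (Finset.sum_nonneg fun pa _ => ?_)
  split_ifs with h
  · exact apaProb_nonneg α β hβ hαβ pa h.1
  · exact le_rfl

theorem postRoot_relabel {U : Type} [Fintype U] [DecidableEq U] (n : ℕ) [NeZero n] (α β θ : ℝ)
    (g : SimpleGraph U) (τ : U ≃ U) (u : U) :
    postRoot n α β θ (g.comap ⇑τ.symm) (τ u) = postRoot n α β θ g u := by
  unfold postRoot
  have hc : ∀ π : Fin n ≃ U, (g.comap ⇑τ.symm).comap ⇑(π.trans τ) = g.comap ⇑π := by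
    intro π; ext; simp
  congr 1
  · symm
    refine Fintype.sum_equiv ((Equiv.refl (Fin n)).equivCongr τ) _ _ fun π => ?_
    rw [show ((Equiv.refl (Fin n)).equivCongr τ) π = π.trans τ from rfl, hc]
    simp
  · symm
    refine Fintype.sum_equiv ((Equiv.refl (Fin n)).equivCongr τ) _ _ fun π => ?_
    rw [show ((Equiv.refl (Fin n)).equivCongr τ) π = π.trans τ from rfl, hc]

theorem Bset_relabel {U : Type} [Fintype U] [DecidableEq U] (n : ℕ) [NeZero n] (α β θ ε : ℝ)
    (g : SimpleGraph U) (σ : U ≃ Fin n) (τ : U ≃ U) (u : U) :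
    τ u ∈ Bset n α β θ ε (g.comap ⇑τ.symm) (τ.symm.trans σ) ↔ u ∈ Bset n α β θ ε g σ := by
  unfold Bset
  simp only [Set.mem_ofPred_eq]
  rw [← Equiv.sum_comp τ]
  simp only [postRoot_relabel, Equiv.trans_apply, Equiv.symm_apply_apply]

theorem Bset_mass {U : Type} [Fintype U] [DecidableEq U] (n : ℕ) [NeZero n] (α β θ ε : ℝ)
    (hβ : 0 ≤ β) (hαβ : 0 < α + β) (hθ0 : 0 ≤ θ) (hθ1 : θ ≤ 1)
    (hε0 : 0 < ε) (g : SimpleGraph U) (σ : U ≃ Fin n) :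
    (1 - ε) * ∑ π : Fin n ≃ U, paperProb n α β θ (g.comap ⇑π) ≤
      ∑ π : Fin n ≃ U, if π 0 ∈ Bset n α β θ ε g σ then paperProb n α β θ (g.comap ⇑π) else 0 := by
  have hnn : ∀ π : Fin n ≃ U, 0 ≤ paperProb n α β θ (g.comap ⇑π) :=
    fun π => paper_nonneg n α β θ hβ hαβ hθ0 hθ1 _
  have hZ0 := Finset.sum_nonneg (s := Finset.univ) (fun π _ => hnn π)
  set Z := ∑ π : Fin n ≃ U, paperProb n α β θ (g.comap ⇑π) with hZ
  rcases hZ0.eq_or_lt with h0 | hpos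
  · rw [← h0, mul_zero]
    refine Finset.sum_nonneg fun π _ => ?_
    split_ifs
    · exact hnn π
    · exact le_rfl
  · have hpZ : ∀ u, postRoot n α β θ g u * Z =
        ∑ π : Fin n ≃ U, if π 0 = u then paperProb n α β θ (g.comap ⇑π) else 0 := by
      intro u
      unfold postRoot
      rw [← hZ, div_mul_cancel₀ _ hpos.ne']
    have hp : ∀ u, 0 ≤ postRoot n α β θ g u := by
      intro u
      unfold postRoot
      refine div_nonneg (Finset.sum_nonneg fun π _ => ?_) hpos.le
      split_ifs
      · exact hnn π
      · exact le_rfl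
    have hs : ∑ u, postRoot n α β θ g u = 1 := by
      refine mul_right_cancel₀ hpos.ne' ?_
      rw [Finset.sum_mul, Finset.sum_congr rfl (fun u _ => hpZ u), Finset.sum_comm, one_mul, hZ]
      simp
    have hm := Bmass_ge _ hp hs ε hε0 σ
    refine (mul_le_mul_of_nonneg_right hm hpos.le).trans (le_of_eq ?_)
    rw [Finset.sum_mul]
    have hterm : ∀ u : U, (if (∑ v, if postRoot n α β θ g u < postRoot n α β θ g v ∨
        (postRoot n α β θ g v = postRoot n α β θ g u ∧ σ v < σ u) then postRoot n α β θ g v else 0)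
          < 1 - ε then postRoot n α β θ g u else 0) * Z
        = ∑ π : Fin n ≃ U, if π 0 = u then
          (if π 0 ∈ Bset n α β θ ε g σ then paperProb n α β θ (g.comap ⇑π) else 0) else 0 := by
      intro u
      split_ifs with hu
      · rw [hpZ]
        refine Finset.sum_congr rfl fun π _ => ?_
        by_cases h : π 0 = u
        · rw [if_pos h, if_pos h, if_pos (by rw [h]; exact hu)]
        · rw [if_neg h, if_neg h]
      · rw [zero_mul]
        symm
        refine Finset.sum_eq_zero fun π _ => ?_
        by_cases h : π 0 = u
        · rw [if_pos h, if_neg (by rw [h]; exact hu)]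
        · rw [if_neg h]
    rw [Finset.sum_congr rfl (fun u _ => hterm u), Finset.sum_comm]
    simp

/-- graph relabelling as an equivalence -/
def graphEquiv {n : ℕ} {U : Type} (π : Fin n ≃ U) : SimpleGraph U ≃ SimpleGraph (Fin n) where
  toFun g := g.comap ⇑π
  invFun g := g.comap ⇑π.symm
  left_inv g := by ext; simp
  right_inv g := by ext; simp

/-- symmetry: coverage does not depend on the labelling -/
theorem cover_const {U : Type} [Fintype U] [DecidableEq U] (n : ℕ) [NeZero n] (α β θ ε : ℝ)
    (ρ π : Fin n ≃ U) :
    (∑ σ : U ≃ Fin n, ∑ g : SimpleGraph (Fin n),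
      if ρ 0 ∈ Bset n α β θ ε (g.comap ⇑ρ.symm) σ then paperProb n α β θ g else 0) =
    ∑ σ : U ≃ Fin n, ∑ g : SimpleGraph (Fin n),
      if π 0 ∈ Bset n α β θ ε (g.comap ⇑π.symm) σ then paperProb n α β θ g else 0 := by
  set τ : U ≃ U := ρ.symm.trans π with hτ
  refine Fintype.sum_equiv (τ.equivCongr (Equiv.refl (Fin n))) _ _ fun σ => ?_
  refine Finset.sum_congr rfl fun g _ => ?_
  have h := Bset_relabel n α β θ ε (g.comap ⇑ρ.symm) σ τ (ρ 0)
  have e1 : τ (ρ 0) = π 0 := by simp [hτ]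
  have e2 : (g.comap ⇑ρ.symm).comap ⇑τ.symm = g.comap ⇑π.symm := by ext; simp [hτ]
  rw [e1, e2] at h
  rw [show (τ.equivCongr (Equiv.refl (Fin n))) σ = τ.symm.trans σ from rfl]
  simp only [h]

theorem root_credible_set_coverage
    (n : ℕ) [NeZero n] (U : Type) [Fintype U] [DecidableEq U]
    (α β θ ε : ℝ)
    (hβ : 0 ≤ β) (hαβ : 0 < α + β) (hθ0 : 0 ≤ θ) (hθ1 : θ ≤ 1)
    (hε0 : 0 < ε) (hε1 : ε < 1)
    (ρ : Fin n ≃ U) :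
    1 - ε ≤
      (Nat.factorial n : ℝ)⁻¹ *
        ∑ σ : U ≃ Fin n, ∑ g : SimpleGraph (Fin n),
          if ρ 0 ∈ Bset n α β θ ε (g.comap ⇑ρ.symm) σ then paperProb n α β θ g else 0 := by
  set F : (Fin n ≃ U) → ℝ := fun π => ∑ σ : U ≃ Fin n, ∑ g : SimpleGraph (Fin n),
      if π 0 ∈ Bset n α β θ ε (g.comap ⇑π.symm) σ then paperProb n α β θ g else 0 with hF
  have hcU : Fintype.card U = n := by rw [← Fintype.card_congr ρ, Fintype.card_fin]
  have hc1 : Fintype.card (Fin n ≃ U) = n.factorial := by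
    rw [Fintype.card_equiv ρ, Fintype.card_fin]
  have hc2 : Fintype.card (U ≃ Fin n) = n.factorial := by
    rw [Fintype.card_equiv ρ.symm, hcU]
  have hfac : (0 : ℝ) < n.factorial := by exact_mod_cast n.factorial_pos
  have hconst : ∑ π, F π = n.factorial * F ρ := by
    rw [Finset.sum_congr rfl (fun π _ => (cover_const n α β θ ε π ρ : F π = F ρ)),
      Finset.sum_const, Finset.card_univ, hc1, nsmul_eq_mul]
  have hswap : ∑ π, F π = ∑ σ : U ≃ Fin n, ∑ g : SimpleGraph U, ∑ π : Fin n ≃ U,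
      if π 0 ∈ Bset n α β θ ε g σ then paperProb n α β θ (g.comap ⇑π) else 0 := by
    rw [hF, Finset.sum_comm]
    refine Finset.sum_congr rfl fun σ _ => ?_
    rw [Finset.sum_comm (s := (Finset.univ : Finset (SimpleGraph U)))]
    refine Finset.sum_congr rfl fun π _ => ?_
    symm
    refine Fintype.sum_equiv (graphEquiv π) _ _ fun g => ?_
    have : ((graphEquiv π) g).comap ⇑π.symm = g := (graphEquiv π).left_inv g
    rw [this]
    rfl
  have hZ : ∑ g : SimpleGraph U, ∑ π : Fin n ≃ U, paperProb n α β θ (g.comap ⇑π) = n.factorial := by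
    rw [Finset.sum_comm]
    have : ∀ π : Fin n ≃ U, ∑ g : SimpleGraph U, paperProb n α β θ (g.comap ⇑π) = 1 := by
      intro π
      rw [← sum_paper n α β θ hβ hαβ]
      exact Fintype.sum_equiv (graphEquiv π) _ _ fun g => rfl
    rw [Finset.sum_congr rfl (fun π _ => this π), Finset.sum_const, Finset.card_univ, hc1]
    simp
  have hge : (n.factorial : ℝ) * ((1 - ε) * n.factorial) ≤ ∑ π, F π := by
    rw [hswap]
    calc (n.factorial : ℝ) * ((1 - ε) * n.factorial)
        = ∑ σ : U ≃ Fin n, ∑ g : SimpleGraph U,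
          (1 - ε) * ∑ π : Fin n ≃ U, paperProb n α β θ (g.comap ⇑π) := by
          rw [← Finset.mul_sum, hZ, Finset.sum_const, Finset.card_univ, hc2, nsmul_eq_mul]
      _ ≤ _ := Finset.sum_le_sum fun σ _ => Finset.sum_le_sum fun g _ =>
          Bset_mass n α β θ ε hβ hαβ hθ0 hθ1 hε0 g σ
  rw [hconst] at hge
  have hfin := le_of_mul_le_mul_left hge hfac
  change 1 - ε ≤ (Nat.factorial n : ℝ)⁻¹ * F ρ
  rw [inv_mul_eq_div, le_div_iff₀ hfac]
  exact hfin
end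
end

section
/- Let ε ∈ (0,1) and let G_n ~ PAPER(α, β, K, θ) (fixed K roots) or G_n ~ PAPER(α, β, α₀, θ) (random number of roots), with S ⊂ [n] the set of root nodes (S = [K] in the fixed-K model; S is the random set of nodes that start new component trees in the random-K model). Let G*_n = ρ G_n be the observed relabeled graph for any bijection ρ ∈ Bi([n], U_n). Then the credible set B_ε built from posterior root-membership probabilities satisfies P(ρS ⊆ B_ε(G*_n)) ≥ 1 − ε. -/
open scoped Classical
open Finset

noncomputable section

/-! ### The multi-root preferential attachment forest models -/

/-- A parent map encoding a `K`-rooted recursive forest on `Fin n`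
(nodes indexed by arrival time, `0`-indexed): the nodes `0,…,K-1` are roots
(encoded as self-parents) and every node `t ≥ K` attaches to an earlier node. -/
def IsForestMap (n K : ℕ) (pa : Fin n → Fin n) : Prop :=
  (∀ t : Fin n, t.val < K → pa t = t) ∧ ∀ t : Fin n, K ≤ t.val → (pa t).val < t.val

/-- Degree of node `w` in the fixed-`K` forest grown on the nodes `0, …, t`
(the imaginary self-loops of the roots are not counted). -/
def degAtK {n : ℕ} (K : ℕ) (pa : Fin n → Fin n) (t : ℕ) (w : Fin n) : ℕ :=
  (Finset.univ.filter (fun s : Fin n => K ≤ s.val ∧ s.val ≤ t ∧ pa s = w)).card +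
    (if K ≤ w.val ∧ w.val ≤ t then 1 else 0)

/-- Probability that the process `APA(α,β,K)` produces the forest `pa`:
node `t ≥ K` attaches to `w` with probability
`(β·deg(w) + 2β·1{w is a root} + α)/((2β+α)·#existing nodes)`. -/
def apaKProb {n : ℕ} (K : ℕ) (α β : ℝ) (pa : Fin n → Fin n) : ℝ :=
  ∏ t : Fin n,
    if K ≤ t.val then
      (β * degAtK K pa (t.val - 1) (pa t) + 2 * β * (if (pa t).val < K then 1 else 0) + α) /
        ((2 * β + α) * (t.val : ℝ))
    else 1

/-- The graph of the fixed-`K` recursive forest encoded by `pa`. -/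
def forestGraph {n : ℕ} (K : ℕ) (pa : Fin n → Fin n) : SimpleGraph (Fin n) :=
  SimpleGraph.fromRel (fun i j => K ≤ j.val ∧ pa j = i)

/-- A parent map encoding a recursive forest with a random set of roots
(random-`K` model): each node is either a root (a self-parent) or attaches to an
earlier node.  Node `0` is necessarily a root. -/
def IsRForestMap {n : ℕ} (pa : Fin n → Fin n) : Prop :=
  ∀ t : Fin n, pa t = t ∨ (pa t).val < t.val

/-- The (random) set of roots of a random-`K` forest: nodes that start a new
component tree. -/
def rootsR {n : ℕ} (pa : Fin n → Fin n) : Finset (Fin n) :=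
  Finset.univ.filter (fun t : Fin n => pa t = t)

/-- Degree of node `w` in the random-`K` forest grown on the nodes `0, …, t`
(imaginary self-loops of roots not counted). -/
def degAtR {n : ℕ} (pa : Fin n → Fin n) (t : ℕ) (w : Fin n) : ℕ :=
  (Finset.univ.filter (fun s : Fin n => s.val ≤ t ∧ pa s = w ∧ s ≠ w)).card +
    (if pa w ≠ w ∧ w.val ≤ t then 1 else 0)

/-- Probability that the process `APA(α,β,α₀)` produces the forest `pa`:
node `t ≥ 1` becomes a new root with probability `α₀/((2β+α)·t + α₀)` and
attaches to an existing node `w` with probability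
`(β·deg(w) + α + 2β·1{w is a root})/((2β+α)·t + α₀)`. -/
def apaRProb {n : ℕ} (α β α₀ : ℝ) (pa : Fin n → Fin n) : ℝ :=
  ∏ t : Fin n,
    if t.val ≠ 0 then
      (if pa t = t then α₀
       else β * degAtR pa (t.val - 1) (pa t) + α +
         2 * β * (if pa (pa t) = pa t then 1 else 0)) /
        ((2 * β + α) * (t.val : ℝ) + α₀)
    else 1

/-- The graph of the random-`K` recursive forest encoded by `pa`. -/
def forestGraphR {n : ℕ} (pa : Fin n → Fin n) : SimpleGraph (Fin n) :=
  SimpleGraph.fromRel (fun i j => pa j = i ∧ pa j ≠ j)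

/-- Erdős–Rényi noise weight for observing the graph `g` given a latent spanning
forest with `K` component trees (so `n - K` forest edges): each of the
`m - (n - K)` non-forest edges appears with probability `θ` and each of the
`n(n-1)/2 - m` non-edges is absent with probability `1-θ`. -/
def noiseWeight (n : ℕ) (θ : ℝ) (K : ℕ) (g : SimpleGraph (Fin n)) : ℝ :=
  θ ^ (g.edgeSet.ncard - (n - K)) * (1 - θ) ^ (n * (n - 1) / 2 - g.edgeSet.ncard)

variable {U : Type} [Fintype U] [DecidableEq U]

/-! ### Posterior root-membership probabilities and the credible set -/

/-- Posterior root-membership probability `P(u ∈ S̃ | G̃_n = g̃)` in the fixed-`K`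
model `PAPER(α,β,K,θ)`: `S̃ = Π S` with `S = {0,…,K-1}` and `Π` a uniformly
random bijection `Fin n ≃ U` independent of `G_n`. -/
def postMemK (n K : ℕ) (α β θ : ℝ) (g : SimpleGraph U) (u : U) : ℝ :=
  (∑ π : Fin n ≃ U, ∑ pa : Fin n → Fin n,
      if IsForestMap n K pa ∧ forestGraph K pa ≤ g.comap ⇑π ∧ (π.symm u).val < K then
        apaKProb K α β pa * noiseWeight n θ K (g.comap ⇑π)
      else 0) /
    ∑ π : Fin n ≃ U, ∑ pa : Fin n → Fin n,
      if IsForestMap n K pa ∧ forestGraph K pa ≤ g.comap ⇑π then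
        apaKProb K α β pa * noiseWeight n θ K (g.comap ⇑π)
      else 0

/-- Posterior root-membership probability `P(u ∈ S̃ | G̃_n = g̃)` in the
random-`K` model `PAPER(α,β,α₀,θ)`: `S̃ = Π S` with `S` the random set of roots. -/
def postMemR (n : ℕ) (α β α₀ θ : ℝ) (g : SimpleGraph U) (u : U) : ℝ :=
  (∑ π : Fin n ≃ U, ∑ pa : Fin n → Fin n,
      if IsRForestMap pa ∧ forestGraphR pa ≤ g.comap ⇑π ∧ pa (π.symm u) = π.symm u then
        apaRProb α β α₀ pa * noiseWeight n θ (rootsR pa).card (g.comap ⇑π)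
      else 0) /
    ∑ π : Fin n ≃ U, ∑ pa : Fin n → Fin n,
      if IsRForestMap pa ∧ forestGraphR pa ≤ g.comap ⇑π then
        apaRProb α β α₀ pa * noiseWeight n θ (rootsR pa).card (g.comap ⇑π)
      else 0

/-- The level `1-ε` credible set built from root-membership probabilities `p`:
sort the nodes in decreasing order of `p` (ties broken by the order `σ`), let
`L_ε = min{k : Σ_{i>k} p(u_i) ≤ ε}`, and take the top `L_ε` nodes.  A node `u`
belongs to the set iff the total mass of `u` and of the nodes after `u` is `> ε`. -/
def BsetOf {n : ℕ} (p : U → ℝ) (ε : ℝ) (σ : U ≃ Fin n) : Set U :=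
  {u | ε < ∑ v : U, if p v < p u ∨ (p v = p u ∧ σ u ≤ σ v) then p v else 0}

namespace RSC

/-! ### Abstract coverage argument -/

def postG {n : ℕ} {U X : Type} [Fintype U] [DecidableEq U] [Fintype X]
    (W : X → SimpleGraph (Fin n) → ℝ) (R : X → Fin n → Prop)
    (h : SimpleGraph U) (u : U) : ℝ :=
  (∑ π : Fin n ≃ U, ∑ x : X, if R x (π.symm u) then W x (h.comap ⇑π) else 0) /
    ∑ π : Fin n ≃ U, ∑ x : X, W x (h.comap ⇑π)

theorem tail_le {n : ℕ} {U : Type} [Fintype U] [DecidableEq U] (p : U → ℝ) (hp : ∀ u, 0 ≤ p u)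
    (ε : ℝ) (hε : 0 < ε) (σ : U ≃ Fin n) :
    ∑ u : U, (if u ∈ BsetOf p ε σ then 0 else p u) ≤ ε := by
  by_cases hne : ∃ u, u ∉ BsetOf p ε σ
  · let C : Finset U := Finset.univ.filter (fun u => u ∉ BsetOf p ε σ)
    have hC : C.Nonempty := by
      obtain ⟨u, hu⟩ := hne
      exact ⟨u, by simp [C, hu]⟩
    obtain ⟨u₁, hu₁, hmax⟩ := C.exists_max_image p hC
    let C' : Finset U := C.filter (fun u => p u = p u₁)
    have hC' : C'.Nonempty := ⟨u₁, by simp [C', hu₁]⟩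
    obtain ⟨u₂, hu₂, hmin⟩ := C'.exists_min_image σ hC'
    have h2 : u₂ ∈ C ∧ p u₂ = p u₁ := by simpa [C'] using hu₂
    have h3 : u₂ ∉ BsetOf p ε σ := by simpa [C] using h2.1
    have h4 : (∑ v : U, if p v < p u₂ ∨ (p v = p u₂ ∧ σ u₂ ≤ σ v) then p v else 0) ≤ ε := by
      simpa [BsetOf] using h3
    refine le_trans (Finset.sum_le_sum fun v _ => ?_) h4
    by_cases hv : v ∈ BsetOf p ε σ
    · simp only [hv, if_true]
      split_ifs
      · exact hp v
      · exact le_rfl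
    · have hvC : v ∈ C := by simp [C, hv]
      have hcond : p v < p u₂ ∨ (p v = p u₂ ∧ σ u₂ ≤ σ v) := by
        rw [h2.2]
        rcases (hmax v hvC).lt_or_eq with h | h
        · exact Or.inl h
        · exact Or.inr ⟨h, hmin v (by simp [C', hvC, h])⟩
      simp only [hv, if_false]
      rw [if_pos hcond]
  · push Not at hne
    have : ∑ u : U, (if u ∈ BsetOf p ε σ then 0 else p u) = 0 :=
      Finset.sum_eq_zero fun u _ => by rw [if_pos (hne u)]
    rw [this]; exact hε.le

section
variable {n : ℕ} {U X : Type} [Fintype U] [DecidableEq U] [Fintype X]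
  (W : X → SimpleGraph (Fin n) → ℝ) (R : X → Fin n → Prop)

theorem postG_equivariant (h : SimpleGraph U) (τ : U ≃ U) (u : U) :
    postG W R (h.comap ⇑τ.symm) (τ u) = postG W R h u := by
  have key : ∀ F : (Fin n ≃ U) → ℝ,
      ∑ π : Fin n ≃ U, F (π.trans τ.symm) = ∑ π : Fin n ≃ U, F π := by
    intro F
    exact Equiv.sum_comp ((Equiv.refl (Fin n)).equivCongr τ.symm) F
  unfold postG
  congr 1
  · symm; rw [← key]
    refine Finset.sum_congr rfl fun π _ => Finset.sum_congr rfl fun x _ => ?_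
    by_cases hR : R x (π.symm (τ u)) <;> simp [hR, SimpleGraph.comap_comap, Equiv.coe_trans]
  · symm; rw [← key]
    refine Finset.sum_congr rfl fun π _ => Finset.sum_congr rfl fun x _ => ?_
    simp [SimpleGraph.comap_comap, Equiv.coe_trans]

theorem Bset_equivariant (p p' : U → ℝ) (ε : ℝ) (σ : U ≃ Fin n) (τ : U ≃ U)
    (hp : ∀ u, p' (τ u) = p u) (u : U) :
    τ u ∈ BsetOf p' ε (τ.symm.trans σ) ↔ u ∈ BsetOf p ε σ := by
  unfold BsetOf
  simp only [Set.mem_ofPred_eq]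
  rw [← Equiv.sum_comp τ]
  simp [hp]

def covG (ε : ℝ) (ρ : Fin n ≃ U) : ℝ :=
  ∑ σ : U ≃ Fin n, ∑ x : X, ∑ g : SimpleGraph (Fin n),
    if ∀ s, R x s → ρ s ∈ BsetOf (postG W R (g.comap ⇑ρ.symm)) ε σ then W x g else 0

theorem covG_const (ε : ℝ) (ρ ρ' : Fin n ≃ U) : covG W R ε ρ = covG W R ε ρ' := by
  unfold covG
  let τ : U ≃ U := ρ.symm.trans ρ'
  rw [← Equiv.sum_comp (τ.equivCongr (Equiv.refl (Fin n)))
    (fun σ : U ≃ Fin n => ∑ x : X, ∑ g : SimpleGraph (Fin n),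
    if ∀ s, R x s → ρ' s ∈ BsetOf (postG W R (g.comap ⇑ρ'.symm)) ε σ then W x g else 0)]
  refine Finset.sum_congr rfl fun σ _ => Finset.sum_congr rfl fun x _ =>
    Finset.sum_congr rfl fun g _ => ?_
  have : ∀ s, (ρ s ∈ BsetOf (postG W R (g.comap ⇑ρ.symm)) ε σ ↔
      ρ' s ∈ BsetOf (postG W R (g.comap ⇑ρ'.symm)) ε
        ((τ.equivCongr (Equiv.refl (Fin n))) σ)) := by
    intro s
    have h1 : ρ' s = τ (ρ s) := by simp [τ]
    have h2 : (τ.equivCongr (Equiv.refl (Fin n))) σ = τ.symm.trans σ := by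
      ext; simp [Equiv.equivCongr]
    have h3 : g.comap ⇑ρ'.symm = (g.comap ⇑ρ.symm).comap ⇑τ.symm := by
      ext a b; simp [τ]
    rw [h1, h2, h3, Bset_equivariant (postG W R (g.comap ⇑ρ.symm)) _ ε σ τ
      (fun u => postG_equivariant W R _ τ u)]
  simp only [this]

def comapEquiv (ρ : Fin n ≃ U) : SimpleGraph U ≃ SimpleGraph (Fin n) where
  toFun h := h.comap ⇑ρ
  invFun g := g.comap ⇑ρ.symm
  left_inv h := by ext a b; simp
  right_inv h := by ext a b; simp

theorem cond_bound (hW : ∀ x g, 0 ≤ W x g) (ε : ℝ) (hε : 0 < ε) (σ : U ≃ Fin n)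
    (h : SimpleGraph U) :
    (1 - ε) * ∑ ρ : Fin n ≃ U, ∑ x : X, W x (h.comap ⇑ρ) ≤
      ∑ ρ : Fin n ≃ U, ∑ x : X,
        if ∀ s, R x s → ρ s ∈ BsetOf (postG W R h) ε σ then W x (h.comap ⇑ρ) else 0 := by
  set D := ∑ ρ : Fin n ≃ U, ∑ x : X, W x (h.comap ⇑ρ) with hD
  set B := BsetOf (postG W R h) ε σ with hB
  have hD0 : 0 ≤ D := Finset.sum_nonneg fun _ _ => Finset.sum_nonneg fun _ _ => hW _ _
  let N : U → ℝ := fun u =>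
    ∑ π : Fin n ≃ U, ∑ x : X, if R x (π.symm u) then W x (h.comap ⇑π) else 0
  have hN0 : ∀ u, 0 ≤ N u := fun u => Finset.sum_nonneg fun _ _ => Finset.sum_nonneg fun _ _ => by
    split_ifs
    · exact hW _ _
    · exact le_rfl
  have hND : ∀ u, N u ≤ D := fun u => Finset.sum_le_sum fun _ _ => Finset.sum_le_sum fun _ _ => by
    split_ifs
    · exact le_rfl
    · exact hW _ _
  have hpost : ∀ u, postG W R h u = N u / D := fun u => rfl
  have hNp : ∀ u, N u = postG W R h u * D := by
    intro u
    rw [hpost]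
    by_cases hz : D = 0
    · have := hND u
      have := hN0 u
      rw [hz]; simp; linarith
    · field_simp
  have htail := tail_le (postG W R h) (fun u => by rw [hpost]; exact div_nonneg (hN0 u) hD0) ε hε σ
  rw [← hB] at htail
  have hbad : D - (∑ ρ : Fin n ≃ U, ∑ x : X,
        if ∀ s, R x s → ρ s ∈ B then W x (h.comap ⇑ρ) else 0) ≤
      ∑ u : U, if u ∈ B then 0 else N u := by
    have e1 : (∑ u : U, if u ∈ B then 0 else N u) = ∑ ρ : Fin n ≃ U, ∑ x : X, ∑ u : U,
        if u ∈ B then 0 else if R x (ρ.symm u) then W x (h.comap ⇑ρ) else 0 := by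
      have : ∀ u, (if u ∈ B then 0 else N u) = ∑ ρ : Fin n ≃ U, ∑ x : X,
          if u ∈ B then 0 else if R x (ρ.symm u) then W x (h.comap ⇑ρ) else 0 := by
        intro u
        by_cases hu : u ∈ B
        · simp [hu]
        · simp [hu, N]
      simp_rw [this]
      rw [Finset.sum_comm]
      refine Finset.sum_congr rfl fun ρ _ => ?_
      rw [Finset.sum_comm]
    rw [e1, hD, ← Finset.sum_sub_distrib]
    refine Finset.sum_le_sum fun ρ _ => ?_
    rw [← Finset.sum_sub_distrib]
    refine Finset.sum_le_sum fun x _ => ?_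
    have hnn : ∀ u ∈ (Finset.univ : Finset U), 0 ≤
        (if u ∈ B then 0 else if R x (ρ.symm u) then W x (h.comap ⇑ρ) else 0 : ℝ) := by
      intro u _
      split_ifs
      · exact le_rfl
      · exact hW _ _
      · exact le_rfl
    by_cases hg : ∀ s, R x s → ρ s ∈ B
    · rw [if_pos hg, sub_self]
      exact Finset.sum_nonneg hnn
    · rw [if_neg hg, sub_zero]
      push Not at hg
      obtain ⟨s, hs, hsB⟩ := hg
      refine le_trans ?_ (Finset.single_le_sum hnn (Finset.mem_univ (ρ s)))
      simp [hsB, hs]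
  have e2 : (∑ u : U, if u ∈ B then 0 else N u) =
      (∑ u : U, if u ∈ B then 0 else postG W R h u) * D := by
    rw [Finset.sum_mul]
    refine Finset.sum_congr rfl fun u _ => ?_
    by_cases hu : u ∈ B
    · simp [hu]
    · simp only [hu, if_false]; exact hNp u
  have := mul_le_mul_of_nonneg_right htail hD0
  linarith

theorem coverage (hW : ∀ x g, 0 ≤ W x g) (hsum : ∑ x, ∑ g, W x g = 1) (ε : ℝ) (hε : 0 < ε)
    (ρ : Fin n ≃ U) : 1 - ε ≤ (Nat.factorial n : ℝ)⁻¹ * covG W R ε ρ := by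
  have hc : Fintype.card (Fin n ≃ U) = Nat.factorial n := by
    rw [Fintype.card_equiv ρ, Fintype.card_fin]
  have hc' : Fintype.card (U ≃ Fin n) = Nat.factorial n := by
    rw [Fintype.card_equiv ρ.symm, ← Fintype.card_congr ρ, Fintype.card_fin]
  have hpos : (0 : ℝ) < Nat.factorial n := by exact_mod_cast Nat.factorial_pos n
  have h1 : (Nat.factorial n : ℝ) * covG W R ε ρ = ∑ ρ' : Fin n ≃ U, covG W R ε ρ' := by
    rw [Finset.sum_congr rfl (fun ρ' _ => covG_const W R ε ρ' ρ)]
    simp [hc]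
  have h2 : ∑ ρ' : Fin n ≃ U, covG W R ε ρ' = ∑ σ : U ≃ Fin n, ∑ h : SimpleGraph U,
      ∑ ρ : Fin n ≃ U, ∑ x : X,
        if ∀ s, R x s → ρ s ∈ BsetOf (postG W R h) ε σ then W x (h.comap ⇑ρ) else 0 := by
    unfold covG
    rw [Finset.sum_comm]
    refine Finset.sum_congr rfl fun σ _ => ?_
    rw [Finset.sum_comm (s := (Finset.univ : Finset (SimpleGraph U)))]
    refine Finset.sum_congr rfl fun ρ' _ => ?_
    rw [Finset.sum_comm, ← Equiv.sum_comp (comapEquiv ρ')]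
    refine Finset.sum_congr rfl fun h _ => Finset.sum_congr rfl fun x _ => ?_
    have : ((comapEquiv ρ') h).comap ⇑ρ'.symm = h := (comapEquiv ρ').left_inv h
    rw [this]
    rfl
  have h3 : ∑ h : SimpleGraph U, ∑ ρ : Fin n ≃ U, ∑ x : X, W x (h.comap ⇑ρ) =
      (Nat.factorial n : ℝ) := by
    rw [Finset.sum_comm]
    have : ∀ ρ : Fin n ≃ U, ∑ h : SimpleGraph U, ∑ x : X, W x (h.comap ⇑ρ) = 1 := by
      intro ρ
      have := Equiv.sum_comp (comapEquiv ρ) (fun g => ∑ x, W x g)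
      rw [Finset.sum_comm (s := (Finset.univ : Finset (SimpleGraph (Fin n)))), hsum] at this
      exact this
    simp [this, hc]
  have h4 : (Nat.factorial n : ℝ) * ((1 - ε) * Nat.factorial n) ≤
      (Nat.factorial n : ℝ) * covG W R ε ρ := by
    rw [h1, h2]
    have : (Nat.factorial n : ℝ) * ((1 - ε) * Nat.factorial n) = ∑ σ : U ≃ Fin n,
        ∑ h : SimpleGraph U, (1 - ε) * ∑ ρ : Fin n ≃ U, ∑ x : X, W x (h.comap ⇑ρ) := by
      rw [← Finset.mul_sum, h3]
      simp [hc']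
    rw [this]
    exact Finset.sum_le_sum fun σ _ => Finset.sum_le_sum fun h _ => cond_bound W R hW ε hε σ h
  have h5 := le_of_mul_le_mul_left h4 hpos
  rw [inv_mul_eq_div, le_div_iff₀ hpos]
  exact h5
end

/-! ### Noise -/

theorem noise_sum {n : ℕ} (θ : ℝ) (F : SimpleGraph (Fin n)) :
    ∑ g : SimpleGraph (Fin n), (if F ≤ g then
      θ ^ (g.edgeSet.ncard - F.edgeSet.ncard) * (1 - θ) ^ (n * (n - 1) / 2 - g.edgeSet.ncard)
      else 0) = 1 := by
  have hnc : ∀ g : SimpleGraph (Fin n), g.edgeSet.ncard = g.edgeFinset.card := by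
    intro g
    rw [← SimpleGraph.coe_edgeFinset, Set.ncard_coe_finset]
  have htop : (⊤ : SimpleGraph (Fin n)).edgeFinset.card = n * (n - 1) / 2 := by
    rw [SimpleGraph.card_edgeFinset_top_eq_card_choose_two, Fintype.card_fin, Nat.choose_two_right]
  let T := (⊤ : SimpleGraph (Fin n)).edgeFinset \ F.edgeFinset
  have hT : T.card = n * (n - 1) / 2 - F.edgeFinset.card := by
    rw [← htop]
    exact Finset.card_sdiff_of_subset (SimpleGraph.edgeFinset_mono le_top)
  have h1 : ∑ t ∈ T.powerset, θ ^ #t * (1 - θ) ^ (#T - #t) = 1 := by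
    rw [Finset.sum_pow_mul_eq_add_pow]; simp
  refine Eq.trans ?_ h1
  rw [← Finset.sum_filter]
  refine Finset.sum_bij' (fun g _ => g.edgeFinset \ F.edgeFinset)
    (fun t _ => F ⊔ SimpleGraph.fromEdgeSet (t : Set (Sym2 (Fin n)))) ?_ ?_ ?_ ?_ ?_
  · intro g _
    rw [Finset.mem_powerset]
    exact Finset.sdiff_subset_sdiff (SimpleGraph.edgeFinset_mono le_top) le_rfl
  · intro t _
    simp
  · intro g hg
    have hg : F ≤ g := by simpa using hg
    ext a b
    have := @hg a b
    by_cases hF : F.Adj a b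
    · simp [hF, this hF]
    · simp only [SimpleGraph.sup_adj, hF, SimpleGraph.fromEdgeSet_adj, false_or, Finset.coe_sdiff,
        SimpleGraph.coe_edgeFinset, Set.mem_sdiff, SimpleGraph.mem_edgeSet, not_false_eq_true,
        and_true]
      exact ⟨fun h => h.1, fun h => ⟨h, h.ne⟩⟩
  · intro t ht
    rw [Finset.mem_powerset] at ht
    ext e
    induction e with
    | _ a b =>
      have h2 : s(a, b) ∈ t → a ≠ b ∧ ¬ F.Adj a b := fun h => by simpa [T] using ht h
      simp only [Finset.mem_sdiff, SimpleGraph.mem_edgeFinset, SimpleGraph.mem_edgeSet,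
        SimpleGraph.sup_adj, SimpleGraph.fromEdgeSet_adj, Finset.mem_coe]
      tauto
  · intro g hg
    have hg : F ≤ g := by simpa using hg
    have h3 : (g.edgeFinset \ F.edgeFinset).card = g.edgeFinset.card - F.edgeFinset.card :=
      Finset.card_sdiff_of_subset (SimpleGraph.edgeFinset_mono hg)
    have h4 : F.edgeFinset.card ≤ g.edgeFinset.card :=
      Finset.card_le_card (SimpleGraph.edgeFinset_mono hg)
    have h5 : n * (n - 1) / 2 - g.edgeFinset.card =
        n * (n - 1) / 2 - F.edgeFinset.card - (g.edgeFinset.card - F.edgeFinset.card) := by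
      omega
    rw [hnc, hnc, h3, hT, ← h5]

theorem forest_edges {n : ℕ} (pa : Fin n → Fin n) (h : IsRForestMap pa) :
    (forestGraphR pa).edgeSet.ncard = n - (rootsR pa).card := by
  have h1 : (forestGraphR pa).edgeSet =
      (fun j => s(pa j, j)) '' ((Finset.univ.filter (fun j => ¬ pa j = j) : Finset (Fin n)) :
        Set (Fin n)) := by
    ext e
    induction e with
    | _ a b =>
      simp only [forestGraphR, SimpleGraph.mem_edgeSet, SimpleGraph.fromRel_adj, Set.mem_image,
        Finset.mem_coe, Finset.mem_filter, Finset.mem_univ, true_and, Sym2.eq_iff]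
      constructor
      · rintro ⟨hab, ⟨h1, h2⟩ | ⟨h1, h2⟩⟩
        · exact ⟨b, h2, Or.inl ⟨h1, rfl⟩⟩
        · exact ⟨a, h2, Or.inr ⟨h1, rfl⟩⟩
      · rintro ⟨j, hj, ⟨h1, h2⟩ | ⟨h1, h2⟩⟩
        · subst h2; subst h1; exact ⟨hj, Or.inl ⟨rfl, hj⟩⟩
        · subst h2; subst h1; exact ⟨fun h => hj h.symm, Or.inr ⟨rfl, hj⟩⟩
  rw [h1, Set.InjOn.ncard_image, Set.ncard_coe_finset]
  · have := Finset.card_filter_add_card_filter_not (s := (Finset.univ : Finset (Fin n)))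
      (fun j => pa j = j)
    rw [Finset.card_univ, Fintype.card_fin] at this
    unfold rootsR
    omega
  · intro i hi j hj hij
    have hi : ¬ pa i = i := by simpa using hi
    have hj : ¬ pa j = j := by simpa using hj
    have hi' := (h i).resolve_left hi
    have hj' := (h j).resolve_left hj
    simp only [Sym2.eq_iff] at hij
    rcases hij with ⟨_, h2⟩ | ⟨h1, h2⟩
    · exact h2
    · rw [h1] at hi'; rw [← h2] at hj'; omega

/-! ### Sequential products -/

theorem sum_update {n : ℕ} (m : Fin n) (g : (Fin n → Fin n) → ℝ) :
    ∑ pa : Fin n → Fin n, ∑ w : Fin n, g (Function.update pa m w) =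
      n * ∑ pa : Fin n → Fin n, g pa := by
  let e : ((Fin n → Fin n) × Fin n) ≃ ((Fin n → Fin n) × Fin n) :=
    { toFun := fun q => (Function.update q.1 m q.2, q.1 m)
      invFun := fun q => (Function.update q.1 m q.2, q.1 m)
      left_inv := by rintro ⟨q, w⟩; simp
      right_inv := by rintro ⟨q, w⟩; simp }
  have := Equiv.sum_comp e (fun q => g q.1)
  rw [Fintype.sum_prod_type, Fintype.sum_prod_type] at this
  simp only [e, Equiv.coe_fn_mk] at this
  rw [this]
  simp [Finset.mul_sum]

theorem seq_sum {n : ℕ} [NeZero n] (f : Fin n → (Fin n → Fin n) → ℝ)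
    (hdep : ∀ s m pa w, s < m → f s (Function.update pa m w) = f s pa)
    (hone : ∀ m pa, (∀ s, s < m → f s pa ≠ 0) → ∑ w, f m (Function.update pa m w) = 1) :
    ∑ pa : Fin n → Fin n, ∏ t, f t pa = 1 := by
  have hn : (n : ℝ) ≠ 0 := by exact_mod_cast NeZero.ne n
  have key : ∀ k, k ≤ n → (n : ℝ) ^ k * ∑ pa : Fin n → Fin n,
      ∏ t ∈ Finset.univ.filter (fun t : Fin n => t.val < k), f t pa = (n : ℝ) ^ n := by
    intro k
    induction k with
    | zero => intro _; simp
    | succ k ih =>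
      intro hk
      rw [← ih (by omega), pow_succ, mul_assoc]
      congr 1
      let m : Fin n := ⟨k, by omega⟩
      rw [← sum_update m]
      refine Finset.sum_congr rfl fun pa _ => ?_
      have hfil : Finset.univ.filter (fun t : Fin n => t.val < k + 1) =
          insert m (Finset.univ.filter (fun t : Fin n => t.val < k)) := by
        ext t; simp [m, Fin.ext_iff]; omega
      have hs : ∀ w, ∏ t ∈ Finset.univ.filter (fun t : Fin n => t.val < k + 1),
          f t (Function.update pa m w) = f m (Function.update pa m w) *
            ∏ t ∈ Finset.univ.filter (fun t : Fin n => t.val < k), f t pa := by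
        intro w
        rw [hfil, Finset.prod_insert (by simp [m])]
        congr 1
        refine Finset.prod_congr rfl fun t ht => hdep t m pa w ?_
        simpa [m, Fin.lt_def] using ht
      simp_rw [hs]
      rw [← Finset.sum_mul]
      by_cases hz : ∀ s, s < m → f s pa ≠ 0
      · rw [hone m pa hz, one_mul]
      · push Not at hz
        obtain ⟨s, hs, h0⟩ := hz
        have : ∏ t ∈ Finset.univ.filter (fun t : Fin n => t.val < k), f t pa = 0 :=
          Finset.prod_eq_zero (by simpa [m, Fin.lt_def] using hs) h0
        rw [this, mul_zero]
  have h := key n le_rfl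
  have h' : ∀ pa, ∏ t ∈ Finset.univ.filter (fun t : Fin n => t.val < n), f t pa = ∏ t, f t pa := by
    intro pa
    rw [Finset.filter_true_of_mem (fun t _ => t.isLt)]
  simp_rw [h'] at h
  exact mul_left_cancel₀ (pow_ne_zero n hn) (h.trans (mul_one _).symm)

/-! ### The random-root model -/

def fR {n : ℕ} (α β α₀ : ℝ) (t : Fin n) (pa : Fin n → Fin n) : ℝ :=
  if t.val ≠ 0 then
    (if pa t = t then α₀
      else if (pa t).val < t.val then β * degAtR pa (t.val - 1) (pa t) + α +
         2 * β * (if pa (pa t) = pa t then 1 else 0) else 0) /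
        ((2 * β + α) * (t.val : ℝ) + α₀)
  else if pa t = t then 1 else 0

theorem prod_fR {n : ℕ} (α β α₀ : ℝ) (pa : Fin n → Fin n) :
    ∏ t, fR α β α₀ t pa = if IsRForestMap pa then apaRProb α β α₀ pa else 0 := by
  by_cases h : IsRForestMap pa
  · rw [if_pos h]
    unfold apaRProb
    refine Finset.prod_congr rfl fun t _ => ?_
    unfold fR
    have := h t
    by_cases ht : t.val = 0
    · have h1 : pa t = t := this.resolve_right (by omega)
      simp [ht, h1]
    · by_cases h1 : pa t = t
      · simp [ht, h1]
      · have h2 := this.resolve_left h1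
        simp only [ne_eq, ht, not_false_eq_true, if_true, h1, if_false, h2]
  · rw [if_neg h]
    unfold IsRForestMap at h
    push Not at h
    obtain ⟨t, h1, h2⟩ := h
    refine Finset.prod_eq_zero (Finset.mem_univ t) ?_
    have h3 : ¬ (pa t).val < t.val := by omega
    unfold fR
    simp [h1, h3]

theorem degR_update {n : ℕ} (pa : Fin n → Fin n) (m w v : Fin n) (k : ℕ) (hk : k < m.val)
    (hv : v < m) : degAtR (Function.update pa m w) k v = degAtR pa k v := by
  unfold degAtR
  have h1 : ∀ s : Fin n, s.val ≤ k → Function.update pa m w s = pa s := by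
    intro s hs
    exact Function.update_of_ne (by rintro rfl; omega) _ _
  have h2 : Function.update pa m w v = pa v := Function.update_of_ne hv.ne _ _
  rw [h2]
  congr 2
  ext s
  simp only [Finset.mem_filter, Finset.mem_univ, true_and]
  constructor
  · rintro ⟨a, b, c⟩; exact ⟨a, by rw [← h1 s a]; exact b, c⟩
  · rintro ⟨a, b, c⟩; exact ⟨a, by rw [h1 s a]; exact b, c⟩

theorem fR_nonneg {n : ℕ} (α β α₀ : ℝ) (hβ : 0 ≤ β) (hαβ : 0 < α + β) (hα₀ : 0 < α₀)
    (t : Fin n) (pa : Fin n → Fin n) : 0 ≤ fR α β α₀ t pa := by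
  unfold fR
  have hden : 0 ≤ (2 * β + α) * (t.val : ℝ) + α₀ := by
    have : 0 ≤ 2 * β + α := by linarith
    positivity
  by_cases ht : t.val = 0
  · simp only [ht, ne_eq, not_true_eq_false, if_false]
    split_ifs <;> norm_num
  · simp only [ht, ne_eq, not_false_eq_true, if_true]
    refine div_nonneg ?_ hden
    split_ifs with h1 h2 h3
    · exact hα₀.le
    · have : (0 : ℝ) ≤ β * degAtR pa (t.val - 1) (pa t) := by positivity
      linarith
    · have h4 : 1 ≤ degAtR pa (t.val - 1) (pa t) := by
        unfold degAtR
        rw [if_pos ⟨h3, by omega⟩]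
        omega
      have h5 : (1 : ℝ) ≤ degAtR pa (t.val - 1) (pa t) := by exact_mod_cast h4
      nlinarith
    · exact le_rfl

theorem sum_degR {n : ℕ} (pa : Fin n → Fin n) (m : Fin n)
    (hpa : ∀ s, s < m → pa s = s ∨ (pa s).val < s.val) :
    ∑ v ∈ Finset.univ.filter (fun v : Fin n => v < m), degAtR pa (m.val - 1) v =
      2 * (Finset.univ.filter (fun v : Fin n => v < m ∧ pa v ≠ v)).card := by
  unfold degAtR
  rw [Finset.sum_add_distrib, two_mul]
  congr 1
  · rw [Finset.card_eq_sum_card_fiberwise (f := pa)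
      (t := Finset.univ.filter (fun v : Fin n => v < m))]
    · refine Finset.sum_congr rfl fun v hv => ?_
      have hv : v < m := by simpa using hv
      congr 1
      ext s
      simp only [Finset.mem_filter, Finset.mem_univ, true_and, Fin.lt_def] at hv ⊢
      constructor
      · rintro ⟨a, b, c⟩; exact ⟨⟨by omega, by rw [b]; exact c.symm⟩, b⟩
      · rintro ⟨⟨a, b⟩, c⟩; exact ⟨by omega, c, by rw [c] at b; exact b.symm⟩
    · intro s hs
      simp only [Finset.coe_filter, Finset.mem_univ, true_and, Set.mem_ofPred_eq, Fin.lt_def]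
        at hs ⊢
      have := (hpa s hs.1).resolve_left hs.2
      omega
  · rw [← Finset.card_filter, Finset.filter_filter]
    congr 1
    ext s
    simp only [Finset.mem_filter, Finset.mem_univ, true_and, Fin.lt_def]
    constructor
    · rintro ⟨a, b, c⟩; exact ⟨a, b⟩
    · rintro ⟨a, b⟩; exact ⟨a, b, by omega⟩

theorem card_lt {n : ℕ} (m : Fin n) :
    (Finset.univ.filter (fun v : Fin n => v < m)).card = m.val := by
  simp [Finset.filter_gt_eq_Iio]

theorem sum_weightR {n : ℕ} (α β : ℝ) (pa : Fin n → Fin n) (m : Fin n)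
    (hpa : ∀ s, s < m → pa s = s ∨ (pa s).val < s.val) :
    ∑ v ∈ Finset.univ.filter (fun v : Fin n => v < m),
      (β * degAtR pa (m.val - 1) v + α + 2 * β * (if pa v = v then 1 else 0)) =
      (2 * β + α) * (m.val : ℝ) := by
  have h1 := sum_degR pa m hpa
  have h2 : ((∑ v ∈ Finset.univ.filter (fun v : Fin n => v < m),
      degAtR pa (m.val - 1) v : ℕ) : ℝ) =
      2 * (Finset.univ.filter (fun v : Fin n => v < m ∧ pa v ≠ v)).card := by
    rw [h1]; push_cast; ring
  push_cast at h2
  have h3 := Finset.card_filter_add_card_filter_not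
    (s := Finset.univ.filter (fun v : Fin n => v < m)) (fun v => pa v = v)
  rw [card_lt, Finset.filter_filter, Finset.filter_filter] at h3
  have h4 : (((Finset.univ.filter (fun v : Fin n => v < m ∧ pa v = v)).card +
    (Finset.univ.filter (fun v : Fin n => v < m ∧ pa v ≠ v)).card : ℕ) : ℝ) = m.val := by
    exact_mod_cast h3
  push_cast at h4
  rw [Finset.sum_add_distrib, Finset.sum_add_distrib, ← Finset.mul_sum, ← Finset.mul_sum, h2,
    Finset.sum_const, card_lt, Finset.sum_boole, Finset.filter_filter, nsmul_eq_mul]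
  linear_combination 2 * β * h4

theorem sum_fR {n : ℕ} [NeZero n] (α β α₀ : ℝ) (hβ : 0 ≤ β) (hαβ : 0 < α + β) (hα₀ : 0 < α₀) :
    ∑ pa : Fin n → Fin n, ∏ t, fR α β α₀ t pa = 1 := by
  apply seq_sum
  · intro s m pa w hsm
    have h1 : Function.update pa m w s = pa s := Function.update_of_ne hsm.ne _ _
    unfold fR
    rw [h1]
    by_cases hs : s.val = 0
    · simp [hs]
    · by_cases h2 : (pa s).val < s.val
      · have h3 : pa s < m := by rw [Fin.lt_def] at *; omega
        have h4 : Function.update pa m w (pa s) = pa (pa s) := Function.update_of_ne h3.ne _ _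
        rw [h4, degR_update pa m w (pa s) _ (by rw [Fin.lt_def] at hsm; omega) h3]
      · simp [h2]
  · intro m pa hnz
    have hpa : ∀ s, s < m → pa s = s ∨ (pa s).val < s.val := by
      intro s hs
      by_contra hc
      push Not at hc
      have h3 : ¬ (pa s).val < s.val := by omega
      refine hnz s hs ?_
      unfold fR
      simp [hc.1, h3]
    by_cases hm : m.val = 0
    · simp [fR, hm]
    · have hden : 0 < (2 * β + α) * (m.val : ℝ) + α₀ := by
        have : 0 ≤ 2 * β + α := by linarith
        positivity
      have hw : ∀ w, fR α β α₀ m (Function.update pa m w) =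
          ((if w = m then α₀ else 0) + (if w < m then
            (β * degAtR pa (m.val - 1) w + α + 2 * β * (if pa w = w then 1 else 0)) else 0)) /
            ((2 * β + α) * (m.val : ℝ) + α₀) := by
        intro w
        unfold fR
        rw [if_pos hm, Function.update_self]
        congr 1
        by_cases h1 : w = m
        · simp [h1]
        · by_cases h2 : w < m
          · have h2' : w.val < m.val := h2
            rw [degR_update pa m w w _ (by omega) h2, Function.update_of_ne h1]
            simp [h1, h2]
          · have h2' : ¬ w.val < m.val := h2
            simp [h1, h2]
      simp_rw [hw]
      rw [← Finset.sum_div, Finset.sum_add_distrib, ← Finset.sum_filter (fun w => w < m),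
        sum_weightR α β pa m hpa, div_eq_one_iff_eq hden.ne']
      simp
      ring

/-! ### The fixed-root model -/

def fK {n : ℕ} (K : ℕ) (α β : ℝ) (t : Fin n) (pa : Fin n → Fin n) : ℝ :=
  if K ≤ t.val then
    (if (pa t).val < t.val then β * degAtK K pa (t.val - 1) (pa t) +
        2 * β * (if (pa t).val < K then 1 else 0) + α else 0) / ((2 * β + α) * (t.val : ℝ))
  else if pa t = t then 1 else 0

theorem prod_fK {n : ℕ} (K : ℕ) (α β : ℝ) (pa : Fin n → Fin n) :
    ∏ t, fK K α β t pa = if IsForestMap n K pa then apaKProb K α β pa else 0 := by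
  by_cases h : IsForestMap n K pa
  · rw [if_pos h]
    unfold apaKProb
    refine Finset.prod_congr rfl fun t _ => ?_
    unfold fK
    by_cases ht : K ≤ t.val
    · rw [if_pos ht, if_pos ht, if_pos (h.2 t ht)]
    · rw [if_neg ht, if_neg ht, if_pos (h.1 t (by omega))]
  · rw [if_neg h]
    have : ∃ t, fK K α β t pa = 0 := by
      by_contra hc
      push Not at hc
      refine h ⟨fun t ht => ?_, fun t ht => ?_⟩
      · by_contra h1
        refine hc t ?_
        unfold fK
        rw [if_neg (by omega), if_neg h1]
      · by_contra h1
        refine hc t ?_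
        unfold fK
        rw [if_pos ht, if_neg h1, zero_div]
    obtain ⟨t, ht⟩ := this
    exact Finset.prod_eq_zero (Finset.mem_univ t) ht

theorem degK_update {n : ℕ} (K : ℕ) (pa : Fin n → Fin n) (m w v : Fin n) (k : ℕ)
    (hk : k < m.val) : degAtK K (Function.update pa m w) k v = degAtK K pa k v := by
  unfold degAtK
  have h1 : ∀ s : Fin n, s.val ≤ k → Function.update pa m w s = pa s := by
    intro s hs
    exact Function.update_of_ne (by rintro rfl; omega) _ _
  congr 2
  ext s
  simp only [Finset.mem_filter, Finset.mem_univ, true_and]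
  constructor
  · rintro ⟨a, b, c⟩; exact ⟨a, b, by rw [← h1 s b]; exact c⟩
  · rintro ⟨a, b, c⟩; exact ⟨a, b, by rw [h1 s b]; exact c⟩

theorem fK_nonneg {n : ℕ} (K : ℕ) (hK1 : 1 ≤ K) (α β : ℝ) (hβ : 0 ≤ β) (hαβ : 0 < α + β)
    (t : Fin n) (pa : Fin n → Fin n) : 0 ≤ fK K α β t pa := by
  unfold fK
  have hden : 0 ≤ (2 * β + α) * (t.val : ℝ) := by
    have : 0 ≤ 2 * β + α := by linarith
    positivity
  by_cases ht : K ≤ t.val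
  · rw [if_pos ht]
    refine div_nonneg ?_ hden
    split_ifs with h1 h2
    · have : (0 : ℝ) ≤ β * degAtK K pa (t.val - 1) (pa t) := by positivity
      linarith
    · have h4 : 1 ≤ degAtK K pa (t.val - 1) (pa t) := by
        unfold degAtK
        rw [if_pos ⟨by omega, by omega⟩]
        omega
      have h5 : (1 : ℝ) ≤ degAtK K pa (t.val - 1) (pa t) := by exact_mod_cast h4
      nlinarith
    · exact le_rfl
  · rw [if_neg ht]
    split_ifs <;> norm_num

/-- Below time `m`, the fixed-root degrees agree with the random-root degrees of the
map in which every node from time `m` on is made a root. -/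
theorem degK_eq_degR {n : ℕ} (K : ℕ) (pa : Fin n → Fin n) (m v : Fin n) (hv : v < m)
    (h1 : ∀ s : Fin n, s < m → s.val < K → pa s = s)
    (h2 : ∀ s : Fin n, s < m → K ≤ s.val → (pa s).val < s.val) :
    degAtK K pa (m.val - 1) v = degAtR pa (m.val - 1) v := by
  have hr : ∀ s : Fin n, s < m → (pa s ≠ s ↔ K ≤ s.val) := by
    intro s hs
    constructor
    · intro h; by_contra hc; exact h (h1 s hs (by omega))
    · intro h h3; have := h2 s hs h; rw [h3] at this; omega
  unfold degAtK degAtR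
  congr 1
  · congr 1
    ext s
    simp only [Finset.mem_filter, Finset.mem_univ, true_and]
    constructor
    · rintro ⟨a, b, c⟩
      refine ⟨b, c, ?_⟩
      have := (hr s (by rw [Fin.lt_def] at *; omega)).2 a
      rw [c] at this; exact this.symm
    · rintro ⟨a, b, c⟩
      refine ⟨(hr s (by rw [Fin.lt_def] at *; omega)).1 ?_, a, b⟩
      rw [b]; exact c.symm
  · have := hr v hv
    simp only [this]

theorem sum_fK {n : ℕ} [NeZero n] (K : ℕ) (hK1 : 1 ≤ K) (α β : ℝ) (hβ : 0 ≤ β)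
    (hαβ : 0 < α + β) : ∑ pa : Fin n → Fin n, ∏ t, fK K α β t pa = 1 := by
  apply seq_sum
  · intro s m pa w hsm
    have h1 : Function.update pa m w s = pa s := Function.update_of_ne hsm.ne _ _
    unfold fK
    rw [h1]
    rw [degK_update K pa m w (pa s) _ (by rw [Fin.lt_def] at hsm; omega)]
  · intro m pa hnz
    have h1 : ∀ s : Fin n, s < m → s.val < K → pa s = s := by
      intro s hs hK
      by_contra hc
      refine hnz s hs ?_
      unfold fK
      rw [if_neg (by omega), if_neg hc]
    have h2 : ∀ s : Fin n, s < m → K ≤ s.val → (pa s).val < s.val := by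
      intro s hs hK
      by_contra hc
      refine hnz s hs ?_
      unfold fK
      rw [if_pos hK, if_neg hc, zero_div]
    have hpa : ∀ s, s < m → pa s = s ∨ (pa s).val < s.val := by
      intro s hs
      by_cases hK : s.val < K
      · exact Or.inl (h1 s hs hK)
      · exact Or.inr (h2 s hs (by omega))
    by_cases hm : K ≤ m.val
    · have hden : 0 < (2 * β + α) * (m.val : ℝ) := by
        have h3 : 0 < 2 * β + α := by linarith
        have h4 : (0 : ℝ) < m.val := by exact_mod_cast (by omega : 0 < m.val)
        positivity
      have hw : ∀ w, fK K α β m (Function.update pa m w) =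
          (if w < m then
            (β * degAtR pa (m.val - 1) w + α + 2 * β * (if pa w = w then 1 else 0)) else 0) /
            ((2 * β + α) * (m.val : ℝ)) := by
        intro w
        unfold fK
        rw [if_pos hm, Function.update_self]
        congr 1
        by_cases h3 : w < m
        · have h3' : w.val < m.val := h3
          rw [degK_update K pa m w w _ (by omega), if_pos h3, if_pos h3',
            degK_eq_degR K pa m w h3 h1 h2]
          have h5 : w.val < K ↔ pa w = w := by
            constructor
            · exact h1 w h3
            · intro h; by_contra hc
              have := h2 w h3 (by omega)
              rw [h] at this; omega
          simp only [h5]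
          ring
        · have h3' : ¬ w.val < m.val := h3
          rw [if_neg h3, if_neg h3']
      simp_rw [hw]
      rw [← Finset.sum_div, ← Finset.sum_filter (fun w => w < m),
        sum_weightR α β pa m hpa, div_self hden.ne']
    · simp [fK, hm]

theorem isR_of_isK {n K : ℕ} {pa : Fin n → Fin n} (h : IsForestMap n K pa) :
    IsRForestMap pa := by
  intro t
  by_cases hK : t.val < K
  · exact Or.inl (h.1 t hK)
  · exact Or.inr (h.2 t (by omega))

theorem root_iff {n K : ℕ} {pa : Fin n → Fin n} (h : IsForestMap n K pa) (t : Fin n) :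
    pa t = t ↔ t.val < K := by
  constructor
  · intro h1; by_contra hc
    have := h.2 t (by omega)
    rw [h1] at this; omega
  · exact h.1 t

theorem graph_eq {n K : ℕ} {pa : Fin n → Fin n} (h : IsForestMap n K pa) :
    forestGraph K pa = forestGraphR pa := by
  unfold forestGraph forestGraphR
  congr 1
  ext i j
  have := root_iff h j
  constructor
  · rintro ⟨a, b⟩; exact ⟨b, fun hc => by have := this.1 hc; omega⟩
  · rintro ⟨a, b⟩; exact ⟨by by_contra hc; exact b (this.2 (by omega)), a⟩

theorem roots_card {n K : ℕ} (hKn : K ≤ n) {pa : Fin n → Fin n} (h : IsForestMap n K pa) :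
    (rootsR pa).card = K := by
  unfold rootsR
  simp only [root_iff h]
  rw [Fin.card_filter_val_lt]
  omega

theorem noise_sumR {n : ℕ} (θ : ℝ) (pa : Fin n → Fin n) (h : IsRForestMap pa) :
    ∑ g : SimpleGraph (Fin n), (if forestGraphR pa ≤ g then
      noiseWeight n θ (rootsR pa).card g else 0) = 1 := by
  have := noise_sum θ (forestGraphR pa)
  rw [forest_edges pa h] at this
  exact this

theorem noise_nonneg (n : ℕ) (θ : ℝ) (h0 : 0 ≤ θ) (h1 : θ ≤ 1) (K : ℕ)
    (g : SimpleGraph (Fin n)) : 0 ≤ noiseWeight n θ K g := by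
  unfold noiseWeight
  have : 0 ≤ 1 - θ := by linarith
  positivity

def WK {n : ℕ} (K : ℕ) (α β θ : ℝ) (pa : Fin n → Fin n) (g : SimpleGraph (Fin n)) : ℝ :=
  if IsForestMap n K pa ∧ forestGraph K pa ≤ g then
    apaKProb K α β pa * noiseWeight n θ K g else 0

def WR {n : ℕ} (α β α₀ θ : ℝ) (pa : Fin n → Fin n) (g : SimpleGraph (Fin n)) : ℝ :=
  if IsRForestMap pa ∧ forestGraphR pa ≤ g then
    apaRProb α β α₀ pa * noiseWeight n θ (rootsR pa).card g else 0

theorem WK_nonneg {n : ℕ} (K : ℕ) (hK1 : 1 ≤ K) (α β θ : ℝ) (hβ : 0 ≤ β) (hαβ : 0 < α + β)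
    (h0 : 0 ≤ θ) (h1 : θ ≤ 1) (pa : Fin n → Fin n) (g : SimpleGraph (Fin n)) :
    0 ≤ WK K α β θ pa g := by
  unfold WK
  split_ifs with h
  · refine mul_nonneg ?_ (noise_nonneg n θ h0 h1 K g)
    have := prod_fK K α β pa
    rw [if_pos h.1] at this
    rw [← this]
    exact Finset.prod_nonneg fun t _ => fK_nonneg K hK1 α β hβ hαβ t pa
  · exact le_rfl

theorem WR_nonneg {n : ℕ} (α β α₀ θ : ℝ) (hβ : 0 ≤ β) (hαβ : 0 < α + β) (hα₀ : 0 < α₀)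
    (h0 : 0 ≤ θ) (h1 : θ ≤ 1) (pa : Fin n → Fin n) (g : SimpleGraph (Fin n)) :
    0 ≤ WR α β α₀ θ pa g := by
  unfold WR
  split_ifs with h
  · refine mul_nonneg ?_ (noise_nonneg n θ h0 h1 _ g)
    have := prod_fR α β α₀ pa
    rw [if_pos h.1] at this
    rw [← this]
    exact Finset.prod_nonneg fun t _ => fR_nonneg α β α₀ hβ hαβ hα₀ t pa
  · exact le_rfl

theorem WK_sum {n : ℕ} [NeZero n] (K : ℕ) (hK1 : 1 ≤ K) (hKn : K ≤ n) (α β θ : ℝ) (hβ : 0 ≤ β)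
    (hαβ : 0 < α + β) :
    ∑ pa : Fin n → Fin n, ∑ g, WK K α β θ pa g = 1 := by
  rw [← sum_fK (n := n) K hK1 α β hβ hαβ]
  refine Finset.sum_congr rfl fun pa _ => ?_
  rw [prod_fK]
  by_cases h : IsForestMap n K pa
  · have hs := noise_sumR θ pa (isR_of_isK h)
    rw [roots_card hKn h, ← graph_eq h] at hs
    rw [if_pos h, ← mul_one (apaKProb K α β pa), ← hs, Finset.mul_sum]
    refine Finset.sum_congr rfl fun g _ => ?_
    unfold WK
    by_cases hg : forestGraph K pa ≤ g
    · simp [h, hg]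
    · simp [h, hg]
  · simp [WK, h]

theorem WR_sum {n : ℕ} [NeZero n] (α β α₀ θ : ℝ) (hβ : 0 ≤ β)
    (hαβ : 0 < α + β) (hα₀ : 0 < α₀) :
    ∑ pa : Fin n → Fin n, ∑ g, WR α β α₀ θ pa g = 1 := by
  rw [← sum_fR (n := n) α β α₀ hβ hαβ hα₀]
  refine Finset.sum_congr rfl fun pa _ => ?_
  rw [prod_fR]
  by_cases h : IsRForestMap pa
  · have hs := noise_sumR θ pa h
    rw [if_pos h, ← mul_one (apaRProb α β α₀ pa), ← hs, Finset.mul_sum]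
    refine Finset.sum_congr rfl fun g _ => ?_
    unfold WR
    by_cases hg : forestGraphR pa ≤ g
    · simp [h, hg]
    · simp [h, hg]
  · simp [WR, h]

theorem postK_eq {U : Type} [Fintype U] [DecidableEq U] (n K : ℕ) (α β θ : ℝ)
    (g : SimpleGraph U) :
    postMemK n K α β θ g = postG (n := n) (WK K α β θ) (fun _ s => s.val < K) g := by
  funext u
  unfold postMemK postG WK
  congr 1
  refine Finset.sum_congr rfl fun π _ => Finset.sum_congr rfl fun pa _ => ?_
  by_cases h : (π.symm u).val < K
  · simp only [h, and_true, if_true]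
  · simp only [h, and_false, if_false]

theorem postR_eq {U : Type} [Fintype U] [DecidableEq U] (n : ℕ) (α β α₀ θ : ℝ)
    (g : SimpleGraph U) :
    postMemR n α β α₀ θ g = postG (n := n) (WR α β α₀ θ) (fun pa s => pa s = s) g := by
  funext u
  unfold postMemR postG WR
  congr 1
  refine Finset.sum_congr rfl fun π _ => Finset.sum_congr rfl fun pa _ => ?_
  by_cases h : pa (π.symm u) = π.symm u
  · simp only [h, and_true, if_true]
  · simp only [h, and_false, if_false]

end RSC

/-- **Theorem `frequentist-coverage2`.**  Let `G_n ~ PAPER(α,β,K,θ)` (fixed `K`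
roots) or `G_n ~ PAPER(α,β,α₀,θ)` (random number of roots), with `S` the set of
root nodes, and let `G*_n = ρ G_n` be the observed relabeled graph.  Then the
credible set `B_ε` built from the posterior root-membership probabilities (with
an independent uniformly random tie-breaking order `σ`) satisfies
`P(ρ S ⊆ B_ε(G*_n)) ≥ 1 - ε`, in both models. -/
theorem root_set_credible_coverage
    (n K : ℕ) [NeZero n] (hK1 : 1 ≤ K) (hKn : K ≤ n)
    (U : Type) [Fintype U] [DecidableEq U]
    (α β θ ε α₀ : ℝ)
    (hβ : 0 ≤ β) (hαβ : 0 < α + β) (hα₀ : 0 < α₀)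
    (hθ0 : 0 ≤ θ) (hθ1 : θ ≤ 1) (hε0 : 0 < ε) (hε1 : ε < 1)
    (ρ : Fin n ≃ U) :
    -- fixed-`K` model PAPER(α,β,K,θ)
    (1 - ε ≤
      (Nat.factorial n : ℝ)⁻¹ *
        ∑ σ : U ≃ Fin n, ∑ pa : Fin n → Fin n, ∑ g : SimpleGraph (Fin n),
          if IsForestMap n K pa ∧ forestGraph K pa ≤ g ∧
              (∀ s : Fin n, s.val < K →
                ρ s ∈ BsetOf (postMemK n K α β θ (g.comap ⇑ρ.symm)) ε σ) then
            apaKProb K α β pa * noiseWeight n θ K g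
          else 0) ∧
    -- random-`K` model PAPER(α,β,α₀,θ)
    (1 - ε ≤
      (Nat.factorial n : ℝ)⁻¹ *
        ∑ σ : U ≃ Fin n, ∑ pa : Fin n → Fin n, ∑ g : SimpleGraph (Fin n),
          if IsRForestMap pa ∧ forestGraphR pa ≤ g ∧
              (∀ s : Fin n, pa s = s →
                ρ s ∈ BsetOf (postMemR n α β α₀ θ (g.comap ⇑ρ.symm)) ε σ) then
            apaRProb α β α₀ pa * noiseWeight n θ (rootsR pa).card g
          else 0) := by
  constructor
  · have h := RSC.coverage (RSC.WK K α β θ) (fun (_ : Fin n → Fin n) s => s.val < K)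
      (RSC.WK_nonneg K hK1 α β θ hβ hαβ hθ0 hθ1)
      (RSC.WK_sum K hK1 hKn α β θ hβ hαβ) ε hε0 ρ
    refine h.trans (le_of_eq ?_)
    congr 1
    unfold RSC.covG
    refine Finset.sum_congr rfl fun σ _ => Finset.sum_congr rfl fun pa _ =>
      Finset.sum_congr rfl fun g _ => ?_
    rw [RSC.postK_eq]
    generalize RSC.postG (RSC.WK K α β θ) (fun _ s => s.val < K) (g.comap ⇑ρ.symm) = p
    by_cases hc : ∀ s : Fin n, s.val < K → ρ s ∈ BsetOf p ε σ
    · rw [if_pos hc]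
      unfold RSC.WK
      by_cases h2 : IsForestMap n K pa ∧ forestGraph K pa ≤ g
      · rw [if_pos h2, if_pos ⟨h2.1, h2.2, hc⟩]
      · rw [if_neg h2, if_neg (fun h3 => h2 ⟨h3.1, h3.2.1⟩)]
    · rw [if_neg hc, if_neg (fun h3 => hc h3.2.2)]
  · have h := RSC.coverage (RSC.WR α β α₀ θ) (fun (pa : Fin n → Fin n) s => pa s = s)
      (RSC.WR_nonneg α β α₀ θ hβ hαβ hα₀ hθ0 hθ1)
      (RSC.WR_sum α β α₀ θ hβ hαβ hα₀) ε hε0 ρ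
    refine h.trans (le_of_eq ?_)
    congr 1
    unfold RSC.covG
    refine Finset.sum_congr rfl fun σ _ => Finset.sum_congr rfl fun pa _ =>
      Finset.sum_congr rfl fun g _ => ?_
    rw [RSC.postR_eq]
    generalize RSC.postG (RSC.WR α β α₀ θ) (fun pa s => pa s = s) (g.comap ⇑ρ.symm) = p
    by_cases hc : ∀ s : Fin n, pa s = s → ρ s ∈ BsetOf p ε σ
    · rw [if_pos hc]
      unfold RSC.WR
      by_cases h2 : IsRForestMap pa ∧ forestGraphR pa ≤ g
      · rw [if_pos h2, if_pos ⟨h2.1, h2.2, hc⟩]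
      · rw [if_neg h2, if_neg (fun h3 => h2 ⟨h3.1, h3.2.1⟩)]
    · rw [if_neg hc, if_neg (fun h3 => hc h3.2.2)]
end
end

section
/- Let F_n ~ APA(α, β, K). Then for any time-labeled forest f_n on [n] attainable by the process (i.e., f_n has exactly K component trees, nodes 1,…,K lie in distinct components, and every node t > K has exactly one neighbor with smaller label), P(F_n = f_n) = [ ∏_{v ∈ [K]} ψ^r_{α,β}(D_{f_n}(v)) · ∏_{v ∉ [K]} ψ_{α,β}(D_{f_n}(v)) ] / [ ∏_{t=K+1}^n (2(t−1)β + (t−1)α) ], where ψ_{α,β}(k) = ∏_{j=1}^{k−1}(βj + α) with ψ_{α,β}(1) = 1, and ψ^r_{α,β}(k) = ∏_{j=2}^{k+1}(βj + α). -/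
open scoped Classical
open Finset

noncomputable section

/-- Probability that the time-labeled `APA(α,β,K)` random forest `F_n` equals
the given time-labeled graph `f_n` on `Fin n`. -/
def apaKGraphProb (n K : ℕ) (α β : ℝ) (f : SimpleGraph (Fin n)) : ℝ :=
  ∑ pa : Fin n → Fin n,
    if IsForestMap n K pa ∧ forestGraph K pa = f then apaKProb K α β pa else 0

/-- `ψ_{α,β}(k) = ∏_{j=1}^{k-1} (βj + α)`, with `ψ_{α,β}(1) = 1`. -/
def psi (α β : ℝ) (k : ℕ) : ℝ :=
  ∏ j ∈ Finset.Ico 1 k, (β * (j : ℝ) + α)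

/-- `ψ^r_{α,β}(k) = ∏_{j=2}^{k+1} (βj + α)` (root version, accounting for the
imaginary self-loop). -/
def psiRoot (α β : ℝ) (k : ℕ) : ℝ :=
  ∏ j ∈ Finset.Icc 2 (k + 1), (β * (j : ℝ) + α)

lemma prod_rank {ι : Type*} [LinearOrder ι] (g : ℕ → ℝ) (S : Finset ι) :
    ∏ t ∈ S, g ((S.filter (fun s => s < t)).card) = ∏ i ∈ Finset.range S.card, g i := by
  induction S using Finset.induction_on_max with
  | empty => simp
  | insert a S ha ih =>
    have hn : a ∉ S := fun h => lt_irrefl _ (ha a h)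
    rw [Finset.prod_insert hn, Finset.card_insert_of_notMem hn, Finset.prod_range_succ, mul_comm, ← ih]
    congr 1
    · apply Finset.prod_congr rfl
      intro t ht
      rw [Finset.filter_insert, if_neg (not_lt.mpr (ha t ht).le)]
    · rw [Finset.filter_insert, if_neg (lt_irrefl _), Finset.filter_true_of_mem ha]

lemma psiRoot_range (α β : ℝ) (k : ℕ) :
    psiRoot α β k = ∏ i ∈ Finset.range k, (β * (i : ℝ) + 2 * β + α) := by
  unfold psiRoot
  rw [← Finset.Ico_add_one_right_eq_Icc, Finset.prod_Ico_eq_prod_range]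
  have : k + 1 + 1 - 2 = k := by omega
  rw [this]
  refine Finset.prod_congr rfl fun i _ => ?_
  push_cast; ring

lemma psi_range (α β : ℝ) (k : ℕ) :
    psi α β (k + 1) = ∏ i ∈ Finset.range k, (β * ((i : ℝ) + 1) + α) := by
  unfold psi
  rw [Finset.prod_Ico_eq_prod_range]
  refine Finset.prod_congr rfl fun i _ => ?_
  push_cast; ring

lemma forestGraph_adj {n K : ℕ} {pa : Fin n → Fin n} (h : IsForestMap n K pa) (v w : Fin n) :
    (forestGraph K pa).Adj v w ↔ (K ≤ w.val ∧ pa w = v) ∨ (K ≤ v.val ∧ pa v = w) := by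
  unfold forestGraph
  rw [SimpleGraph.fromRel_adj]
  constructor
  · exact fun h => h.2
  · intro h'
    refine ⟨?_, h'⟩
    rintro rfl
    have : K ≤ v.val ∧ pa v = v := by tauto
    have h2 := h.2 v this.1
    rw [this.2] at h2
    exact lt_irrefl _ h2

lemma denom_eq (n K : ℕ) (hKn : K ≤ n) (α β : ℝ) :
    ∏ t : Fin n, (if K ≤ t.val then ((2 * β + α) * (t.val : ℝ)) else 1) =
      ∏ t ∈ Finset.Icc (K + 1) n, (2 * ((t : ℝ) - 1) * β + ((t : ℝ) - 1) * α) := by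
  rw [Fin.prod_univ_eq_prod_range (fun t : ℕ => if K ≤ t then ((2 * β + α) * (t : ℝ)) else 1) n,
    ← Finset.prod_filter]
  symm
  refine Finset.prod_bij' (fun t _ => t - 1) (fun t _ => t + 1) ?_ ?_ ?_ ?_ ?_
  · intro t ht; simp at ht ⊢; omega
  · intro t ht; simp at ht ⊢; omega
  · intro t ht; simp at ht ⊢; omega
  · intro t ht; simp
  · intro t ht
    simp at ht
    rw [Nat.cast_sub (by omega)]
    push_cast; ring

lemma ncard_nbr {n K : ℕ} {pa : Fin n → Fin n} (h : IsForestMap n K pa) (v : Fin n) :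
    ((forestGraph K pa).neighborSet v).ncard =
      (Finset.univ.filter (fun s : Fin n => K ≤ s.val ∧ pa s = v)).card +
        (if K ≤ v.val then 1 else 0) := by
  have hs : (forestGraph K pa).neighborSet v =
      ((Finset.univ.filter (fun s : Fin n => K ≤ s.val ∧ pa s = v)) ∪
        (if K ≤ v.val then {pa v} else ∅) : Finset (Fin n)) := by
    ext w
    rw [SimpleGraph.mem_neighborSet, forestGraph_adj h]
    by_cases hv : K ≤ v.val <;> simp [hv, eq_comm, or_comm]
  rw [hs, Set.ncard_coe_finset, Finset.card_union_of_disjoint]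
  · split_ifs <;> simp
  · split_ifs with hv
    · rw [Finset.disjoint_singleton_right]
      simp only [Finset.mem_filter, Finset.mem_univ, true_and, not_and]
      intro h1 h2
      have a := h.2 _ h1
      have b := h.2 _ hv
      rw [h2] at a
      exact lt_asymm a b
    · simp

lemma degAtK_child {n K : ℕ} (hK : 1 ≤ K) {pa : Fin n → Fin n} (h : IsForestMap n K pa)
    (v t : Fin n) (ht : K ≤ t.val) (hv : pa t = v) :
    degAtK K pa (t.val - 1) v =
      ((Finset.univ.filter (fun s : Fin n => K ≤ s.val ∧ pa s = v)).filter (fun s => s < t)).card +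
        (if K ≤ v.val then 1 else 0) := by
  unfold degAtK
  have hlt := h.2 t ht
  rw [hv] at hlt
  congr 1
  · congr 1
    ext s
    simp only [Finset.mem_filter, Finset.mem_univ, true_and, Fin.lt_def]
    constructor
    · rintro ⟨a, b, c⟩; exact ⟨⟨a, c⟩, by omega⟩
    · rintro ⟨⟨a, c⟩, b⟩; exact ⟨a, by omega, c⟩
  · have : v.val ≤ t.val - 1 := by omega
    simp [this]

lemma apaKProb_eq {n K : ℕ} (hK : 1 ≤ K) (hKn : K ≤ n) (α β : ℝ) {pa : Fin n → Fin n}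
    (h : IsForestMap n K pa) :
    apaKProb K α β pa =
      (∏ v : Fin n,
          if v.val < K then psiRoot α β (((forestGraph K pa).neighborSet v).ncard)
          else psi α β (((forestGraph K pa).neighborSet v).ncard)) /
        ∏ t ∈ Finset.Icc (K + 1) n, (2 * ((t : ℝ) - 1) * β + ((t : ℝ) - 1) * α) := by
  rw [← denom_eq n K hKn]
  unfold apaKProb
  have h1 : ∀ t : Fin n, (if K ≤ t.val then
      (β * degAtK K pa (t.val - 1) (pa t) + 2 * β * (if (pa t).val < K then 1 else 0) + α) /
        ((2 * β + α) * (t.val : ℝ)) else 1) =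
      (if K ≤ t.val then
      (β * degAtK K pa (t.val - 1) (pa t) + 2 * β * (if (pa t).val < K then 1 else 0) + α) else 1) /
      (if K ≤ t.val then ((2 * β + α) * (t.val : ℝ)) else 1) := by
    intro t
    by_cases ht : K ≤ t.val <;> simp [ht]
  rw [Finset.prod_congr rfl (fun t _ => h1 t), Finset.prod_div_distrib]
  congr 1
  rw [← Finset.prod_filter, ← Finset.prod_fiberwise _ pa]
  refine Finset.prod_congr rfl fun v _ => ?_
  rw [Finset.filter_filter, ncard_nbr h]
  set S := Finset.univ.filter (fun s : Fin n => K ≤ s.val ∧ pa s = v) with hS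
  by_cases hv : v.val < K
  · rw [if_pos hv, if_neg (not_le.mpr hv), add_zero, psiRoot_range,
      ← prod_rank (fun i : ℕ => β * (i : ℝ) + 2 * β + α) S]
    refine Finset.prod_congr rfl fun t ht => ?_
    obtain ⟨-, ht1, ht2⟩ := Finset.mem_filter.mp ht
    rw [ht2, degAtK_child hK h v t ht1 ht2]
    simp [hv, not_le.mpr hv, hS]
  · rw [if_neg hv, if_pos (not_lt.mp hv), psi_range,
      ← prod_rank (fun i : ℕ => β * ((i : ℝ) + 1) + α) S]
    refine Finset.prod_congr rfl fun t ht => ?_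
    obtain ⟨-, ht1, ht2⟩ := Finset.mem_filter.mp ht
    rw [ht2, degAtK_child hK h v t ht1 ht2]
    simp [hv, not_lt.mp hv, hS]

/-- **Likelihood of an APA forest (Proposition `apa-prob2`).**  For
`F_n ~ APA(α,β,K)` and any time-labeled forest `f_n` attainable by the process
(`f_n` has exactly `K` component trees, the roots `0,…,K-1` lie in distinct
components, and every node `t ≥ K` has exactly one neighbor with smaller label),
`P(F_n = f_n) = [∏_{roots v} ψ^r_{α,β}(D(v)) · ∏_{non-roots v} ψ_{α,β}(D(v))]
  / ∏_{t=K+1}^n (2(t-1)β + (t-1)α)`. -/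
theorem apa_forest_likelihood
    (n K : ℕ) (hK : 1 ≤ K) (hKn : K ≤ n) (α β : ℝ)
    (f : SimpleGraph (Fin n))
    (hcomp : Nat.card f.ConnectedComponent = K)
    (hroots : ∀ i j : Fin n, i.val < K → j.val < K → i ≠ j →
      f.connectedComponentMk i ≠ f.connectedComponentMk j)
    (hrec : ∀ t : Fin n, K ≤ t.val → ∃! w : Fin n, f.Adj t w ∧ w.val < t.val) :
    apaKGraphProb n K α β f =
      (∏ v : Fin n,
          if v.val < K then psiRoot α β ((f.neighborSet v).ncard)
          else psi α β ((f.neighborSet v).ncard)) /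
        ∏ t ∈ Finset.Icc (K + 1) n, (2 * ((t : ℝ) - 1) * β + ((t : ℝ) - 1) * α) := by
  choose! p hp hu using hrec
  let pa : Fin n → Fin n := fun t => if K ≤ t.val then p t else t
  have hpa : ∀ t : Fin n, K ≤ t.val → pa t = p t := fun t ht => if_pos ht
  have hF : IsForestMap n K pa := by
    refine ⟨fun t ht => if_neg (not_le.mpr ht), fun t ht => ?_⟩
    rw [hpa t ht]; exact (hp t ht).2
  have hG : forestGraph K pa = f := by
    ext v w
    rw [forestGraph_adj hF]
    constructor
    · rintro (⟨a, b⟩ | ⟨a, b⟩)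
      · rw [hpa _ a] at b; rw [← b]; exact (hp _ a).1.symm
      · rw [hpa _ a] at b; rw [← b]; exact (hp _ a).1
    · intro hadj
      have hne := hadj.ne
      rcases lt_or_gt_of_ne hne with hlt | hlt
      · left
        have hw : K ≤ w.val := by
          by_contra hc
          have hlt' : v.val < w.val := hlt
          exact hroots v w (by omega) (by omega) hne
            (SimpleGraph.ConnectedComponent.sound hadj.reachable)
        exact ⟨hw, by rw [hpa _ hw]; exact (hu w hw v ⟨hadj.symm, hlt⟩).symm⟩
      · right
        have hv : K ≤ v.val := by
          by_contra hc
          have hlt' : w.val < v.val := hlt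
          exact hroots v w (by omega) (by omega) hne
            (SimpleGraph.ConnectedComponent.sound hadj.reachable)
        exact ⟨hv, by rw [hpa _ hv]; exact (hu v hv w ⟨hadj, hlt⟩).symm⟩
  unfold apaKGraphProb
  rw [Finset.sum_eq_single pa]
  · rw [if_pos ⟨hF, hG⟩, apaKProb_eq hK hKn α β hF, hG]
  · intro q _ hq
    rw [if_neg]
    rintro ⟨hqF, hqG⟩
    apply hq
    funext t
    by_cases ht : K ≤ t.val
    · rw [hpa t ht]
      refine hu t ht (q t) ⟨?_, hqF.2 t ht⟩
      rw [← hqG, forestGraph_adj hqF]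
      exact Or.inr ⟨ht, rfl⟩
    · rw [hqF.1 t (not_le.mp ht), hF.1 t (not_le.mp ht)]
  · intro hc; exact absurd (Finset.mem_univ _) hc
end
end

section
/- Let t ∈ ℕ, let q_1,…,q_t ∈ [0,1] with Σ_{j=1}^t q_j ≤ 1, and let θ > 0 be such that θ q_j ≤ 1 for all j ∈ [t]. Let X and Y be random subsets of [t], where X includes each j ∈ [t] independently with probability θ q_j, and Y is generated by drawing M ~ Poisson(θ) and then, M times independently and with replacement, choosing an element j ∈ [t] with probability q_j and adding it to Y. Let P^{(X)} and P^{(Y)} be the laws of X and Y. Then the total variation distance satisfies d_TV(P^{(X)}, P^{(Y)}) ≤ θ² · max_{j ∈ [t]} q_j. -/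
open scoped Classical
open Finset

noncomputable section

/-- Law of the random subset `X ⊆ [t]` that includes each `j` independently with
probability `θ q_j`. -/
def bernoulliSetLaw (t : ℕ) (q : Fin t → ℝ) (θ : ℝ) (A : Finset (Fin t)) : ℝ :=
  ∏ j : Fin t, if j ∈ A then θ * q j else 1 - θ * q j

/-- Weight of one draw in the Poissonized mechanism: an element `j` is drawn
with probability `q j`, and no element is drawn with the remaining probability
`1 - Σ_j q j` (encoded as `none`). -/
def drawWeight (t : ℕ) (q : Fin t → ℝ) : Option (Fin t) → ℝ
  | none => 1 - ∑ j : Fin t, q j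
  | some j => q j

/-- Law of the random subset `Y ⊆ [t]` generated by drawing `M ~ Poisson(θ)` and
then, `M` times independently and with replacement, choosing `j ∈ [t]` with
probability `q j` and adding it to `Y` (multiplicities collapsed). -/
def poissonSetLaw (t : ℕ) (q : Fin t → ℝ) (θ : ℝ) (A : Finset (Fin t)) : ℝ :=
  ∑' m : ℕ, (Real.exp (-θ) * θ ^ m / (Nat.factorial m : ℝ)) *
    ∑ ω : Fin m → Option (Fin t),
      (∏ i : Fin m, drawWeight t q (ω i)) *
        (if Finset.univ.filter (fun j : Fin t => ∃ i : Fin m, ω i = some j) = A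
          then 1 else 0)

/-- Total variation distance between two mass functions on subsets of `[t]`. -/
def tvDist (t : ℕ) (P Q : Finset (Fin t) → ℝ) : ℝ :=
  (1 / 2) * ∑ A : Finset (Fin t), |P A - Q A|

/-- product law on subsets of `s` -/
def pl {ι : Type*} (s : Finset ι) (a b : ι → ℝ) (A : Finset ι) : ℝ :=
  ∏ j ∈ s, if j ∈ A then a j else b j

lemma pl_insert_left {ι : Type*} {s : Finset ι} {i : ι} (hi : i ∉ s) (a b : ι → ℝ)
    {A : Finset ι} (hA : i ∉ A) : pl (insert i s) a b A = b i * pl s a b A := by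
  unfold pl
  rw [Finset.prod_insert hi, if_neg hA]

lemma pl_insert_right {ι : Type*} {s : Finset ι} {i : ι} (hi : i ∉ s) (a b : ι → ℝ)
    (A : Finset ι) : pl (insert i s) a b (insert i A) = a i * pl s a b A := by
  unfold pl
  rw [Finset.prod_insert hi, if_pos (Finset.mem_insert_self _ _)]
  congr 1
  refine Finset.prod_congr rfl fun j hj => ?_
  have : j ≠ i := fun h => hi (h ▸ hj)
  simp [this]

lemma pl_sum {ι : Type*} (s : Finset ι) (a b : ι → ℝ) :
    ∑ A ∈ s.powerset, pl s a b A = ∏ j ∈ s, (a j + b j) := by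
  induction s using Finset.induction_on with
  | empty => simp [pl]
  | insert i s hi ih =>
    rw [Finset.sum_powerset_insert hi, Finset.prod_insert hi, ← ih, add_mul, Finset.mul_sum,
      Finset.mul_sum, add_comm]
    congr 1
    · exact Finset.sum_congr rfl fun A _ => pl_insert_right hi a b A
    · refine Finset.sum_congr rfl fun A hA => pl_insert_left hi a b ?_
      exact fun h => hi (Finset.mem_powerset.1 hA h)

lemma pl_nonneg {ι : Type*} (s : Finset ι) (a b : ι → ℝ) (ha : ∀ j, 0 ≤ a j) (hb : ∀ j, 0 ≤ b j)
    (A : Finset ι) : 0 ≤ pl s a b A := by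
  unfold pl
  refine Finset.prod_nonneg fun j _ => ?_
  split_ifs
  · exact ha j
  · exact hb j

lemma pl_tv {ι : Type*} (s : Finset ι) (a b : ι → ℝ) (ha : ∀ j, 0 ≤ a j) (ha1 : ∀ j, a j ≤ 1)
    (hb : ∀ j, 0 ≤ b j) (hb1 : ∀ j, b j ≤ 1) :
    ∑ A ∈ s.powerset, |pl s a (fun j => 1 - a j) A - pl s b (fun j => 1 - b j) A|
      ≤ 2 * ∑ j ∈ s, |a j - b j| := by
  induction s using Finset.induction_on with
  | empty => simp [pl]
  | insert i s hi ih =>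
    have key : ∀ A ∈ s.powerset,
        |pl (insert i s) a (fun j => 1 - a j) A - pl (insert i s) b (fun j => 1 - b j) A| +
        |pl (insert i s) a (fun j => 1 - a j) (insert i A)
          - pl (insert i s) b (fun j => 1 - b j) (insert i A)|
        ≤ |pl s a (fun j => 1 - a j) A - pl s b (fun j => 1 - b j) A|
          + 2 * |a i - b i| * pl s a (fun j => 1 - a j) A := by
      intro A hA
      have hiA : i ∉ A := fun h => hi (Finset.mem_powerset.1 hA h)
      rw [pl_insert_left hi _ _ hiA, pl_insert_left hi _ _ hiA, pl_insert_right hi,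
        pl_insert_right hi]
      have hP := pl_nonneg s a (fun j => 1 - a j) ha (fun j => sub_nonneg.2 (ha1 j)) A
      generalize pl s a (fun j => 1 - a j) A = P at *
      generalize pl s b (fun j => 1 - b j) A = Q at *
      have h1 : |(1 - a i) * P - (1 - b i) * Q| ≤ |a i - b i| * P + (1 - b i) * |P - Q| := by
        have e : (1 - a i) * P - (1 - b i) * Q = -(a i - b i) * P + (1 - b i) * (P - Q) := by ring
        rw [e]
        refine (abs_add_le _ _).trans_eq ?_
        rw [abs_mul, abs_mul, abs_neg, abs_of_nonneg hP, abs_of_nonneg (sub_nonneg.2 (hb1 i))]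
      have h2 : |a i * P - b i * Q| ≤ |a i - b i| * P + b i * |P - Q| := by
        have e : a i * P - b i * Q = (a i - b i) * P + b i * (P - Q) := by ring
        rw [e]
        refine (abs_add_le _ _).trans_eq ?_
        rw [abs_mul, abs_mul, abs_of_nonneg hP, abs_of_nonneg (hb i)]
      linarith
    rw [Finset.sum_powerset_insert hi, ← Finset.sum_add_distrib, Finset.sum_insert hi]
    refine (Finset.sum_le_sum key).trans ?_
    rw [Finset.sum_add_distrib, ← Finset.mul_sum, pl_sum]
    simp only [add_sub_cancel, Finset.prod_const_one]
    linarith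

/-- Law after exactly `m` draws. -/
def cm (t : ℕ) (q : Fin t → ℝ) (m : ℕ) (A : Finset (Fin t)) : ℝ :=
    ∑ ω : Fin m → Option (Fin t),
      (∏ i : Fin m, drawWeight t q (ω i)) *
        (if Finset.univ.filter (fun j : Fin t => ∃ i : Fin m, ω i = some j) = A
          then 1 else 0)

lemma cm_sum (t : ℕ) (q : Fin t → ℝ) (m : ℕ) (A : Finset (Fin t)) :
    ∑ B ∈ A.powerset, cm t q m B = (1 - ∑ j ∈ univ \ A, q j) ^ m := by
  have h0 : (1 - ∑ j ∈ univ \ A, q j) =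
      ∑ o : Option (Fin t), drawWeight t q o * (if ∀ j, o = some j → j ∈ A then 1 else 0) := by
    rw [Fintype.sum_option]
    have := Finset.sum_sdiff (f := q) (Finset.subset_univ A)
    simp [drawWeight, Finset.sum_ite_mem]
    simp at this
    linarith
  rw [h0, Fintype.sum_pow]
  unfold cm
  rw [Finset.sum_comm]
  refine Finset.sum_congr rfl fun ω _ => ?_
  rw [← Finset.mul_sum, Finset.prod_mul_distrib, Finset.sum_ite_eq]
  congr 1
  by_cases h : ∀ i j, ω i = some j → j ∈ A
  · rw [if_pos, Finset.prod_eq_one]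
    · intro i _
      exact if_pos (h i)
    · rw [Finset.mem_powerset]
      intro j hj
      obtain ⟨i, hi⟩ := (Finset.mem_filter.1 hj).2
      exact h i j hi
  · have h' := h
    push Not at h'
    obtain ⟨i, j, hij, hj⟩ := h'
    rw [if_neg, Finset.prod_eq_zero (Finset.mem_univ i)]
    · exact if_neg fun hh => hj (hh j hij)
    · intro hh
      exact hj (Finset.mem_powerset.1 hh (Finset.mem_filter.2 ⟨Finset.mem_univ _, i, hij⟩))

lemma pl_sum_sub (t : ℕ) (a b : Fin t → ℝ) (hab : ∀ j, a j + b j = 1) (A : Finset (Fin t)) :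
    ∑ B ∈ A.powerset, pl univ a b B = ∏ j ∈ univ \ A, b j := by
  have h : ∀ B ∈ A.powerset, pl univ a b B = (∏ j ∈ univ \ A, b j) * pl A a b B := by
    intro B hB
    unfold pl
    rw [← Finset.prod_sdiff (Finset.subset_univ A)]
    congr 1
    refine Finset.prod_congr rfl fun j hj => if_neg fun h => ?_
    exact (Finset.mem_sdiff.1 hj).2 (Finset.mem_powerset.1 hB h)
  rw [Finset.sum_congr rfl h, ← Finset.mul_sum, pl_sum]
  simp [hab]

lemma poisson_hasSum (t : ℕ) (q : Fin t → ℝ) (θ : ℝ) (A : Finset (Fin t)) :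
    HasSum (fun m : ℕ => (Real.exp (-θ) * θ ^ m / (Nat.factorial m : ℝ)) * cm t q m A)
      (pl univ (fun j => 1 - Real.exp (-(θ * q j))) (fun j => Real.exp (-(θ * q j))) A) := by
  induction A using Finset.strongInduction with
  | H A ih =>
    have hs := pl_sum_sub t (fun j => 1 - Real.exp (-(θ * q j)))
      (fun j => Real.exp (-(θ * q j))) (fun j => by ring) A
    have hA : A ∉ A.ssubsets := by simp
    have hps : A.powerset = insert A A.ssubsets := by
      rw [Finset.ssubsets, Finset.insert_erase (Finset.mem_powerset_self A)]
    rw [hps, Finset.sum_insert hA] at hs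
    have hc : ∀ m, cm t q m A = (1 - ∑ j ∈ univ \ A, q j) ^ m - ∑ B ∈ A.ssubsets, cm t q m B := by
      intro m
      have := cm_sum t q m A
      rw [hps, Finset.sum_insert hA] at this
      linarith
    rw [eq_sub_of_add_eq hs]
    simp only [hc, mul_sub, Finset.mul_sum]
    refine HasSum.sub ?_ (hasSum_sum fun B hB => ih B (Finset.mem_ssubsets.1 hB))
    have he := (NormedSpace.expSeries_div_hasSum_exp (𝔸 := ℝ)
      (θ * (1 - ∑ j ∈ univ \ A, q j))).mul_left (Real.exp (-θ))
    rw [← Real.exp_eq_exp_ℝ, ← Real.exp_add] at he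
    rw [← Real.exp_sum]
    have e1 : (fun m : ℕ => Real.exp (-θ) * θ ^ m / (m.factorial : ℝ) *
        (1 - ∑ j ∈ univ \ A, q j) ^ m) = fun i : ℕ =>
        Real.exp (-θ) * ((θ * (1 - ∑ j ∈ univ \ A, q j)) ^ i / (i.factorial : ℝ)) := by
      funext m
      rw [mul_pow]
      ring
    have e2 : ∑ x ∈ univ \ A, -(θ * q x) = -θ + θ * (1 - ∑ j ∈ univ \ A, q j) := by
      rw [Finset.sum_neg_distrib, ← Finset.mul_sum]
      ring
    rw [e1, e2]
    exact he

/-- **Proposition `poisson_approx`.**  Let `q_1,…,q_t ∈ [0,1]` with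
`Σ_j q_j ≤ 1` and let `θ > 0` with `θ q_j ≤ 1` for all `j`.  Then the laws of
the independent-Bernoulli random subset `X` and of the Poissonized random subset
`Y` satisfy `d_TV(P^(X), P^(Y)) ≤ θ² · max_j q_j`. -/
theorem poisson_bernoulli_tv_bound
    (t : ℕ) (ht : 0 < t) (q : Fin t → ℝ)
    (hq0 : ∀ j, 0 ≤ q j) (hq1 : ∀ j, q j ≤ 1)
    (hqsum : ∑ j : Fin t, q j ≤ 1)
    (θ : ℝ) (hθ : 0 < θ) (hθq : ∀ j, θ * q j ≤ 1) :
    tvDist t (bernoulliSetLaw t q θ) (poissonSetLaw t q θ) ≤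
      θ ^ 2 * Finset.univ.sup' (Finset.univ_nonempty_iff.mpr ⟨⟨0, ht⟩⟩) q := by
  have hY : ∀ A, poissonSetLaw t q θ A =
      pl univ (fun j => 1 - Real.exp (-(θ * q j))) (fun j => 1 - (1 - Real.exp (-(θ * q j)))) A := by
    intro A
    simp only [sub_sub_cancel]
    exact (poisson_hasSum t q θ A).tsum_eq
  have h0 : ∀ j, 0 ≤ θ * q j := fun j => mul_nonneg hθ.le (hq0 j)
  have hX : ∀ A, bernoulliSetLaw t q θ A =
      pl univ (fun j => θ * q j) (fun j => 1 - θ * q j) A := by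
    intro A
    unfold bernoulliSetLaw pl
    congr!
  have htv := pl_tv univ (fun j => θ * q j) (fun j => 1 - Real.exp (-(θ * q j))) h0 hθq
    (fun j => by
      have := Real.exp_le_one_iff.2 (neg_nonpos.2 (h0 j))
      linarith) (fun j => by
      have := Real.exp_pos (-(θ * q j))
      linarith)
  rw [Finset.powerset_univ] at htv
  unfold tvDist
  simp only [hX, hY]
  set M := Finset.univ.sup' (Finset.univ_nonempty_iff.mpr ⟨⟨0, ht⟩⟩) q with hM
  have hqM : ∀ j, q j ≤ M := fun j => Finset.le_sup' q (Finset.mem_univ j)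
  have hM0 : 0 ≤ M := (hq0 ⟨0, ht⟩).trans (hqM _)
  have hb : ∑ j, |θ * q j - (1 - Real.exp (-(θ * q j)))| ≤ ∑ j, θ ^ 2 * M * q j := by
    refine Finset.sum_le_sum fun j _ => ?_
    have h := Real.abs_exp_sub_one_sub_id_le (x := -(θ * q j))
      (by rw [abs_neg, abs_of_nonneg (h0 j)]; exact hθq j)
    have e : θ * q j - (1 - Real.exp (-(θ * q j))) =
      Real.exp (-(θ * q j)) - 1 - -(θ * q j) := by ring
    rw [e]
    refine h.trans ?_
    have : q j * q j ≤ M * q j := mul_le_mul_of_nonneg_right (hqM j) (hq0 j)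
    nlinarith [mul_le_mul_of_nonneg_left this (sq_nonneg θ)]
  rw [← Finset.mul_sum] at hb
  have : θ ^ 2 * M * ∑ j, q j ≤ θ ^ 2 * M := mul_le_of_le_one_right (by positivity) hqsum
  linarith
end
end

section
/- Let G_n ~ PAPER(α, β, θ), let Π be uniformly random on Bi([n], U_n) independent of G_n, and G̃_n = Π G_n. Then for any alphabetically labeled graph g̃_n on U_n and any node u ∈ U_n, the posterior root probability equals the normalized likelihood of u being the root given the unlabeled shape: P(Π_1 = u | G̃_n = g̃_n) = 𝓛(u, g̃_n) / Σ_{v ∈ U_n} 𝓛(v, g̃_n). -/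
open scoped Classical
open Finset

noncomputable section

variable {U : Type} [Fintype U] [DecidableEq U]

/-- `(g, v) ∼₀ (g', v')`: the rooted graphs have the same shape, i.e. there is a
relabeling bijection carrying `g` to `g'` and `v` to `v'`. -/
def RootedIso {V V' : Type} (g : SimpleGraph V) (v : V)
    (g' : SimpleGraph V') (v' : V') : Prop :=
  ∃ e : V ≃ V', (∀ x y : V, g.Adj x y ↔ g'.Adj (e x) (e y)) ∧ e v = v'

/-- `Eq(u, g)`: the nodes of `g` indistinguishable from `u` once labels are removed. -/
def eqClass {V : Type} (g : SimpleGraph V) (u : V) : Set V :=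
  {u' | RootedIso g u g u'}

/-- The likelihood `𝓛(u, g̃)` that node `u` is the root on observing the
unlabeled shape of `g̃`:
`𝓛(u, g̃) = |Eq(u,g̃)|⁻¹ · Σ_{time-labeled g} P(G_n = g) 1{(g,1) ∼₀ (g̃,u)}`. -/
def rootLikelihood (n : ℕ) [NeZero n] (α β θ : ℝ) (g : SimpleGraph U) (u : U) : ℝ :=
  ((eqClass g u).ncard : ℝ)⁻¹ *
    ∑ g' : SimpleGraph (Fin n),
      if RootedIso g' 0 g u then paperProb n α β θ g' else 0

/-- Number of isomorphisms from the rooted graph `(g', v)` to `(g, u)`. -/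
def isoFin {V U : Type} [Fintype V] [Fintype U] (g' : SimpleGraph V) (v : V)
    (g : SimpleGraph U) (u : U) : Finset (V ≃ U) :=
  Finset.univ.filter (fun e => (∀ x y, g'.Adj x y ↔ g.Adj (e x) (e y)) ∧ e v = u)

theorem isoFin_card_left {V U : Type} [Fintype V] [Fintype U] (g' : SimpleGraph V) (v : V)
    (g : SimpleGraph U) (u : U) (h : RootedIso g' v g u) :
    (isoFin g' v g u).card = (isoFin g u g u).card := by
  obtain ⟨e0, h1, h2⟩ := h
  refine Finset.card_bij' (fun e _ => e0.symm.trans e) (fun e _ => e0.trans e) ?_ ?_ ?_ ?_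
  · intro e he
    simp only [isoFin, Finset.mem_filter, Finset.mem_univ, true_and] at he ⊢
    refine ⟨fun x y => ?_, ?_⟩
    · have := h1 (e0.symm x) (e0.symm y)
      simp only [Equiv.apply_symm_apply] at this
      rw [← this, he.1]; rfl
    · have h3 : e0.symm u = v := by rw [← h2]; simp
      simp [h3, he.2]
  · intro e he
    simp only [isoFin, Finset.mem_filter, Finset.mem_univ, true_and] at he ⊢
    refine ⟨fun x y => ?_, ?_⟩
    · rw [h1, he.1]; rfl
    · simp [h2, he.2]
  · intro e _; ext x; simp
  · intro e _; ext x; simp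

theorem isoFin_card_right {V U : Type} [Fintype V] [Fintype U] (g' : SimpleGraph V) (v : V)
    (g : SimpleGraph U) (u : U) (h : RootedIso g' v g u) :
    (isoFin g' v g u).card = (isoFin g' v g' v).card := by
  obtain ⟨e0, h1, h2⟩ := h
  refine Finset.card_bij' (fun e _ => e.trans e0.symm) (fun e _ => e.trans e0) ?_ ?_ ?_ ?_
  · intro e he
    simp only [isoFin, Finset.mem_filter, Finset.mem_univ, true_and] at he ⊢
    refine ⟨fun x y => ?_, ?_⟩
    · rw [he.1, h1]; simp
    · simp [he.2, ← h2]
  · intro e he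
    simp only [isoFin, Finset.mem_filter, Finset.mem_univ, true_and] at he ⊢
    refine ⟨fun x y => ?_, ?_⟩
    · rw [he.1, h1]; rfl
    · simp [h2, he.2]
  · intro e _; ext x; simp
  · intro e _; ext x; simp

theorem isoFin_eq_empty {V U : Type} [Fintype V] [Fintype U] (g' : SimpleGraph V) (v : V)
    (g : SimpleGraph U) (u : U) (h : ¬ RootedIso g' v g u) :
    isoFin g' v g u = ∅ := by
  rw [isoFin, Finset.filter_eq_empty_iff]
  exact fun e _ he => h ⟨e, he⟩

/-- The automorphisms of `g`. -/
def autFin {U : Type} [Fintype U] (g : SimpleGraph U) : Finset (U ≃ U) :=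
  Finset.univ.filter (fun e => ∀ x y, g.Adj x y ↔ g.Adj (e x) (e y))

/-- Orbit-stabilizer. -/
theorem autFin_card {U : Type} [Fintype U] (g : SimpleGraph U) (u : U) :
    (autFin g).card = (eqClass g u).ncard * (isoFin g u g u).card := by
  rw [Finset.card_eq_sum_card_fiberwise (f := fun e => e u) (t := Finset.univ)
    (fun _ _ => by simp)]
  have h : ∀ v : U, ((autFin g).filter (fun e => e u = v)).card
      = if v ∈ eqClass g u then (isoFin g u g u).card else 0 := by
    intro v
    have h0 : (autFin g).filter (fun e => e u = v) = isoFin g u g v := by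
      ext e; simp [autFin, isoFin]
    rw [h0]
    split_ifs with hv
    · exact isoFin_card_right g u g v hv
    · rw [isoFin_eq_empty g u g v hv, Finset.card_empty]
  rw [Finset.sum_congr rfl (fun v _ => h v), ← Finset.sum_filter, Finset.sum_const, smul_eq_mul,
    Set.ncard_eq_toFinset_card']
  congr 2
  ext v; simp

theorem autFin_card_ne {U : Type} [Fintype U] (g : SimpleGraph U) : (autFin g).card ≠ 0 :=
  Finset.card_ne_zero_of_mem (a := Equiv.refl U) (by simp [autFin])

theorem sum_eq_aut_mul_likelihood (n : ℕ) [NeZero n] {U : Type} [Fintype U] [DecidableEq U]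
    (α β θ : ℝ) (g : SimpleGraph U) (u : U) :
    (∑ π : Fin n ≃ U, if π 0 = u then paperProb n α β θ (g.comap ⇑π) else 0)
      = ((autFin g).card : ℝ) * rootLikelihood n α β θ g u := by
  have hne := autFin_card_ne g
  have hc := autFin_card g u
  have hq : ((eqClass g u).ncard : ℝ) ≠ 0 := by
    intro h
    rw [Nat.cast_eq_zero] at h
    rw [h, zero_mul] at hc
    exact hne hc
  rw [rootLikelihood, hc, Nat.cast_mul]
  have : ((eqClass g u).ncard : ℝ) * ((isoFin g u g u).card : ℝ) *
      (((eqClass g u).ncard : ℝ)⁻¹ * ∑ g' : SimpleGraph (Fin n),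
      if RootedIso g' 0 g u then paperProb n α β θ g' else 0) =
      ((isoFin g u g u).card : ℝ) * ∑ g' : SimpleGraph (Fin n),
      if RootedIso g' 0 g u then paperProb n α β θ g' else 0 := by
    field_simp
  rw [this, Finset.mul_sum, ← Finset.sum_filter,
    ← Finset.sum_fiberwise (g := fun π : Fin n ≃ U => g.comap ⇑π)]
  refine Finset.sum_congr rfl fun g' _ => ?_
  have h0 : (Finset.univ.filter (fun π : Fin n ≃ U => π 0 = u)).filter
      (fun π : Fin n ≃ U => g.comap ⇑π = g') = isoFin g' 0 g u := by
    ext e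
    simp only [isoFin, Finset.mem_filter, Finset.mem_univ, true_and]
    rw [and_comm]
    refine and_congr ⟨?_, ?_⟩ Iff.rfl
    · rintro rfl x y; rfl
    · intro h; ext x y; exact (h x y).symm
  have h1 : ∑ π ∈ (Finset.univ.filter (fun π : Fin n ≃ U => π 0 = u)).filter
      (fun π : Fin n ≃ U => g.comap ⇑π = g'), paperProb n α β θ (g.comap ⇑π)
      = ((isoFin g' 0 g u).card : ℝ) * paperProb n α β θ g' := by
    rw [← h0, ← nsmul_eq_mul]
    refine Finset.sum_eq_card_nsmul fun π hπ => ?_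
    rw [(Finset.mem_filter.mp hπ).2]
  split_ifs with hr
  · rw [← isoFin_card_left g' 0 g u hr, ← h1]
  · rw [isoFin_eq_empty g' 0 g u hr] at h1
    simp only [Finset.card_empty, Nat.cast_zero, zero_mul] at h1
    rw [mul_zero, ← h1]

/-- **Theorem `equivalence-mle`.**  The posterior root probability of a node
equals its root likelihood, normalized:
`P(Π₁ = u | G̃_n = g̃) = 𝓛(u, g̃) / Σ_v 𝓛(v, g̃)`. -/
theorem posterior_eq_normalized_likelihood
    (n : ℕ) [NeZero n] (U : Type) [Fintype U] [DecidableEq U]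
    (α β θ : ℝ) (g : SimpleGraph U) (u : U) :
    postRoot n α β θ g u =
      rootLikelihood n α β θ g u / ∑ v : U, rootLikelihood n α β θ g v := by
  have hd : (∑ π : Fin n ≃ U, paperProb n α β θ (g.comap ⇑π))
      = ((autFin g).card : ℝ) * ∑ v : U, rootLikelihood n α β θ g v := by
    rw [Finset.mul_sum]
    simp_rw [← sum_eq_aut_mul_likelihood]
    rw [Finset.sum_comm]
    simp
  rw [postRoot, sum_eq_aut_mul_likelihood, hd, mul_div_mul_left]
  exact Nat.cast_ne_zero.mpr (autFin_card_ne g)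
end
end

section
/- Let t̃_n be a labeled tree on U_n and let π ∈ hist(π_1, t̃_n) be a valid history. Let u, v be two nodes, neither equal to the root π_1, with π^{−1}_u < π^{−1}_v, and let π* be the ordering obtained from π by swapping the positions of u and v. Root t̃_n at π_1 and let pa(·) denote the induced parent map. Then π* ∈ hist(π_1, t̃_n) if and only if (1) every child w of u satisfies π^{−1}_w > π^{−1}_v, and (2) the parent pa(v) of v satisfies π^{−1}_{pa(v)} < π^{−1}_u (i.e., all ancestors of v occupy π-positions earlier than that of u). -/
open scoped Classical

noncomputable section

/-- The set of valid histories, started at the root `r`, of a labeled tree `t`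
on the alphabet `U`: bijections `π : Fin n ≃ U` with `π 0 = r` such that every
initial segment `{π₀,…,π_s}` induces a connected subgraph of `t`. -/
def histSet {U : Type} [Fintype U] (n : ℕ) [NeZero n] (r : U) (t : SimpleGraph U) :
    Set (Fin n ≃ U) :=
  {π | π 0 = r ∧ ∀ s : Fin n, (t.induce (⇑π '' {i : Fin n | i ≤ s})).Connected}

/-- A bijection starting at the root is a valid history iff parents precede children. -/
theorem mem_histSet_iff_parent
    (n : ℕ) [NeZero n] (U : Type) [Fintype U]
    (t : SimpleGraph U) (ht : t.IsTree) (r : U)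
    (p : U → U)
    (hp : ∀ w : U, w ≠ r → t.Adj w (p w) ∧ t.dist r (p w) + 1 = t.dist r w)
    (σ : Fin n ≃ U) (h0 : σ 0 = r) :
    σ ∈ histSet n r t ↔ ∀ w, w ≠ r → σ.symm (p w) < σ.symm w := by
  have hmem : ∀ (s : Fin n) (x : U), x ∈ (⇑σ '' {i : Fin n | i ≤ s}) ↔ σ.symm x ≤ s := by
    intro s x
    constructor
    · rintro ⟨i, hi, rfl⟩
      simpa using hi
    · intro h
      exact ⟨σ.symm x, h, by simp⟩
  have hr : σ.symm r = 0 := by rw [← h0]; simp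
  constructor
  · rintro ⟨-, hc⟩ w hw
    obtain ⟨hadj, hd⟩ := hp w hw
    have hne : σ.symm (p w) ≠ σ.symm w := fun h => hadj.ne (σ.symm.injective h).symm
    refine lt_of_le_of_ne ?_ hne
    rw [← hmem]
    have hrS := (hmem (σ.symm w) r).2 (by rw [hr]; exact Fin.zero_le _)
    have hwS := (hmem (σ.symm w) w).2 le_rfl
    obtain ⟨q, hq⟩ := ((hc (σ.symm w)).preconnected ⟨r, hrS⟩ ⟨w, hwS⟩).exists_isPath
    obtain ⟨q', hq'⟩ := (ht.1.preconnected r (p w)).exists_walk_length_eq_dist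
    have hP : (q'.concat hadj.symm).IsPath := by
      apply SimpleGraph.Walk.isPath_of_length_eq_dist
      rw [SimpleGraph.Walk.length_concat, hq', hd]
    have hQ : (q.map (SimpleGraph.Embedding.induce _).toHom).IsPath :=
      SimpleGraph.Walk.map_isPath_of_injective
        Subtype.val_injective hq
    have heq := congrArg Subtype.val (ht.2.path_unique ⟨_, hP⟩ ⟨_, hQ⟩)
    have hin : p w ∈ (q'.concat hadj.symm).support := by
      simp [SimpleGraph.Walk.support_concat]
    simp only at heq
    rw [heq] at hin
    replace hin := (SimpleGraph.Walk.support_map (SimpleGraph.Embedding.induce _).toHom q) ▸ (show p w ∈ (q.map (SimpleGraph.Embedding.induce _).toHom).support from hin)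
    rw [List.mem_map] at hin
    obtain ⟨x, -, hx⟩ := hin
    rw [← hx]
    exact x.2
  · intro h
    refine ⟨h0, fun s => ?_⟩
    have hrS := (hmem s r).2 (by rw [hr]; exact Fin.zero_le _)
    have key : ∀ d : ℕ, ∀ x : U, t.dist r x = d →
        ∀ hx : x ∈ (⇑σ '' {i : Fin n | i ≤ s}),
        (t.induce (⇑σ '' {i : Fin n | i ≤ s})).Reachable ⟨x, hx⟩ ⟨r, hrS⟩ := by
      intro d
      induction d with
      | zero =>
        intro x hd hx
        have : r = x := (ht.1.dist_eq_zero_iff).1 hd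
        subst this
        exact SimpleGraph.Reachable.refl _
      | succ d ih =>
        intro x hd hx
        have hxr : x ≠ r := by
          rintro rfl
          simp at hd
        obtain ⟨hadj, hd'⟩ := hp x hxr
        have hpS := (hmem s (p x)).2 ((h x hxr).le.trans ((hmem s x).1 hx))
        refine SimpleGraph.Reachable.trans ?_ (ih (p x) (by omega) hpS)
        apply SimpleGraph.Adj.reachable
        simpa using hadj
    haveI : Nonempty (⇑σ '' {i : Fin n | i ≤ s}) := ⟨⟨r, hrS⟩⟩
    exact ⟨fun x y => (key _ x.1 rfl x.2).trans (key _ y.1 rfl y.2).symm⟩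

/-- **Transposition lemma (Lemma `swap_valid`).**  Let `t` be a tree on `U`
rooted at `r = π 0`, with parent map `p` (for `w ≠ r`, `p w` is the neighbor of
`w` on the path from `w` to `r`).  Let `π` be a valid history, let `u, v` be two
nodes, neither equal to the root, occupying positions `i = π⁻¹ u < j = π⁻¹ v`,
and let `π*` be obtained from `π` by swapping the positions of `u` and `v`.
Then `π*` is a valid history iff (1) every child `w` of `u` satisfies
`π⁻¹ w > j`, and (2) the parent of `v` satisfies `π⁻¹ (p v) < i`. -/
theorem swap_valid_history
    (n : ℕ) [NeZero n] (U : Type) [Fintype U] [DecidableEq U]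
    (t : SimpleGraph U) (ht : t.IsTree)
    (π : Fin n ≃ U) (r : U) (hroot : π 0 = r)
    (hπ : π ∈ histSet n r t)
    (p : U → U)
    (hp : ∀ w : U, w ≠ r → t.Adj w (p w) ∧ t.dist r (p w) + 1 = t.dist r w)
    (u v : U) (hu : u ≠ r) (hv : v ≠ r)
    (hij : π.symm u < π.symm v) :
    (Equiv.swap (π.symm u) (π.symm v)).trans π ∈ histSet n r t ↔
      ((∀ w : U, w ≠ r → p w = u → π.symm v < π.symm w) ∧
        π.symm (p v) < π.symm u) := by
  have hr : π.symm r = 0 := by rw [← hroot]; simp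
  have hi0 : π.symm u ≠ 0 := fun h => hu (π.symm.injective (h.trans hr.symm))
  have hj0 : π.symm v ≠ 0 := fun h => hv (π.symm.injective (h.trans hr.symm))
  have hpar := (mem_histSet_iff_parent n U t ht r p hp π hroot).1 hπ
  rw [mem_histSet_iff_parent n U t ht r p hp _ (by
    rw [Equiv.trans_apply, Equiv.swap_apply_of_ne_of_ne hi0.symm hj0.symm, hroot])]
  set σ := (Equiv.swap (π.symm u) (π.symm v)).trans π with hσ
  have hσu : σ.symm u = π.symm v := by simp [hσ]
  have hσv : σ.symm v = π.symm u := by simp [hσ]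
  have hσo : ∀ x, x ≠ u → x ≠ v → σ.symm x = π.symm x := by
    intro x hxu hxv
    simp only [hσ, Equiv.symm_trans_apply, Equiv.symm_swap]
    exact Equiv.swap_apply_of_ne_of_ne (fun h => hxu (π.symm.injective h))
      (fun h => hxv (π.symm.injective h))
  clear_value σ
  have huv : u ≠ v := by rintro rfl; exact lt_irrefl _ hij
  constructor
  · intro h
    constructor
    · intro w hw hwu
      have h1 := h w hw
      rw [hwu, hσu] at h1
      have hwne : w ≠ u := by rintro rfl; rw [hσu] at h1; exact absurd h1 (lt_irrefl _)
      have hwnv : w ≠ v := by rintro rfl; rw [hσv] at h1; exact absurd h1 hij.asymm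
      rwa [hσo w hwne hwnv] at h1
    · have h1 := h v hv
      have hne : p v ≠ v := fun e => (hp v hv).1.ne e.symm
      have hnu : p v ≠ u := by
        intro e; rw [e, hσu, hσv] at h1; exact h1.asymm hij
      rwa [hσv, hσo _ hnu hne] at h1
  · rintro ⟨h1, h2⟩ w hw
    have hne : p w ≠ w := fun e => (hp w hw).1.ne e.symm
    have hw1 := hpar w hw
    by_cases hwu : w = u
    · subst hwu
      have hnv : p w ≠ v := by intro e; rw [e] at hw1; exact hw1.asymm hij
      rw [hσu, hσo _ hne hnv]
      exact hw1.trans hij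
    by_cases hwv : w = v
    · subst hwv
      have hnu : p w ≠ u := by intro e; rw [e] at h2; exact lt_irrefl _ h2
      rw [hσv, hσo _ hnu hne]
      exact h2
    rw [hσo w hwu hwv]
    by_cases hpu : p w = u
    · rw [hpu, hσu]; exact h1 w hw hpu
    by_cases hpv : p w = v
    · rw [hpv] at hw1
      rw [hpv, hσv]; exact hij.trans hw1
    rw [hσo _ hpu hpv]
    exact hw1
end
end

section
/- For every q ≥ 1 there exists a constant C_q > 0, depending only on q, such that for all n ∈ ℕ and all θ ∈ [0,1], if X has the Binomial(n, θ) distribution then E[X^q] ≤ (2θn)^q + C_q. (One may take C_q = ∫_0^∞ q s^{q−1} e^{−s/8} ds.) -/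
open Finset

noncomputable section

/-- `E[X^q]` for `X ~ Binomial(n, θ)`: `X` is the number of successes in `n`
independent Bernoulli(θ) trials, so
`E[X^q] = Σ_{k=0}^n C(n,k) θ^k (1-θ)^{n-k} k^q` (with `k^q` a real power). -/
def binomialMoment (n : ℕ) (θ : ℝ) (q : ℝ) : ℝ :=
  ∑ k ∈ Finset.range (n + 1),
    (n.choose k : ℝ) * θ ^ k * (1 - θ) ^ (n - k) * (k : ℝ) ^ q

/-- **Binomial moment bound (Lemma `binomial-moment-bound`).**  For every real
`q ≥ 1` there is a constant `C_q > 0`, depending only on `q`, such that for all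
`n ∈ ℕ` and all `θ ∈ [0,1]`, if `X ~ Binomial(n,θ)` then
`E[X^q] ≤ (2θn)^q + C_q`. -/
theorem binomial_moment_bound (q : ℝ) (hq : 1 ≤ q) :
    ∃ C : ℝ, 0 < C ∧ ∀ (n : ℕ) (θ : ℝ), 0 ≤ θ → θ ≤ 1 →
      binomialMoment n θ q ≤ (2 * θ * (n : ℝ)) ^ q + C := by
  have hq0 : 0 < q := by linarith
  refine ⟨(8 * q) ^ q, by positivity, ?_⟩
  intro n θ h0 h1
  have h1' : 0 ≤ 1 - θ := by linarith
  set m : ℝ := θ * n with hm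
  have hm0 : 0 ≤ m := by positivity
  have hpt : ∀ k : ℕ, (k : ℝ) ^ q ≤ (2 * m) ^ q + (8 * q) ^ q * Real.exp (-m) * 2 ^ k := by
    intro k
    by_cases hk : (k : ℝ) ≤ 2 * m
    · have := Real.rpow_le_rpow (Nat.cast_nonneg k) hk hq0.le
      have h2 : 0 ≤ (8 * q) ^ q * Real.exp (-m) * 2 ^ k := by positivity
      linarith
    · push Not at hk
      have hk0 : (0 : ℝ) ≤ k := Nat.cast_nonneg k
      have e1 : (k : ℝ) ≤ (8 * q) * Real.exp (k / 8 / q) := by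
        have := Real.add_one_le_exp ((k : ℝ) / 8 / q)
        have h3 : (k : ℝ) = 8 * q * (k / 8 / q) := by field_simp
        have h4 : 8 * q * ((k : ℝ) / 8 / q) ≤ 8 * q * Real.exp (k / 8 / q) := by
          apply mul_le_mul_of_nonneg_left _ (by positivity)
          linarith
        linarith
      have e2 : (k : ℝ) ^ q ≤ (8 * q) ^ q * Real.exp (k / 8) := by
        have := Real.rpow_le_rpow hk0 e1 hq0.le
        rw [Real.mul_rpow (by positivity) (by positivity), ← Real.exp_mul,
          div_mul_cancel₀ _ hq0.ne'] at this
        exact this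
      have e3 : Real.exp ((k : ℝ) / 8) ≤ Real.exp (-m) * 2 ^ k := by
        have h5 : (2 : ℝ) ^ k = Real.exp (k * Real.log 2) := by
          rw [Real.exp_nat_mul, Real.exp_log (by norm_num)]
        rw [h5, ← Real.exp_add]
        apply Real.exp_le_exp.mpr
        have := Real.log_two_gt_d9
        nlinarith
      have h6 : 0 ≤ (2 * m) ^ q := by positivity
      have h7 : (8 * q) ^ q * Real.exp (k / 8) ≤ (8 * q) ^ q * (Real.exp (-m) * 2 ^ k) :=
        mul_le_mul_of_nonneg_left e3 (by positivity)
      linarith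
  have s1 : ∑ k ∈ Finset.range (n + 1), (n.choose k : ℝ) * θ ^ k * (1 - θ) ^ (n - k) = 1 := by
    have := add_pow θ (1 - θ) n
    rw [add_sub_cancel, one_pow] at this
    refine Eq.trans ?_ this.symm
    exact Finset.sum_congr rfl fun k _ => by ring
  have s2 : ∑ k ∈ Finset.range (n + 1), (n.choose k : ℝ) * θ ^ k * (1 - θ) ^ (n - k) * 2 ^ k
      = (1 + θ) ^ n := by
    have := add_pow (2 * θ) (1 - θ) n
    rw [show 2 * θ + (1 - θ) = 1 + θ by ring] at this
    rw [this]
    exact Finset.sum_congr rfl fun k _ => by rw [mul_pow]; ring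
  have s3 : (1 + θ) ^ n ≤ Real.exp m := by
    rw [hm, mul_comm, Real.exp_nat_mul]
    apply pow_le_pow_left₀ (by linarith)
    have := Real.add_one_le_exp θ
    linarith
  have key : binomialMoment n θ q ≤ (2 * m) ^ q * 1 + (8 * q) ^ q * Real.exp (-m) * (1 + θ) ^ n := by
    have e : (2 * m) ^ q * 1 = (2 * m) ^ q *
        ∑ k ∈ Finset.range (n + 1), (n.choose k : ℝ) * θ ^ k * (1 - θ) ^ (n - k) := by rw [s1]
    rw [e, ← s2, Finset.mul_sum, Finset.mul_sum, ← Finset.sum_add_distrib]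
    unfold binomialMoment
    apply Finset.sum_le_sum
    intro k _
    have hw : 0 ≤ (n.choose k : ℝ) * θ ^ k * (1 - θ) ^ (n - k) := by positivity
    have := mul_le_mul_of_nonneg_left (hpt k) hw
    linarith
  have s4 : (8 * q) ^ q * Real.exp (-m) * (1 + θ) ^ n ≤ (8 * q) ^ q * Real.exp (-m) * Real.exp m :=
    mul_le_mul_of_nonneg_left s3 (by positivity)
  rw [mul_assoc _ _ (Real.exp m), ← Real.exp_add, neg_add_cancel, Real.exp_zero, mul_one] at s4
  rw [mul_assoc 2 θ, ← hm]
  linarith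
end
end

section
/- Let δ > 0, let q > max(2, 1/δ), let θ ≤ n^{−1/2−δ}, and let X_1,…,X_n be nonnegative random variables each stochastically dominated by a Binomial(n−1, θ) random variable. Then E[ n^{−q/2} Σ_{k=1}^n X_k^q ] ≤ 2^q n^{1−qδ} + C_q n^{1−q/2}, where C_q depends only on q; consequently this expectation tends to 0 as n → ∞, and the sequence n^{−1/2}(X_1,…,X_n,0,0,…) converges to the zero sequence in distribution with respect to the ℓ_q metric. -/
open Finset MeasureTheory Filter

noncomputable section

/-- The tail probability `P(B > t)` of a `Binomial(m, θ)` random variable `B`. -/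
def binomialTail (m : ℕ) (θ : ℝ) (t : ℝ) : ℝ :=
  ∑ j ∈ Finset.range (m + 1),
    if t < (j : ℝ) then (m.choose j : ℝ) * θ ^ j * (1 - θ) ^ (m - j) else 0

lemma nd_rpow_le (q : ℝ) (hq : 2 < q) : ∃ K : ℝ, 0 < K ∧ ∀ l x : ℝ, 0 ≤ l → 0 ≤ x →
    x ^ q ≤ (2 * l) ^ q + K * Real.exp (x - l * (Real.exp 1 - 1)) := by
  have he : Real.exp 1 < 3 := by linarith [Real.exp_one_lt_d9]
  have he1 : 1 < Real.exp 1 := by linarith [Real.exp_one_gt_d9]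
  set c : ℝ := (3 - Real.exp 1) / 2 with hc
  have hc0 : 0 < c := by rw [hc]; linarith
  have hq0 : 0 < q := by linarith
  refine ⟨(q / c) ^ q, by positivity, fun l x hl hx => ?_⟩
  rcases le_or_gt x (2 * l) with h | h
  · have := Real.rpow_le_rpow hx h hq0.le
    have h2 : 0 ≤ (q / c) ^ q * Real.exp (x - l * (Real.exp 1 - 1)) := by positivity
    linarith
  · have h1 : x ^ q ≤ (q / c) ^ q * Real.exp (c * x) := by
      have e1 : x = (q / c) * (c * x / q) := by field_simp
      have e2 : x ^ q = (q / c) ^ q * (c * x / q) ^ q := by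
        rw [← Real.mul_rpow (by positivity) (by positivity), ← e1]
      rw [e2]
      gcongr
      calc (c * x / q) ^ q ≤ (Real.exp (c * x / q)) ^ q := by
            apply Real.rpow_le_rpow (by positivity) _ hq0.le
            linarith [Real.add_one_le_exp (c * x / q)]
        _ = Real.exp (c * x) := by
            rw [← Real.exp_mul]; congr 1; field_simp
    have h2 : c * x ≤ x - l * (Real.exp 1 - 1) := by
      rw [hc]; nlinarith
    have h3 : 0 ≤ (2 * l) ^ q := by positivity
    have h4 : (q / c) ^ q * Real.exp (c * x) ≤
        (q / c) ^ q * Real.exp (x - l * (Real.exp 1 - 1)) := by gcongr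
    linarith

def ndp (m : ℕ) (θ : ℝ) (i : ℕ) : ℝ := (m.choose i : ℝ) * θ ^ i * (1 - θ) ^ (m - i)

lemma ndp_nonneg (m : ℕ) (θ : ℝ) (h0 : 0 ≤ θ) (h1 : θ ≤ 1) (i : ℕ) : 0 ≤ ndp m θ i := by
  have : 0 ≤ 1 - θ := by linarith
  unfold ndp; positivity

lemma ndp_sum (m : ℕ) (θ : ℝ) : ∑ i ∈ Finset.range (m + 1), ndp m θ i = 1 := by
  have := add_pow θ (1 - θ) m
  simp only [add_sub_cancel, one_pow] at this
  rw [this]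
  apply Finset.sum_congr rfl
  intro i _
  unfold ndp; ring

lemma ndp_exp (m : ℕ) (θ : ℝ) (h0 : 0 ≤ θ) (h1 : θ ≤ 1) :
    ∑ i ∈ Finset.range (m + 1), ndp m θ i * Real.exp i ≤
      Real.exp (m * θ * (Real.exp 1 - 1)) := by
  have h := add_pow (θ * Real.exp 1) (1 - θ) m
  have h2 : ∑ i ∈ Finset.range (m + 1), ndp m θ i * Real.exp i
      = (θ * Real.exp 1 + (1 - θ)) ^ m := by
    rw [h]
    apply Finset.sum_congr rfl
    intro i _
    have : Real.exp (i : ℝ) = Real.exp 1 ^ i := by rw [← Real.exp_nat_mul]; simp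
    unfold ndp; rw [this, mul_pow]; ring
  rw [h2]
  have h3 : θ * Real.exp 1 + (1 - θ) ≤ Real.exp (θ * (Real.exp 1 - 1)) := by
    have := Real.add_one_le_exp (θ * (Real.exp 1 - 1))
    linarith
  have h4 : 0 ≤ θ * Real.exp 1 + (1 - θ) := by
    have : 0 ≤ 1 - θ := by linarith
    positivity
  calc _ ≤ (Real.exp (θ * (Real.exp 1 - 1))) ^ m := pow_le_pow_left₀ h4 h3 m
    _ = _ := by rw [← Real.exp_nat_mul]; congr 1; ring

lemma nd_moment (q : ℝ) (K : ℝ) (hK : 0 < K) (l : ℝ) (hl : 0 ≤ l)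
    (hKl : ∀ x : ℝ, 0 ≤ x → x ^ q ≤ (2 * l) ^ q + K * Real.exp (x - l * (Real.exp 1 - 1)))
    (m : ℕ) (θ : ℝ) (h0 : 0 ≤ θ) (h1 : θ ≤ 1) (hm : m * θ ≤ l) :
    ∑ i ∈ Finset.range (m + 1), ndp m θ i * (i : ℝ) ^ q ≤ (2 * l) ^ q + K := by
  have he1 : 1 < Real.exp 1 := by linarith [Real.exp_one_gt_d9]
  calc ∑ i ∈ Finset.range (m + 1), ndp m θ i * (i : ℝ) ^ q
      ≤ ∑ i ∈ Finset.range (m + 1), (ndp m θ i * (2 * l) ^ q +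
          (K * Real.exp (- (l * (Real.exp 1 - 1)))) * (ndp m θ i * Real.exp i)) := by
        apply Finset.sum_le_sum
        intro i _
        have := mul_le_mul_of_nonneg_left (hKl i (by positivity)) (ndp_nonneg m θ h0 h1 i)
        refine this.trans (le_of_eq ?_)
        rw [sub_eq_add_neg, Real.exp_add]; ring
    _ = (2 * l) ^ q + (K * Real.exp (- (l * (Real.exp 1 - 1)))) *
          ∑ i ∈ Finset.range (m + 1), ndp m θ i * Real.exp i := by
        rw [Finset.sum_add_distrib, ← Finset.sum_mul, ndp_sum, one_mul, Finset.mul_sum]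
    _ ≤ (2 * l) ^ q + (K * Real.exp (- (l * (Real.exp 1 - 1)))) *
          Real.exp (l * (Real.exp 1 - 1)) := by
        gcongr
        refine (ndp_exp m θ h0 h1).trans ?_
        apply Real.exp_le_exp.2
        apply mul_le_mul_of_nonneg_right hm; linarith
    _ = (2 * l) ^ q + K := by
        rw [mul_assoc, ← Real.exp_add]; simp

lemma nd_dom {Ω : Type} [MeasurableSpace Ω] (μ : Measure Ω) [IsProbabilityMeasure μ]
    (q : ℝ) (hq : 0 < q) (m : ℕ) (θ : ℝ) (Y : Ω → ℝ) (hY : Measurable Y) (hY0 : ∀ ω, 0 ≤ Y ω)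
    (hd : ∀ t : ℝ, (μ {ω | t < Y ω}).toReal ≤ binomialTail m θ t) :
    Integrable (fun ω => Y ω ^ q) μ ∧
      ∫ ω, Y ω ^ q ∂μ ≤ ∑ i ∈ Finset.range (m + 1), ndp m θ i * (i : ℝ) ^ q := by
  have hms : ∀ t : ℝ, MeasurableSet {ω | t < Y ω} := fun t => measurableSet_lt measurable_const hY
  set d : ℕ → ℝ := fun j => ((j + 1 : ℕ) : ℝ) ^ q - (j : ℝ) ^ q with hdd
  have hd0 : ∀ j, 0 ≤ d j := by
    intro j
    have : (j : ℝ) ^ q ≤ ((j + 1 : ℕ) : ℝ) ^ q := by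
      apply Real.rpow_le_rpow (by positivity) _ hq.le
      push_cast; linarith
    simp only [hdd]; linarith
  have htel : ∀ i : ℕ, ∑ j ∈ Finset.range i, d j = (i : ℝ) ^ q := by
    intro i
    rw [Finset.sum_range_sub (fun j : ℕ => (j : ℝ) ^ q)]
    simp [Real.zero_rpow hq.ne']
  have hYm : ∀ᵐ ω ∂μ, Y ω ≤ m := by
    have h := hd m
    have hz : binomialTail m θ m = 0 := by
      unfold binomialTail
      apply Finset.sum_eq_zero
      intro j hj
      rw [if_neg]
      simp at hj ⊢; omega
    rw [hz] at h
    have h2 : (μ {ω | (m : ℝ) < Y ω}).toReal = 0 := le_antisymm h ENNReal.toReal_nonneg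
    rw [ENNReal.toReal_eq_zero_iff] at h2
    have h3 : μ {ω | (m : ℝ) < Y ω} = 0 := h2.resolve_right (measure_ne_top _ _)
    rw [ae_iff]; simpa using h3
  let g : Ω → ℝ := fun ω => ∑ j ∈ Finset.range m, ({ω | (j : ℝ) < Y ω}).indicator (fun _ => d j) ω
  have hgi : ∀ j ∈ Finset.range m, Integrable (({ω | (j : ℝ) < Y ω}).indicator (fun _ => d j)) μ :=
    fun j _ => (integrable_const _).indicator (hms j)
  have hg : Integrable g μ := integrable_finsetSum _ hgi
  have hle : ∀ᵐ ω ∂μ, Y ω ^ q ≤ g ω := by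
    filter_upwards [hYm] with ω hω
    have h1 : ⌈Y ω⌉₊ ≤ m := Nat.ceil_le.2 hω
    calc Y ω ^ q ≤ (⌈Y ω⌉₊ : ℝ) ^ q := Real.rpow_le_rpow (hY0 ω) (Nat.le_ceil _) hq.le
      _ = ∑ j ∈ Finset.range ⌈Y ω⌉₊, d j := (htel _).symm
      _ = ∑ j ∈ Finset.range ⌈Y ω⌉₊, ({ω | (j : ℝ) < Y ω}).indicator (fun _ => d j) ω := by
          apply Finset.sum_congr rfl
          intro j hj
          have : (j : ℝ) < Y ω := Nat.lt_ceil.1 (Finset.mem_range.1 hj)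
          simp [Set.indicator, this]
      _ ≤ g ω := by
          apply Finset.sum_le_sum_of_subset_of_nonneg (Finset.range_mono h1)
          intro j _ _
          exact Set.indicator_nonneg (fun _ _ => hd0 j) ω
  have hint : Integrable (fun ω => Y ω ^ q) μ := by
    refine hg.mono' (hY.pow_const q).aestronglyMeasurable ?_
    filter_upwards [hle] with ω hω
    rwa [Real.norm_of_nonneg (Real.rpow_nonneg (hY0 ω) q)]
  refine ⟨hint, ?_⟩
  calc ∫ ω, Y ω ^ q ∂μ ≤ ∫ ω, g ω ∂μ := integral_mono_ae hint hg hle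
    _ = ∑ j ∈ Finset.range m, (μ {ω | (j : ℝ) < Y ω}).toReal * d j := by
        rw [integral_finsetSum _ hgi]
        apply Finset.sum_congr rfl
        intro j _
        rw [integral_indicator_const _ (hms j)]; rfl
    _ ≤ ∑ j ∈ Finset.range m, binomialTail m θ j * d j :=
        Finset.sum_le_sum fun j _ => mul_le_mul_of_nonneg_right (hd j) (hd0 j)
    _ = ∑ j ∈ Finset.range m, ∑ i ∈ Finset.range (m + 1),
          (if j < i then ndp m θ i * d j else 0) := by
        apply Finset.sum_congr rfl
        intro j _
        unfold binomialTail
        rw [Finset.sum_mul]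
        apply Finset.sum_congr rfl
        intro i _
        simp only [Nat.cast_lt, ndp, ite_mul, zero_mul]
    _ = ∑ i ∈ Finset.range (m + 1), ndp m θ i * (i : ℝ) ^ q := by
        rw [Finset.sum_comm]
        apply Finset.sum_congr rfl
        intro i hi
        rw [← htel i, Finset.mul_sum, ← Finset.sum_filter]
        apply Finset.sum_congr _ (fun _ _ => rfl)
        ext j
        simp at hi ⊢; omega

/-- **ℓ_q negligibility of the noise degrees (key claim in the proof of Theorem
`pa-conf-size`).**  Fix a real `q > max(2, 1/δ)` with `δ > 0`.  There is a
constant `C = C_q`, depending only on `q`, such that: whenever `θ_n ≤ n^{-1/2-δ}`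
and, for each `n`, `X_{n,1},…,X_{n,n}` are nonnegative random variables each
stochastically dominated by a `Binomial(n-1, θ_n)` variable, then
`E[n^{-q/2} Σ_k X_{n,k}^q] ≤ 2^q n^{1-qδ} + C n^{1-q/2}`;  consequently this
expectation tends to `0`, and `n^{-1/2}(X_{n,1},…,X_{n,n},0,0,…)` converges to
the zero sequence in distribution with respect to the `ℓ_q` metric
(equivalently, since the limit is constant, the `ℓ_q` norm `→ 0` in probability). -/
theorem noise_degrees_lq_negligible (q : ℝ) (hq2 : 2 < q) :
    ∃ C : ℝ, 0 < C ∧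
      ∀ (δ : ℝ), 0 < δ → 1 / δ < q →
      ∀ (θ : ℕ → ℝ), (∀ n, 0 ≤ θ n) → (∀ n, θ n ≤ 1) →
        (∀ n : ℕ, 1 ≤ n → θ n ≤ (n : ℝ) ^ (-(1 / 2 : ℝ) - δ)) →
      ∀ (Ω : ℕ → Type) (_ : ∀ n, MeasurableSpace (Ω n)) (μ : ∀ n, Measure (Ω n)),
        (∀ n, IsProbabilityMeasure (μ n)) →
      ∀ (X : ∀ n : ℕ, Fin n → Ω n → ℝ),
        (∀ n k, Measurable (X n k)) →
        (∀ n k ω, 0 ≤ X n k ω) →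
        (∀ (n : ℕ) (k : Fin n) (t : ℝ),
          ((μ n) {ω | t < X n k ω}).toReal ≤ binomialTail (n - 1) (θ n) t) →
      -- (a) the expectation bound, with a constant depending only on q
      ((∀ n : ℕ, 1 ≤ n →
          (∫ ω, (n : ℝ) ^ (-(q / 2)) * ∑ k : Fin n, X n k ω ^ q ∂(μ n)) ≤
            2 ^ q * (n : ℝ) ^ (1 - q * δ) + C * (n : ℝ) ^ (1 - q / 2)) ∧
      -- (b) hence the expectation tends to 0
        Tendsto (fun n : ℕ =>
            ∫ ω, (n : ℝ) ^ (-(q / 2)) * ∑ k : Fin n, X n k ω ^ q ∂(μ n))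
          atTop (nhds 0) ∧
      -- (c) and the rescaled degree sequence converges to the zero sequence in
      --     distribution w.r.t. the ℓ_q metric: its ℓ_q norm → 0 in probability
        ∀ ε : ℝ, 0 < ε →
          Tendsto (fun n : ℕ =>
              ((μ n) {ω | ε ≤ (∑ k : Fin n, X n k ω ^ q) ^ (1 / q) / Real.sqrt n}).toReal)
            atTop (nhds 0)) := by
  obtain ⟨K, hK, hKb⟩ := nd_rpow_le q hq2
  have hq0 : 0 < q := by linarith
  refine ⟨K, hK, ?_⟩
  intro δ hδ hδq θ hθ0 hθ1 hθ Ω _ μ hμ X hXm hX0 hXd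
  have hI : ∀ n k, Integrable (fun ω => X n k ω ^ q) (μ n) := fun n k =>
    (nd_dom (μ n) q hq0 (n - 1) (θ n) (X n k) (hXm n k) (hX0 n k) (hXd n k)).1
  have hIs : ∀ n : ℕ, Integrable (fun ω => (n : ℝ) ^ (-(q / 2)) * ∑ k : Fin n, X n k ω ^ q) (μ n) :=
    fun n => (integrable_finsetSum _ fun k _ => hI n k).const_mul _
  have hnn : ∀ (n : ℕ) (ω : Ω n), 0 ≤ (n : ℝ) ^ (-(q / 2)) * ∑ k : Fin n, X n k ω ^ q := fun n ω =>
    mul_nonneg (by positivity) (Finset.sum_nonneg fun k _ => Real.rpow_nonneg (hX0 n k ω) q)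
  have hA : ∀ n : ℕ, 1 ≤ n →
          (∫ ω, (n : ℝ) ^ (-(q / 2)) * ∑ k : Fin n, X n k ω ^ q ∂(μ n)) ≤
            2 ^ q * (n : ℝ) ^ (1 - q * δ) + K * (n : ℝ) ^ (1 - q / 2) := by
    intro n hn
    have hn0 : (0 : ℝ) < n := by exact_mod_cast hn
    set l : ℝ := (n : ℝ) ^ (1 / 2 - δ) with hl
    have hl0 : 0 ≤ l := by positivity
    have hml : ((n - 1 : ℕ) : ℝ) * θ n ≤ l := by
      have h1 : ((n - 1 : ℕ) : ℝ) ≤ n := by exact_mod_cast Nat.sub_le n 1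
      calc ((n - 1 : ℕ) : ℝ) * θ n ≤ n * (n : ℝ) ^ (-(1 / 2 : ℝ) - δ) :=
            mul_le_mul h1 (hθ n hn) (hθ0 n) hn0.le
        _ = (n : ℝ) ^ (1 : ℝ) * (n : ℝ) ^ (-(1 / 2 : ℝ) - δ) := by rw [Real.rpow_one]
        _ = l := by rw [← Real.rpow_add hn0, hl]; congr 1; ring
    have hk : ∀ k : Fin n, ∫ ω, X n k ω ^ q ∂(μ n) ≤ (2 * l) ^ q + K := fun k =>
      (nd_dom (μ n) q hq0 (n - 1) (θ n) (X n k) (hXm n k) (hX0 n k) (hXd n k)).2.trans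
        (nd_moment q K hK l hl0 (fun x hx => hKb l x hl0 hx) (n - 1) (θ n) (hθ0 n) (hθ1 n) hml)
    rw [integral_const_mul, integral_finsetSum _ fun k _ => hI n k]
    calc (n : ℝ) ^ (-(q / 2)) * ∑ k : Fin n, ∫ ω, X n k ω ^ q ∂(μ n)
        ≤ (n : ℝ) ^ (-(q / 2)) * ∑ _k : Fin n, ((2 * l) ^ q + K) := by
          gcongr with k _
          exact hk k
      _ = (n : ℝ) ^ (-(q / 2)) * ((n : ℝ) ^ (1 : ℝ) * (2 ^ q * (n : ℝ) ^ ((1 / 2 - δ) * q) + K)) := by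
          rw [Finset.sum_const, Finset.card_univ, Fintype.card_fin, nsmul_eq_mul, Real.rpow_one,
            Real.mul_rpow (by norm_num) hl0, hl, ← Real.rpow_mul hn0.le]
      _ = 2 ^ q * ((n : ℝ) ^ (-(q / 2)) * (n : ℝ) ^ (1 : ℝ) * (n : ℝ) ^ ((1 / 2 - δ) * q))
          + K * ((n : ℝ) ^ (-(q / 2)) * (n : ℝ) ^ (1 : ℝ)) := by ring
      _ = _ := by
          rw [← Real.rpow_add hn0, ← Real.rpow_add hn0]
          congr 3 <;> ring
  have hqδ : 1 < q * δ := by rwa [div_lt_iff₀ hδ] at hδq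
  have hB : Tendsto (fun n : ℕ =>
            ∫ ω, (n : ℝ) ^ (-(q / 2)) * ∑ k : Fin n, X n k ω ^ q ∂(μ n))
          atTop (nhds 0) := by
    have hr : ∀ a : ℝ, a < 0 → Tendsto (fun n : ℕ => (n : ℝ) ^ a) atTop (nhds 0) := by
      intro a ha
      have := (tendsto_rpow_neg_atTop (neg_pos.2 ha)).comp (tendsto_natCast_atTop_atTop (R := ℝ))
      simpa [Function.comp_def] using this
    have hlim : Tendsto (fun n : ℕ => 2 ^ q * (n : ℝ) ^ (1 - q * δ) + K * (n : ℝ) ^ (1 - q / 2))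
        atTop (nhds 0) := by
      have := ((hr (1 - q * δ) (by linarith)).const_mul (2 ^ q)).add
        ((hr (1 - q / 2) (by linarith)).const_mul K)
      simpa using this
    refine tendsto_of_tendsto_of_tendsto_of_le_of_le' tendsto_const_nhds hlim ?_ ?_
    · exact Eventually.of_forall fun n => integral_nonneg (hnn n)
    · filter_upwards [eventually_ge_atTop 1] with n hn using hA n hn
  refine ⟨hA, hB, ?_⟩
  intro ε hε
  have hεq : 0 < ε ^ q := by positivity
  have hlim := hB.const_mul (ε ^ q)⁻¹
  rw [mul_zero] at hlim
  refine tendsto_of_tendsto_of_tendsto_of_le_of_le' tendsto_const_nhds hlim ?_ ?_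
  · exact Eventually.of_forall fun n => ENNReal.toReal_nonneg
  · filter_upwards [eventually_ge_atTop 1] with n hn
    have hn0 : (0 : ℝ) < n := by exact_mod_cast hn
    have hM := mul_meas_ge_le_integral_of_nonneg (Eventually.of_forall (hnn n)) (hIs n) (ε ^ q)
    rw [inv_mul_eq_div, le_div_iff₀ hεq, mul_comm]
    refine le_trans ?_ hM
    apply mul_le_mul_of_nonneg_left _ hεq.le
    apply ENNReal.toReal_mono (measure_ne_top _ _)
    apply measure_mono
    intro ω hω
    simp only [Set.mem_setOf_eq] at hω ⊢
    have hS : 0 ≤ ∑ k : Fin n, X n k ω ^ q :=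
      Finset.sum_nonneg fun k _ => Real.rpow_nonneg (hX0 n k ω) q
    have h1 := Real.rpow_le_rpow hε.le hω hq0.le
    refine h1.trans (le_of_eq ?_)
    rw [Real.div_rpow (by positivity) (by positivity), ← Real.rpow_mul hS,
      one_div_mul_cancel hq0.ne', Real.rpow_one, Real.sqrt_eq_rpow, ← Real.rpow_mul hn0.le,
      Real.rpow_neg hn0.le, div_eq_mul_inv, mul_comm]
    congr 3; ring
end
end

section
/- Let G_n ~ PAPER(1, 0, θ) (uniform attachment tree plus Erdős–Rényi(θ) noise) with θ = o(log n / n), and fix η ∈ (0,1). Then, uniformly over nodes with arrival time s ≥ n^η, P( D_{G_n}(s) ≥ D_{G_n}(1) ) ≤ 2(1 + o(1)) · n^{−(2−η)·h(η/(2−η))} as n → ∞, where h(x) = (1+x)log(1+x) − x and D_{G_n}(t) is the degree in G_n of the node with arrival time t. -/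
open scoped Classical
open Finset

noncomputable section

/-- Degree of node `v` in the graph `g`. -/
def degOf {n : ℕ} (g : SimpleGraph (Fin n)) (v : Fin n) : ℕ :=
  (g.neighborSet v).ncard

/-- `h(x) = (1+x)·log(1+x) − x`. -/
def hBennett (x : ℝ) : ℝ := (1 + x) * Real.log (1 + x) - x

/-- Edges of `g` as a finset. -/
def edgesF {n : ℕ} (g : SimpleGraph (Fin n)) : Finset (Sym2 (Fin n)) :=
  Finset.univ.filter (fun e => e ∈ g.edgeSet)

lemma mem_edgesF {n : ℕ} (g : SimpleGraph (Fin n)) (e : Sym2 (Fin n)) :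
    e ∈ edgesF g ↔ e ∈ g.edgeSet := by simp [edgesF]

lemma ncard_edgesF {n : ℕ} (g : SimpleGraph (Fin n)) :
    g.edgeSet.ncard = (edgesF g).card := by
  rw [← Set.ncard_coe_finset]
  congr 1
  ext e
  simp [edgesF]

lemma edgesF_mono {n : ℕ} {g g' : SimpleGraph (Fin n)} (h : g ≤ g') :
    edgesF g ⊆ edgesF g' := by
  intro e he
  rw [mem_edgesF] at *
  exact SimpleGraph.edgeSet_mono h he

lemma card_edgesF_top (n : ℕ) : (edgesF (⊤ : SimpleGraph (Fin n))).card = n * (n - 1) / 2 := by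
  have h := SimpleGraph.card_edgeFinset_top_eq_card_choose_two (V := Fin n)
  rw [Fintype.card_fin, Nat.choose_two_right] at h
  rw [← h]
  congr 1
  ext e
  rw [mem_edgesF, SimpleGraph.mem_edgeFinset]

lemma degOf_le_add {n : ℕ} (T g : SimpleGraph (Fin n)) (s : Fin n) :
    degOf g s ≤ degOf T s + ((edgesF g \ edgesF T).filter (fun e => s ∈ e)).card := by
  unfold degOf
  have h1 : g.neighborSet s ⊆ T.neighborSet s ∪
      {w | s(s, w) ∈ (edgesF g \ edgesF T)} := by
    intro w hw
    by_cases hT : T.Adj s w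
    · left; exact hT
    · right
      simp only [Set.mem_ofPred_eq, Finset.mem_sdiff, mem_edgesF, SimpleGraph.mem_edgeSet]
      exact ⟨hw, hT⟩
  refine (Set.ncard_le_ncard h1 (Set.toFinite _)).trans ((Set.ncard_union_le _ _).trans ?_)
  gcongr
  rw [← Set.ncard_coe_finset]
  refine Set.ncard_le_ncard_of_injOn (fun w => s(s, w)) ?_ ?_ (Set.toFinite _)
  · intro w hw
    simp only [Set.mem_ofPred_eq] at hw
    simp only [Finset.coe_filter, Set.mem_ofPred_eq]
    exact ⟨hw, by simp⟩
  · intro a _ b _ hab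
    exact (Sym2.congr_right).1 hab

lemma degOf_mono {n : ℕ} {T g : SimpleGraph (Fin n)} (h : T ≤ g) (v : Fin n) :
    degOf T v ≤ degOf g v :=
  Set.ncard_le_ncard (fun _ hw => h hw) (Set.toFinite _)

/-- Number of children. -/
def chil {n : ℕ} (pa : Fin n → Fin n) (v : Fin n) : ℕ :=
  (Finset.univ.filter (fun t : Fin n => t.val ≠ 0 ∧ pa t = v)).card

lemma treeGraph_adj {n : ℕ} (pa : Fin n → Fin n) (i j : Fin n) :
    (treeGraph pa).Adj i j ↔ i ≠ j ∧ ((j.val ≠ 0 ∧ pa j = i) ∨ (i.val ≠ 0 ∧ pa i = j)) := by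
  simp [treeGraph, SimpleGraph.fromRel_adj]

lemma chil_le_deg {n : ℕ} {pa : Fin n → Fin n} (hp : IsParentMap pa) (v : Fin n) :
    chil pa v ≤ degOf (treeGraph pa) v := by
  unfold chil degOf
  rw [← Set.ncard_coe_finset]
  refine Set.ncard_le_ncard ?_ (Set.toFinite _)
  intro t ht
  simp only [Finset.coe_filter, Finset.mem_univ, true_and, Set.mem_ofPred_eq] at ht
  rw [SimpleGraph.mem_neighborSet, treeGraph_adj]
  refine ⟨?_, Or.inl ht⟩
  rintro rfl
  have := hp.2 v ht.1
  rw [ht.2] at this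
  omega

lemma deg_le_chil {n : ℕ} (pa : Fin n → Fin n) (v : Fin n) :
    degOf (treeGraph pa) v ≤ chil pa v + 1 := by
  unfold chil degOf
  rw [← Set.ncard_coe_finset]
  have h1 : (treeGraph pa).neighborSet v ⊆
      insert (pa v) (↑(Finset.univ.filter (fun t : Fin n => t.val ≠ 0 ∧ pa t = v))) := by
    intro w hw
    rw [SimpleGraph.mem_neighborSet, treeGraph_adj] at hw
    rcases hw.2 with h | h
    · right; simpa using h
    · left; exact h.2.symm
  exact (Set.ncard_le_ncard h1 (Set.toFinite _)).trans (Set.ncard_insert_le _ _)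

lemma card_edges_tree {n : ℕ} {pa : Fin n → Fin n} (hp : IsParentMap pa) :
    (edgesF (treeGraph pa)).card = n - 1 := by
  have h1 : edgesF (treeGraph pa) =
      (Finset.univ.filter (fun t : Fin n => t.val ≠ 0)).image (fun t => s(pa t, t)) := by
    ext e
    induction e using Sym2.ind with
    | _ i j =>
    rw [mem_edgesF, SimpleGraph.mem_edgeSet, treeGraph_adj]
    simp only [Finset.mem_image, Finset.mem_filter, Finset.mem_univ, true_and, Sym2.eq_iff]
    constructor
    · rintro ⟨_, h | h⟩
      · exact ⟨j, h.1, Or.inl ⟨h.2, rfl⟩⟩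
      · exact ⟨i, h.1, Or.inr ⟨h.2, rfl⟩⟩
    · rintro ⟨t, ht, ⟨h, rfl⟩ | ⟨h, rfl⟩⟩
      · refine ⟨?_, Or.inl ⟨ht, h⟩⟩
        rintro rfl
        have := hp.2 _ ht
        rw [h] at this; omega
      · refine ⟨?_, Or.inr ⟨ht, h⟩⟩
        rintro rfl
        have := hp.2 _ ht
        rw [h] at this; omega
  rw [h1, Finset.card_image_of_injOn]
  · rcases n with _ | m
    · simp
    · have : (Finset.univ.filter (fun t : Fin (m+1) => t.val ≠ 0)) = Finset.univ.erase 0 := by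
        ext t
        simp only [Finset.mem_filter, Finset.mem_univ, true_and, Finset.mem_erase, and_true, ne_eq,
          Fin.ext_iff, Fin.val_zero]
      rw [this, Finset.card_erase_of_mem (Finset.mem_univ _)]
      simp
  · intro a ha b hb hab
    simp only [Finset.coe_filter, Finset.mem_univ, true_and, Set.mem_ofPred_eq] at ha hb
    rcases Sym2.eq_iff.1 hab with h | h
    · exact h.2
    · have h1 := hp.2 _ ha
      have h2 := hp.2 _ hb
      rw [h.1] at h1
      rw [← h.2] at h2
      omega

lemma noise_sum {n : ℕ} (T : SimpleGraph (Fin n)) (hT : (edgesF T).card = n - 1)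
    (s : Fin n) (th l : ℝ) (h0 : 0 ≤ th) (h1 : th ≤ 1) (hl : 1 ≤ l) :
    (∑ g ∈ Finset.univ.filter (fun g : SimpleGraph (Fin n) => T ≤ g),
      th ^ (g.edgeSet.ncard - (n - 1)) * (1 - th) ^ (n * (n - 1) / 2 - g.edgeSet.ncard) *
        l ^ ((edgesF g \ edgesF T).filter (fun e => s ∈ e)).card) ≤ (1 + th * (l - 1)) ^ n := by
  set U := edgesF (⊤ : SimpleGraph (Fin n)) \ edgesF T with hU
  set f : Finset (Sym2 (Fin n)) → ℝ := fun F =>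
    (∏ e ∈ F, (th * (if s ∈ e then l else 1))) * ∏ e ∈ U \ F, (1 - th) with hf
  have hfn : ∀ F, 0 ≤ f F := by
    intro F
    apply mul_nonneg
    · apply Finset.prod_nonneg
      intro e _
      apply mul_nonneg h0
      split_ifs <;> linarith
    · apply Finset.prod_nonneg
      intro e _
      linarith
  have hsub : ∀ g : SimpleGraph (Fin n), edgesF g \ edgesF T ⊆ U := fun g =>
    Finset.sdiff_subset_sdiff (edgesF_mono le_top) (le_refl _)
  have hterm : ∀ g : SimpleGraph (Fin n), T ≤ g →
      th ^ (g.edgeSet.ncard - (n - 1)) * (1 - th) ^ (n * (n - 1) / 2 - g.edgeSet.ncard) *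
        l ^ ((edgesF g \ edgesF T).filter (fun e => s ∈ e)).card = f (edgesF g \ edgesF T) := by
    intro g hg
    have c1 : g.edgeSet.ncard - (n - 1) = (edgesF g \ edgesF T).card := by
      rw [Finset.card_sdiff_of_subset (edgesF_mono hg), hT, ncard_edgesF]
    have c2 : n * (n - 1) / 2 - g.edgeSet.ncard = (U \ (edgesF g \ edgesF T)).card := by
      have a1 := Finset.card_le_card (edgesF_mono hg)
      rw [Finset.card_sdiff_of_subset (hsub g), hU,
        Finset.card_sdiff_of_subset (edgesF_mono hg), hT, ncard_edgesF,
        Finset.card_sdiff_of_subset (edgesF_mono le_top), hT, card_edgesF_top]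
      omega
    rw [c1, c2, hf]
    simp only
    rw [Finset.prod_mul_distrib, Finset.prod_const, Finset.prod_const, Finset.prod_ite]
    simp only [Finset.prod_const, one_pow, mul_one]
    ring
  rw [Finset.sum_congr rfl (fun g hg => hterm g (Finset.mem_filter.1 hg).2)]
  have hinj : Set.InjOn (fun g : SimpleGraph (Fin n) => edgesF g \ edgesF T)
      ↑(Finset.univ.filter (fun g : SimpleGraph (Fin n) => T ≤ g)) := by
    intro a ha b hb hab
    simp only [Finset.coe_filter, Finset.mem_univ, true_and, Set.mem_ofPred_eq] at ha hb
    have key : edgesF a = edgesF b := by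
      rw [← Finset.sdiff_union_of_subset (edgesF_mono ha),
        ← Finset.sdiff_union_of_subset (edgesF_mono hb)]
      simp only at hab
      rw [hab]
    apply SimpleGraph.edgeSet_injective
    ext e
    rw [← mem_edgesF, ← mem_edgesF, key]
  rw [← Finset.sum_image (f := f) hinj]
  have step1 : ∑ F ∈ (Finset.univ.filter (fun g : SimpleGraph (Fin n) => T ≤ g)).image
      (fun g => edgesF g \ edgesF T), f F ≤ ∑ F ∈ U.powerset, f F := by
    apply Finset.sum_le_sum_of_subset_of_nonneg
    · intro F hF
      obtain ⟨g, _, rfl⟩ := Finset.mem_image.1 hF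
      exact Finset.mem_powerset.2 (hsub g)
    · intro F _ _
      exact hfn F
  refine step1.trans ?_
  rw [hf, ← Finset.prod_add]
  have step2 : ∀ e ∈ U, th * (if s ∈ e then l else 1) + (1 - th) =
      if s ∈ e then 1 + th * (l - 1) else 1 := by
    intro e _
    split_ifs <;> ring
  rw [Finset.prod_congr rfl step2, Finset.prod_ite]
  simp only [Finset.prod_const, one_pow, mul_one]
  apply pow_le_pow_right₀
  · nlinarith
  · calc (U.filter (fun e => s ∈ e)).card
        ≤ ((Finset.univ : Finset (Fin n)).image (fun w => s(s, w))).card := by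
          apply Finset.card_le_card
          intro e he
          obtain ⟨w, hw⟩ := Sym2.mem_iff_exists.1 (Finset.mem_filter.1 he).2
          exact Finset.mem_image.2 ⟨w, Finset.mem_univ _, hw.symm⟩
      _ ≤ n := by
          refine Finset.card_image_le.trans ?_
          simp

lemma apa_eq {n : ℕ} (pa : Fin n → Fin n) :
    apaProb 1 0 pa = ∏ t : Fin n, (if 2 ≤ t.val then 1 / (t.val : ℝ) else 1) := by
  unfold apaProb
  apply Finset.prod_congr rfl
  intro t _
  split_ifs <;> simp

/-- per-step weight -/
def wt {n : ℕ} (r s : Fin n) (l : ℝ) (t i : Fin n) : ℝ :=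
  if t.val = 0 then (if i = t then 1 else 0)
  else if i.val < t.val then
    (1 / (t.val : ℝ)) * ((if i = s then l else 1) * (if i = r then l⁻¹ else 1)) else 0

lemma prod_wt {n : ℕ} (r s : Fin n) (l : ℝ) (pa : Fin n → Fin n) :
    (if IsParentMap pa then apaProb 1 0 pa * (l ^ chil pa s * l⁻¹ ^ chil pa r) else 0)
      = ∏ t, wt r s l t (pa t) := by
  split_ifs with hp
  · have e1 : ∀ (v : Fin n) (x : ℝ), x ^ chil pa v =
        ∏ t : Fin n, if t.val ≠ 0 ∧ pa t = v then x else 1 := by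
      intro v x
      rw [Finset.prod_ite]
      simp [chil]
    rw [apa_eq, e1, e1, ← Finset.prod_mul_distrib, ← Finset.prod_mul_distrib]
    apply Finset.prod_congr rfl
    intro t _
    unfold wt
    by_cases ht : t.val = 0
    · simp [ht, hp.1 t ht]
    · have h2 := hp.2 t ht
      simp only [ht, ne_eq, not_false_eq_true, true_and, if_false, h2, if_true]
      by_cases h3 : 2 ≤ t.val
      · simp [h3]
      · have : t.val = 1 := by omega
        simp [this]
  · by_contra hne
    apply hp
    have hz : ∀ t, wt r s l t (pa t) ≠ 0 := by
      intro t h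
      exact hne (Finset.prod_eq_zero (Finset.mem_univ t) h).symm
    constructor
    · intro t ht
      by_contra h
      exact hz t (by simp [wt, ht, h])
    · intro t ht
      by_contra h
      exact hz t (by simp [wt, ht, h])

lemma sum_wt {n : ℕ} (r s : Fin n) (hr : r.val = 0) (hs : s.val ≠ 0) (l : ℝ) (hl : 1 ≤ l)
    (t : Fin n) :
    ∑ i, wt r s l t i ≤ Real.exp ((-(1 - l⁻¹) + (if s.val < t.val then l - 1 else 0)) *
      (t.val : ℝ)⁻¹) := by
  by_cases ht : t.val = 0
  · simp [wt, ht]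
  · have htp : (0 : ℝ) < t.val := by exact_mod_cast Nat.pos_of_ne_zero ht
    have e : ∀ i, wt r s l t i = (1 / (t.val : ℝ)) * ((if i.val < t.val then 1 else 0)
        + (if i = r then (l⁻¹ - 1) else 0)
        + (if i = s then (if s.val < t.val then l - 1 else 0) else 0)) := by
      intro i
      have hrs : r ≠ s := by rintro rfl; exact hs hr
      unfold wt
      rw [if_neg ht]
      by_cases h1 : i = r
      · subst h1
        simp [hr, hrs, Nat.pos_of_ne_zero ht]
      · by_cases h2 : i = s
        · subst h2
          by_cases h3 : i.val < t.val <;> simp [h1, h3]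
        · by_cases h3 : i.val < t.val <;> simp [h1, h2, h3]
    rw [Finset.sum_congr rfl (fun i _ => e i), ← Finset.mul_sum, Finset.sum_add_distrib,
      Finset.sum_add_distrib, Finset.sum_ite_eq' , Finset.sum_ite_eq']
    have hc : ∑ i : Fin n, (if i.val < t.val then (1 : ℝ) else 0) = t.val := by
      rw [Finset.sum_boole]
      have : (Finset.univ.filter (fun i : Fin n => i.val < t.val)) = Finset.Iio t := by
        ext i; simp
      rw [this, Fin.card_Iio]
    rw [hc]
    simp only [Finset.mem_univ, if_true]
    refine le_trans (le_of_eq ?_) (Real.add_one_le_exp _)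
    field_simp
    ring

lemma tree_sum {n : ℕ} (r s : Fin n) (hr : r.val = 0) (hs : s.val ≠ 0) (l : ℝ) (hl : 1 ≤ l) :
    (∑ pa : Fin n → Fin n,
      if IsParentMap pa then apaProb 1 0 pa * (l ^ chil pa s * l⁻¹ ^ chil pa r) else 0)
    ≤ Real.exp (∑ t : Fin n, (-(1 - l⁻¹) + (if s.val < t.val then l - 1 else 0)) *
      (t.val : ℝ)⁻¹) := by
  rw [Finset.sum_congr rfl (fun pa _ => prod_wt r s l pa)]
  have h := Finset.prod_univ_sum (fun _ : Fin n => (Finset.univ : Finset (Fin n))) (wt r s l)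
  rw [Fintype.piFinset_univ] at h
  rw [← h, Real.exp_sum]
  apply Finset.prod_le_prod
  · intro t _
    apply Finset.sum_nonneg
    intro i _
    have : 0 ≤ l := by linarith
    unfold wt
    split_ifs <;> positivity
  · intro t _
    exact sum_wt r s hr hs l hl t

lemma main_sum {n : ℕ} (r s : Fin n) (hr : r.val = 0) (hs : s.val ≠ 0) (l : ℝ) (hl : 1 ≤ l)
    (th : ℝ) (h0 : 0 ≤ th) (h1 : th ≤ 1) :
    (∑ g : SimpleGraph (Fin n), if degOf g r ≤ degOf g s then paperProb n 1 0 th g else 0) ≤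
      l * (1 + th * (l - 1)) ^ n *
      Real.exp (∑ t : Fin n, (-(1 - l⁻¹) + (if s.val < t.val then l - 1 else 0)) *
      (t.val : ℝ)⁻¹) := by
  have hlp : 0 < l := by linarith
  set A : SimpleGraph (Fin n) → ℝ := fun g =>
    th ^ (g.edgeSet.ncard - (n - 1)) * (1 - th) ^ (n * (n - 1) / 2 - g.edgeSet.ncard) with hA
  have hAn : ∀ g, 0 ≤ A g := fun g => mul_nonneg (pow_nonneg h0 _) (pow_nonneg (by linarith) _)
  have hapa : ∀ pa : Fin n → Fin n, 0 ≤ apaProb 1 0 pa := by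
    intro pa
    rw [apa_eq]
    apply Finset.prod_nonneg
    intro t _
    split_ifs <;> positivity
  have e1 : ∀ g : SimpleGraph (Fin n),
      (if degOf g r ≤ degOf g s then paperProb n 1 0 th g else 0) =
      ∑ pa : Fin n → Fin n, if degOf g r ≤ degOf g s ∧ IsParentMap pa ∧ treeGraph pa ≤ g then
        A g * apaProb 1 0 pa else 0 := by
    intro g
    by_cases h : degOf g r ≤ degOf g s
    · simp only [h, if_true, true_and, paperProb, Finset.mul_sum, mul_ite, mul_zero, hA]
    · simp [h]
  rw [Finset.sum_congr rfl (fun g _ => e1 g), Finset.sum_comm]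
  have e2 : ∀ pa : Fin n → Fin n,
      (∑ g : SimpleGraph (Fin n), if degOf g r ≤ degOf g s ∧ IsParentMap pa ∧ treeGraph pa ≤ g then
        A g * apaProb 1 0 pa else 0) ≤ (l * (1 + th * (l - 1)) ^ n) *
      (if IsParentMap pa then apaProb 1 0 pa * (l ^ chil pa s * l⁻¹ ^ chil pa r) else 0) := by
    intro pa
    by_cases hp : IsParentMap pa
    swap
    · simp [hp]
    have hns := noise_sum (treeGraph pa) (card_edges_tree hp) s th l h0 h1 hl
    rw [if_pos hp]
    set K := apaProb 1 0 pa * (l ^ chil pa s * l⁻¹ ^ chil pa r) * l with hK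
    have hKn : 0 ≤ K := by
      have := hapa pa
      positivity
    have : (∑ g : SimpleGraph (Fin n),
        if degOf g r ≤ degOf g s ∧ IsParentMap pa ∧ treeGraph pa ≤ g then
        A g * apaProb 1 0 pa else 0) ≤
        ∑ g : SimpleGraph (Fin n), if treeGraph pa ≤ g then K * (A g *
          l ^ ((edgesF g \ edgesF (treeGraph pa)).filter (fun e => s ∈ e)).card) else 0 := by
      apply Finset.sum_le_sum
      intro g _
      have hnn : 0 ≤ A g * l ^ ((edgesF g \ edgesF (treeGraph pa)).filter (fun e => s ∈ e)).card :=
        mul_nonneg (hAn g) (by positivity)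
      by_cases hg : treeGraph pa ≤ g
      swap
      · simp [hg]
      rw [if_pos hg]
      split_ifs with hd
      swap
      · exact mul_nonneg hKn hnn
      set k := ((edgesF g \ edgesF (treeGraph pa)).filter (fun e => s ∈ e)).card with hk
      have d1 : chil pa r ≤ chil pa s + 1 + k := by
        have := chil_le_deg hp r
        have := degOf_mono hg r
        have := degOf_le_add (treeGraph pa) g s
        have := deg_le_chil pa s
        omega
      have d2 : 1 ≤ l ^ chil pa s * l⁻¹ ^ chil pa r * l * l ^ k := by
        have : l ^ chil pa r ≤ l ^ (chil pa s + 1 + k) := pow_le_pow_right₀ hl d1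
        rw [inv_pow]
        have e : l ^ chil pa s * (l ^ chil pa r)⁻¹ * l * l ^ k =
            l ^ (chil pa s + 1 + k) / l ^ chil pa r := by
          rw [pow_add, pow_add, pow_one]; field_simp
        rw [e, le_div_iff₀ (by positivity)]
        linarith
      have d3 : 0 ≤ A g * apaProb 1 0 pa := mul_nonneg (hAn g) (hapa pa)
      calc A g * apaProb 1 0 pa ≤ A g * apaProb 1 0 pa *
            (l ^ chil pa s * l⁻¹ ^ chil pa r * l * l ^ k) := le_mul_of_one_le_right d3 d2
        _ = K * (A g * l ^ k) := by rw [hK]; ring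
    refine this.trans ?_
    rw [← Finset.sum_filter, ← Finset.mul_sum]
    refine (mul_le_mul_of_nonneg_left hns hKn).trans (le_of_eq ?_)
    rw [hK]; ring
  refine (Finset.sum_le_sum (fun pa _ => e2 pa)).trans ?_
  rw [← Finset.mul_sum]
  apply mul_le_mul_of_nonneg_left (tree_sum r s hr hs l hl)
  have : 0 ≤ th * (l - 1) := mul_nonneg h0 (by linarith)
  positivity

lemma harm_lower (n : ℕ) (hn : 1 ≤ n) :
    Real.log n ≤ ∑ t ∈ Finset.range n, (t : ℝ)⁻¹ := by
  induction n, hn using Nat.le_induction with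
  | base => simp
  | succ n hn ih =>
    rw [Finset.sum_range_succ]
    have hnp : (0 : ℝ) < n := by exact_mod_cast hn
    have h := Real.log_le_sub_one_of_pos (x := ((n + 1 : ℕ) : ℝ) / n) (by positivity)
    rw [Real.log_div (by positivity) (by positivity)] at h
    have e : ((n + 1 : ℕ) : ℝ) / n - 1 = (n : ℝ)⁻¹ := by
      push_cast; field_simp; ring
    linarith

lemma harm_upper (s n : ℕ) (hs : 1 ≤ s) (hn : s ≤ n) :
    ∑ t ∈ Finset.range (n + 1), (if s < t then (t : ℝ)⁻¹ else 0) ≤ Real.log n - Real.log s := by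
  induction n, hn using Nat.le_induction with
  | base =>
    rw [Finset.sum_eq_zero]
    · simp
    · intro t ht
      have := Finset.mem_range.1 ht
      rw [if_neg (by omega)]
  | succ n hn ih =>
    rw [Finset.sum_range_succ, if_pos (by omega)]
    have hnp : (0 : ℝ) < n := by exact_mod_cast (by omega : 0 < n)
    have h := Real.one_sub_inv_le_log_of_pos (x := ((n + 1 : ℕ) : ℝ) / n) (by positivity)
    rw [Real.log_div (by positivity) (by positivity)] at h
    have e : 1 - (((n + 1 : ℕ) : ℝ) / n)⁻¹ = ((n + 1 : ℕ) : ℝ)⁻¹ := by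
      push_cast; field_simp; ring
    linarith

lemma exponent_le {n : ℕ} (s : Fin n) (hs : s.val ≠ 0) (l : ℝ) (hl : 1 ≤ l) :
    ∑ t : Fin n, (-(1 - l⁻¹) + (if s.val < t.val then l - 1 else 0)) * (t.val : ℝ)⁻¹ ≤
      -(1 - l⁻¹) * Real.log n + (l - 1) * (Real.log n - Real.log s.val) := by
  have hn := s.isLt
  have h1 := harm_lower n (by omega)
  have h2 := harm_upper s.val (n - 1) (by omega) (by omega)
  rw [Nat.sub_add_cancel (by omega)] at h2
  have h3 : Real.log ((n - 1 : ℕ) : ℝ) ≤ Real.log n := by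
    apply Real.log_le_log
    · exact_mod_cast (by omega : 0 < n - 1)
    · exact_mod_cast (by omega : n - 1 ≤ n)
  have e : ∑ t : Fin n, (-(1 - l⁻¹) + (if s.val < t.val then l - 1 else 0)) * (t.val : ℝ)⁻¹ =
      -(1 - l⁻¹) * (∑ t ∈ Finset.range n, (t : ℝ)⁻¹) +
      (l - 1) * ∑ t ∈ Finset.range n, (if s.val < t then (t : ℝ)⁻¹ else 0) := by
    rw [Fin.sum_univ_eq_sum_range (fun t : ℕ =>
      (-(1 - l⁻¹) + (if s.val < t then l - 1 else 0)) * (t : ℝ)⁻¹) n,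
      Finset.mul_sum, Finset.mul_sum, ← Finset.sum_add_distrib]
    apply Finset.sum_congr rfl
    intro t _
    split_ifs <;> ring
  rw [e]
  have hli : l⁻¹ ≤ 1 := inv_le_one_of_one_le₀ hl
  apply add_le_add
  · nlinarith
  · apply mul_le_mul_of_nonneg_left _ (by linarith)
    linarith

lemma gap (η : ℝ) (hη0 : 0 < η) (hη1 : η < 1) :
    (2 - η) * hBennett (η / (2 - η)) < η ^ 2 / (2 * (2 - η)) := by
  have h2 : 0 < 2 - η := by linarith
  have e : 1 + η / (2 - η) = 2 / (2 - η) := by field_simp; ring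
  unfold hBennett
  rw [e]
  have hz : 1 < 2 / (2 - η) := by rw [lt_div_iff₀ h2]; linarith
  have h := Real.self_lt_sinh_iff.2 (Real.log_pos hz)
  rw [Real.sinh_log (by linarith)] at h
  have e2 : (2 - η) * (2 / (2 - η) * Real.log (2 / (2 - η)) - η / (2 - η)) =
      2 * Real.log (2 / (2 - η)) - η := by field_simp
  have e3 : η ^ 2 / (2 * (2 - η)) = 2 * ((2 / (2 - η) - (2 / (2 - η))⁻¹) / 2) - η := by
    field_simp; ring
  rw [e2, e3]
  linarith

lemma eventual_bound
    (η : ℝ) (hη0 : 0 < η) (hη1 : η < 1)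
    (θ : ℕ → ℝ) (hθ0 : ∀ n, 0 ≤ θ n) (hθ1 : ∀ n, θ n ≤ 1)
    (hθ : Filter.Tendsto (fun n : ℕ => θ n * (n : ℝ) / Real.log (n : ℝ))
      Filter.atTop (nhds 0)) :
    ∃ N : ℕ, ∀ n, N ≤ n → ∀ (s : Fin n), (n : ℝ) ^ η ≤ ((s.val : ℝ) + 1) →
        (∑ g : SimpleGraph (Fin n),
            if degOf g ⟨0, s.pos⟩ ≤ degOf g s then paperProb n 1 0 (θ n) g else 0) ≤
          (n : ℝ) ^ (-(2 - η) * hBennett (η / (2 - η))) := by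
  have h2 : 0 < 2 - η := by linarith
  set l : ℝ := 2 / (2 - η) with hl
  have hl1 : 1 < l := by rw [hl, lt_div_iff₀ h2]; linarith
  have hlp : 0 < l := by linarith
  set B := (2 - η) * hBennett (η / (2 - η)) with hB
  set A := η ^ 2 / (2 * (2 - η)) with hA
  have hAB : B < A := gap η hη0 hη1
  have hAl : A = (1 - l⁻¹) - (l - 1) * (1 - η) := by
    rw [hA, hl]; field_simp; ring
  set δ := (A - B) / 2 with hδ
  have hδp : 0 < δ := by rw [hδ]; linarith
  have ev1 : ∀ᶠ n : ℕ in Filter.atTop, θ n * (n : ℝ) / Real.log (n : ℝ) < δ / (l - 1) :=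
    hθ.eventually (gt_mem_nhds (div_pos hδp (by linarith)))
  have tl : Filter.Tendsto (fun n : ℕ => Real.log (n : ℝ)) Filter.atTop Filter.atTop :=
    Real.tendsto_log_atTop.comp tendsto_natCast_atTop_atTop
  have ev2 := tl.eventually_ge_atTop ((Real.log l + (l - 1) * Real.log 2) / δ)
  have ev3 := Filter.eventually_ge_atTop (α := ℕ) 2
  obtain ⟨N, hN⟩ := Filter.eventually_atTop.1 (ev1.and (ev2.and ev3))
  refine ⟨N, fun n hn s hs => ?_⟩
  obtain ⟨b1, b2, b3⟩ := hN n hn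
  have hn1 : (1 : ℝ) < n := by exact_mod_cast (by omega : 1 < n)
  have hL : 0 < Real.log n := Real.log_pos hn1
  rw [div_lt_iff₀ hL] at b1
  rw [div_le_iff₀ hδp] at b2
  have hs0 : s.val ≠ 0 := by
    intro h
    rw [h] at hs
    have := Real.one_lt_rpow hn1 hη0
    norm_num at hs
    linarith
  have hs1 : (1 : ℝ) ≤ s.val := by exact_mod_cast Nat.pos_of_ne_zero hs0
  have hls : η * Real.log n - Real.log 2 ≤ Real.log s.val := by
    have h := Real.log_le_log (by positivity) (hs.trans (by linarith : (s.val : ℝ) + 1 ≤ 2 * s.val))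
    rw [Real.log_rpow (by linarith), Real.log_mul (by norm_num) (by linarith)] at h
    linarith
  refine (main_sum ⟨0, s.pos⟩ s rfl hs0 l hl1.le (θ n) (hθ0 n) (hθ1 n)).trans ?_
  have hx : 0 ≤ θ n * (l - 1) := mul_nonneg (hθ0 n) (by linarith)
  have p1 : (1 + θ n * (l - 1)) ^ n ≤ Real.exp (n * (θ n * (l - 1))) := by
    rw [Real.exp_nat_mul]
    apply pow_le_pow_left₀ (by linarith)
    linarith [Real.add_one_le_exp (θ n * (l - 1))]
  have p2 := Real.exp_le_exp.2 (exponent_le s hs0 l hl1.le)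
  have p3 : (n : ℝ) * (θ n * (l - 1)) ≤ δ * Real.log n := by
    have : θ n * n * (l - 1) ≤ (δ / (l - 1) * Real.log n) * (l - 1) :=
      mul_le_mul_of_nonneg_right b1.le (by linarith)
    have e : (δ / (l - 1) * Real.log n) * (l - 1) = δ * Real.log n := by
      have : l - 1 ≠ 0 := by linarith
      field_simp
    linarith
  have p4 : (l - 1) * (Real.log n - Real.log s.val) ≤
      (l - 1) * ((1 - η) * Real.log n + Real.log 2) :=
    mul_le_mul_of_nonneg_left (by linarith) (by linarith)
  calc l * (1 + θ n * (l - 1)) ^ n * Real.exp _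
      ≤ Real.exp (Real.log l) * Real.exp (n * (θ n * (l - 1))) * Real.exp
        (-(1 - l⁻¹) * Real.log n + (l - 1) * (Real.log n - Real.log s.val)) := by
        rw [Real.exp_log hlp]
        gcongr
    _ ≤ Real.exp (Real.log n * (-B)) := by
        rw [← Real.exp_add, ← Real.exp_add]
        apply Real.exp_le_exp.2
        have : B = A - 2 * δ := by rw [hδ]; ring
        rw [this, hAl]
        nlinarith
    _ = (n : ℝ) ^ (-(2 - η) * hBennett (η / (2 - η))) := by
        rw [Real.rpow_def_of_pos (by linarith), hB, neg_mul]

/-- **Pairwise degree comparison under uniform attachment (key estimate in the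
proof of Theorem `ua-conf-size`).**  Let `G_n ~ PAPER(1,0,θ_n)` (uniform
attachment tree plus Erdős–Rényi(θ_n) noise) with `θ_n = o(log n / n)`, and fix
`η ∈ (0,1)`.  Then, uniformly over nodes with arrival time `s ≥ n^η`
(`s` is `1`-indexed; the node of arrival time `s` is indexed `s-1` below),
`P(D_{G_n}(s) ≥ D_{G_n}(1)) ≤ 2·(1+o(1))·n^{-(2-η)·h(η/(2-η))}` as `n → ∞`. -/
theorem ua_degree_comparison
    (η : ℝ) (hη0 : 0 < η) (hη1 : η < 1)
    (θ : ℕ → ℝ) (hθ0 : ∀ n, 0 ≤ θ n) (hθ1 : ∀ n, θ n ≤ 1)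
    (hθ : Filter.Tendsto (fun n : ℕ => θ n * (n : ℝ) / Real.log (n : ℝ))
      Filter.atTop (nhds 0)) :
    ∃ c : ℕ → ℝ, Filter.Tendsto c Filter.atTop (nhds 0) ∧
      ∀ (n : ℕ) (s : Fin n), (n : ℝ) ^ η ≤ ((s.val : ℝ) + 1) →
        (∑ g : SimpleGraph (Fin n),
            if degOf g ⟨0, s.pos⟩ ≤ degOf g s then paperProb n 1 0 (θ n) g else 0) ≤
          2 * (1 + c n) * (n : ℝ) ^ (-(2 - η) * hBennett (η / (2 - η))) := by
  obtain ⟨N, hN⟩ := eventual_bound η hη0 hη1 θ hθ0 hθ1 hθ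
  let P : (n : ℕ) → Fin n → ℝ := fun n s => ∑ g : SimpleGraph (Fin n),
    if degOf g ⟨0, s.pos⟩ ≤ degOf g s then paperProb n 1 0 (θ n) g else 0
  let x : ℕ → ℝ := fun n => (n : ℝ) ^ (-(2 - η) * hBennett (η / (2 - η)))
  refine ⟨fun n => if N ≤ n then 0 else ∑ s, |P n s| / x n, ?_, ?_⟩
  · apply tendsto_const_nhds.congr'
    filter_upwards [Filter.eventually_ge_atTop N] with n hn
    rw [if_pos hn]
  · intro n s hs
    have hnp : (0 : ℝ) < n := by exact_mod_cast s.pos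
    have hx : 0 < x n := Real.rpow_pos_of_pos hnp _
    change P n s ≤ 2 * (1 + (if N ≤ n then 0 else ∑ s, |P n s| / x n)) * x n
    split_ifs with h
    · have h1 : P n s ≤ x n := hN n h s hs
      linarith
    · have h1 : |P n s| / x n ≤ ∑ s, |P n s| / x n :=
        Finset.single_le_sum (f := fun s => |P n s| / x n)
          (fun i _ => div_nonneg (abs_nonneg _) hx.le) (Finset.mem_univ s)
      rw [div_le_iff₀ hx] at h1
      have h2 := le_abs_self (P n s)
      have h3 := abs_nonneg (P n s)
      nlinarith
end
end
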